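/- Let (A, φ₁, φ₂, ᵗ) be a real second-order probability space with φ₁ tracial and φ₂ cyclically invariant in each argument. Then the family of multilinear functionals κ_{p,q} : A^{p+q} → ℂ (p,q ≥ 1) satisfies the moment–cumulant relation α_{p,q}(x₁,…,x_p,y₁,…,y_q) = Σ_{π ∈ S_ann-nc(p,q)} κ_π(x₁,…,x_p,y₁,…,y_q) + Σ_{π ∈ S_ann-nc(p,q)} κ_π(x₁,…,x_p,y_qᵗ,…,y₁ᵗ) + Σ_{(U,π) ∈ PS′(p,q)} κ_{(U,π)}(x₁,…,x_p,y₁,…,y_q) for all p, q and all x_i, y_j ∈ A, if and only if each κ_{p,q} is given by the explicit formula κ_{p,q}(x₁,…,x_p,y₁,…,y_q) = 2·Σ_{π ∈ S_disc-nc(p,q)} [μ(π,1) + μ(π̂,1)]·α_π(x₁,…,x_p,y₁,…,y_q) + Σ_{π ∈ S_ann-nc(p,q)} μ(π,1)·α_π(x₁,…,x_p,y₁,…,y_q) + Σ_{π ∈ S_ann-nc(p,q)} μ(π,1)·α_π(x₁,…,x_p,y_qᵗ,…,y₁ᵗ) + Σ_{(U,π) ∈ PS′(p,q)} μ(π̂,1)·α_{(U,π)}(x₁,…,x_p,y₁,…,y_q),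 where μ is the Möbius function of the poset S_nc-sd(p,q) and 1 = τ̂_{p,q} is its maximum. -/

import Mathlib

namespace AnnNC

/-- The orbit ("same cycle") setoid of a permutation. -/
def orbitSetoid {α : Type*} (σ : Equiv.Perm α) : Setoid α :=
  ⟨σ.SameCycle, ⟨fun x => Equiv.Perm.SameCycle.refl σ x,
    fun h => h.symm, fun h h' => h.trans h'⟩⟩

/-- Number of orbits (cycles, counting fixed points) of a permutation. -/
noncomputable def numOrbits {α : Type*} (σ : Equiv.Perm α) : ℕ :=
  Nat.card (Quotient (orbitSetoid σ))

/-- Number of blocks of the join `Π(σ) ∨ Π(ρ)` of the orbit partitions. -/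
noncomputable def numJoin {α : Type*} (σ ρ : Equiv.Perm α) : ℕ :=
  Nat.card (Quotient (orbitSetoid σ ⊔ orbitSetoid ρ))

/-- Euler characteristic `χ_ρ(π) = #(ρ) + #(π) + #(π⁻¹ρ) − n`. -/
noncomputable def euler {α : Type*} (ρ π : Equiv.Perm α) : ℤ :=
  (numOrbits ρ : ℤ) + (numOrbits π : ℤ) + (numOrbits (π⁻¹ * ρ) : ℤ) - (Nat.card α : ℤ)

/-- `π` is noncrossing on `ρ`. -/
def IsNoncrossingOn {α : Type*} (π ρ : Equiv.Perm α) : Prop :=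
  euler ρ π = 2 * (numJoin π ρ : ℤ)

/-- Euler characteristic of permutations regarded as permutations of a subset `S`
(for permutations fixing the complement of `S` pointwise). -/
noncomputable def eulerOn {α : Type*} (S : Set α) (ρ π : Equiv.Perm α) : ℤ :=
  ((numOrbits ρ : ℤ) - (Nat.card (Sᶜ : Set α) : ℤ)) +
    ((numOrbits π : ℤ) - (Nat.card (Sᶜ : Set α) : ℤ)) +
    ((numOrbits (π⁻¹ * ρ) : ℤ) - (Nat.card (Sᶜ : Set α) : ℤ)) - (Nat.card (S : Set α) : ℤ)

/-- `π` is noncrossing on `ρ`, both regarded as permutations of the subset `S`. -/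
def IsNoncrossingWithin {α : Type*} (S : Set α) (π ρ : Equiv.Perm α) : Prop :=
  eulerOn S ρ π = 2 * ((numJoin π ρ : ℤ) - (Nat.card (Sᶜ : Set α) : ℤ))

/-- `τ_{p,q} = (1,…,p)(p+1,…,p+q)` as a permutation of `Fin (p+q)`. -/
def tauPQ (p q : ℕ) : Equiv.Perm (Fin (p + q)) :=
  Equiv.permCongr finSumFinEquiv (Equiv.sumCongr (finRotate p) (finRotate q))

/-- Disc-noncrossing permutations: noncrossing on `τ_{p,q}` and the orbit partition
refines that of `τ_{p,q}`. -/
def SDiscNC (p q : ℕ) : Set (Equiv.Perm (Fin (p + q))) :=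
  {π | IsNoncrossingOn π (tauPQ p q) ∧
    ∀ x y : Fin (p + q), π.SameCycle x y → ((x : ℕ) < p ↔ (y : ℕ) < p)}

/-- Annular-noncrossing permutations: noncrossing on `τ_{p,q}` with at least one bridge. -/
def SAnnNC (p q : ℕ) : Set (Equiv.Perm (Fin (p + q))) :=
  {π | IsNoncrossingOn π (tauPQ p q) ∧
    ∃ a b : Fin (p + q), π.SameCycle a b ∧ (a : ℕ) < p ∧ p ≤ (b : ℕ)}

/-- The set of elements lying in bridges of `σ`. -/
def BridgeSet (p q : ℕ) (σ : Equiv.Perm (Fin (p + q))) : Set (Fin (p + q)) :=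
  {x | ∃ a b : Fin (p + q), σ.SameCycle x a ∧ σ.SameCycle x b ∧ (a : ℕ) < p ∧ p ≤ (b : ℕ)}

/-- `π₀` is the permutation induced by `π` on the partition `Π(τ_{p,q})`
(the first–return map of `π` to each of the two sides). -/
def IsPiZero (p q : ℕ) (π π₀ : Equiv.Perm (Fin (p + q))) : Prop :=
  ∀ a : Fin (p + q), ∃ k : ℕ, 0 < k ∧ π₀ a = (π ^ k) a ∧
    (((a : ℕ) < p) ↔ (((π ^ k) a : ℕ) < p)) ∧
    ∀ j : ℕ, 0 < j → j < k → ¬ (((a : ℕ) < p) ↔ (((π ^ j) a : ℕ) < p))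

/-- The order `π ⪯ ρ` for (unhatted) permutations: the orbit partition of `π` refines
that of `ρ` and `π` is noncrossing on `ρ`. -/
def permLe {α : Type*} (π ρ : Equiv.Perm α) : Prop :=
  (∀ x y : α, π.SameCycle x y → ρ.SameCycle x y) ∧ IsNoncrossingOn π ρ

/-- The order relation `π ⪯ ρ̂` in `S_nc-sd(p,q)`, i.e. `Kr(ρ) ⪯ Kr(π)`. -/
def leAnnHat (p q : ℕ) (π ρ : Equiv.Perm (Fin (p + q))) : Prop :=
  permLe (ρ⁻¹ * tauPQ p q) (π⁻¹ * tauPQ p q)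

/-- `σ` is the permutation induced by `π` on the subset `J` (first-return map),
extended by the identity off `J`. -/
def IsInducedOn {α : Type*} (π σ : Equiv.Perm α) (J : Set α) : Prop :=
  (∀ a ∉ J, σ a = a) ∧
  ∀ a ∈ J, ∃ k : ℕ, 0 < k ∧ σ a = (π ^ k) a ∧ (π ^ k) a ∈ J ∧
    ∀ j : ℕ, 0 < j → j < k → (π ^ j) a ∉ J

/-- The size of an orbit of a permutation. -/
noncomputable def orbitSize {α : Type*} (σ : Equiv.Perm α) (c : Quotient (orbitSetoid σ)) : ℕ :=
  Nat.card {x : α // Quotient.mk (orbitSetoid σ) x = c}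

/-- `∏_{U ∈ Π(σ)} (−1)^{|U|−1} C_{|U|−1}`. -/
noncomputable def catProd {α : Type*} (σ : Equiv.Perm α) : ℤ :=
  ∏ᶠ c : Quotient (orbitSetoid σ),
    ((-1 : ℤ) ^ (orbitSize σ c - 1) * (catalan (orbitSize σ c - 1) : ℤ))

/-- The carrier of the poset `S_nc-sd(p,q)`: pairs (permutation, hatted?). -/
def NCSDSet (p q : ℕ) : Set (Equiv.Perm (Fin (p + q)) × Bool) :=
  {z | (z.2 = false ∧ (z.1 ∈ SDiscNC p q ∪ SAnnNC p q)) ∨ (z.2 = true ∧ z.1 ∈ SDiscNC p q)}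

/-- The partial order of `S_nc-sd(p,q)`. -/
def ncsdLe (p q : ℕ) (a b : Equiv.Perm (Fin (p + q)) × Bool) : Prop :=
  (a.2 = false ∧ b.2 = false ∧ permLe a.1 b.1) ∨
  (b.2 = true ∧ permLe (b.1⁻¹ * tauPQ p q) (a.1⁻¹ * tauPQ p q))

end AnnNC
namespace AnnNC

variable {A : Type*} [Ring A] [Algebra ℂ A]

/-- The set of minimal representatives of the cycles of a permutation of `Fin n`. -/
def minReps {n : ℕ} (π : Equiv.Perm (Fin n)) : Set (Fin n) :=
  {a | ∀ b : Fin n, π.SameCycle a b → a ≤ b}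

/-- The product `x_a · x_{π(a)} · x_{π²(a)} ⋯` along the cycle of `a`. -/
noncomputable def cycleList {n : ℕ} (π : Equiv.Perm (Fin n)) (x : Fin n → A) (a : Fin n) : A :=
  ((List.range (Function.minimalPeriod (⇑π) a)).map (fun i => x ((π ^ i) a))).prod

/-- `α_π(x₁,…,x_n) = ∏_{cycles (c₁,…,c_k) of π} φ₁(x_{c₁}⋯x_{c_k})`. -/
noncomputable def alphaPerm {n : ℕ} (φ₁ : A →ₗ[ℂ] ℂ) (π : Equiv.Perm (Fin n))
    (x : Fin n → A) : ℂ :=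
  ∏ᶠ a ∈ minReps π, φ₁ (cycleList π x a)

/-- `κ_π(x₁,…,x_n)`: the product over the cycles of `π` of the free cumulant functional
applied to the entries of the cycle in cyclic order. -/
noncomputable def kappaPerm {n : ℕ} (κ : ∀ m : ℕ, (Fin m → A) → ℂ)
    (π : Equiv.Perm (Fin n)) (x : Fin n → A) : ℂ :=
  ∏ᶠ a ∈ minReps π,
    κ (Function.minimalPeriod (⇑π) a) (fun i => x ((π ^ (i : ℕ)) a))

/-- The vector `(x₁,…,x_p,y₁,…,y_q)`. -/
def joinVec {p q : ℕ} (x : Fin p → A) (y : Fin q → A) : Fin (p + q) → A :=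
  fun i => if h : (i : ℕ) < p then x ⟨i, h⟩
    else y ⟨(i : ℕ) - p, by have := i.isLt; omega⟩

/-- The vector `(y_qᵗ, …, y₁ᵗ)`. -/
def revVec {q : ℕ} (T : A → A) (y : Fin q → A) : Fin q → A :=
  fun j => T (y ⟨q - 1 - (j : ℕ), by have := j.isLt; omega⟩)

/-- Noncrossing permutations of `[n]` (on the single cycle `(1,…,n)`). -/
def SNC (n : ℕ) : Set (Equiv.Perm (Fin n)) := {π | IsNoncrossingOn π (finRotate n)}

/-- `κ_{(U,π)}` for `(U,π) ∈ PS′(p,q)` represented by a disc-noncrossing `π` together with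
the minimal representatives `a`, `b` of the two cycles merged by the special block of `U`:
free cumulants on all other cycles times the second-order cumulant on the two
merged cycles. -/
noncomputable def kappaUPi (κfree : ∀ m : ℕ, (Fin m → A) → ℂ)
    (κ₂ : ∀ r s : ℕ, (Fin r → A) → (Fin s → A) → ℂ)
    {p q : ℕ} (π : Equiv.Perm (Fin (p + q))) (a b : Fin (p + q))
    (z : Fin (p + q) → A) : ℂ :=
  (∏ᶠ c ∈ {c : Fin (p + q) | c ∈ minReps π ∧ c ≠ a ∧ c ≠ b},
      κfree (Function.minimalPeriod (⇑π) c) (fun i => z ((π ^ (i : ℕ)) c))) *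
    κ₂ (Function.minimalPeriod (⇑π) a) (Function.minimalPeriod (⇑π) b)
      (fun i => z ((π ^ (i : ℕ)) a)) (fun i => z ((π ^ (i : ℕ)) b))

/-- `α_{(U,π)}` for `(U,π) ∈ PS′(p,q)`: first-order moments on all cycles other than the
two merged ones, times the second-order moment `φ₂` on the two merged cycles. -/
noncomputable def alphaUPi (φ₁ : A →ₗ[ℂ] ℂ) (φ₂ : A →ₗ[ℂ] A →ₗ[ℂ] ℂ)
    {p q : ℕ} (π : Equiv.Perm (Fin (p + q))) (a b : Fin (p + q))
    (z : Fin (p + q) → A) : ℂ :=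
  (∏ᶠ c ∈ {c : Fin (p + q) | c ∈ minReps π ∧ c ≠ a ∧ c ≠ b}, φ₁ (cycleList π z c)) *
    φ₂ (cycleList π z a) (cycleList π z b)

/-- The second-order moment–cumulant relation (formula (5) of the paper) at `(p,q)`
applied to `x₁,…,x_p, y₁,…,y_q`:
`α_{p,q}(x,y) = Σ_{π ∈ S_ann-nc} κ_π(x,y) + Σ_{π ∈ S_ann-nc} κ_π(x, yᵗ reversed)
  + Σ_{(U,π) ∈ PS′} κ_{(U,π)}(x,y)`. -/
def MomCumRel (φ₂ : A →ₗ[ℂ] A →ₗ[ℂ] ℂ) (T : A →ₗ[ℂ] A)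
    (κfree : ∀ m : ℕ, (Fin m → A) → ℂ)
    (κ₂ : ∀ r s : ℕ, (Fin r → A) → (Fin s → A) → ℂ)
    (p q : ℕ) (x : Fin p → A) (y : Fin q → A) : Prop :=
  φ₂ ((List.ofFn x).prod) ((List.ofFn y).prod) =
    (∑ᶠ π ∈ SAnnNC p q, kappaPerm κfree π (joinVec x y)) +
    (∑ᶠ π ∈ SAnnNC p q, kappaPerm κfree π (joinVec x (revVec (⇑T) y))) +
    (∑ᶠ π ∈ SDiscNC p q,
      ∑ᶠ a ∈ {a : Fin (p + q) | a ∈ minReps π ∧ (a : ℕ) < p},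
        ∑ᶠ b ∈ {b : Fin (p + q) | b ∈ minReps π ∧ p ≤ (b : ℕ)},
          kappaUPi κfree κ₂ π a b (joinVec x y))

end AnnNC

namespace AnnNC

/-- The explicit formula (formula (6) of the paper) for the second-order cumulant
`κ_{p,q}(x₁,…,x_p,y₁,…,y_q)` in terms of moments and the Möbius function `μ` of the poset
`S_nc-sd(p,q)`, whose maximal element is `1 = τ̂_{p,q}` (here `(τ_{p,q}, true)`). -/
def ExplicitCumulantFormula {A : Type*} [Ring A] [Algebra ℂ A]
    (φ₁ : A →ₗ[ℂ] ℂ) (φ₂ : A →ₗ[ℂ] A →ₗ[ℂ] ℂ) (T : A →ₗ[ℂ] A)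
    (κ₂ : ∀ r s : ℕ, (Fin r → A) → (Fin s → A) → ℂ)
    (μ : ∀ p q : ℕ,
      (Equiv.Perm (Fin (p + q)) × Bool) → (Equiv.Perm (Fin (p + q)) × Bool) → ℤ)
    (p q : ℕ) (x : Fin p → A) (y : Fin q → A) : Prop :=
  κ₂ p q x y =
    2 * (∑ᶠ π ∈ SDiscNC p q,
        (((μ p q (π, false) (tauPQ p q, true) + μ p q (π, true) (tauPQ p q, true) : ℤ) : ℂ) *
          alphaPerm φ₁ π (joinVec x y))) +
    (∑ᶠ π ∈ SAnnNC p q,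
        ((μ p q (π, false) (tauPQ p q, true) : ℤ) : ℂ) * alphaPerm φ₁ π (joinVec x y)) +
    (∑ᶠ π ∈ SAnnNC p q,
        ((μ p q (π, false) (tauPQ p q, true) : ℤ) : ℂ) *
          alphaPerm φ₁ π (joinVec x (revVec (⇑T) y))) +
    (∑ᶠ π ∈ SDiscNC p q,
      ∑ᶠ a ∈ {a : Fin (p + q) | a ∈ minReps π ∧ (a : ℕ) < p},
        ∑ᶠ b ∈ {b : Fin (p + q) | b ∈ minReps π ∧ p ≤ (b : ℕ)},
          ((μ p q (π, true) (tauPQ p q, true) : ℤ) : ℂ) * alphaUPi φ₁ φ₂ π a b (joinVec x y))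

end AnnNC

namespace AnnNC

section Orbits

open Equiv Equiv.Perm

variable {α β : Type*}

theorem orbitSetoid_le_iff (σ : Perm α) (r : Setoid α) :
    orbitSetoid σ ≤ r ↔ ∀ x, r x (σ x) := by
  constructor
  · intro h x
    exact h (show σ.SameCycle x (σ x) from ⟨1, by simp⟩)
  · intro h x y hxy
    obtain ⟨i, rfl⟩ := hxy
    induction i with
    | zero => exact r.refl x
    | succ i ih =>
      have : (σ ^ ((i : ℤ) + 1)) x = σ ((σ ^ (i : ℤ)) x) := by
        rw [add_comm, zpow_add, Perm.mul_apply, zpow_one]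
      rw [this]
      exact r.trans ih (h _)
    | pred i ih =>
      have : (σ ^ (-(i : ℤ))) x = σ ((σ ^ (-(i : ℤ) - 1)) x) := by
        rw [← Perm.mul_apply, ← zpow_one_add]
        congr 2
        ring
      rw [this] at ih
      exact r.trans ih (r.symm (h _))

theorem sameCycle_closed {σ : Perm α} {r : Setoid α} (h : ∀ x, r x (σ x)) {x y : α}
    (hxy : σ.SameCycle x y) : r x y :=
  (orbitSetoid_le_iff σ r).2 h hxy

/-- The functions on `α` that are constant on the classes of a setoid. -/
def invariants (s : Setoid α) : Submodule ℚ (α → ℚ) where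
  carrier := {v | s ≤ Setoid.ker v}
  add_mem' := by
    intro v w hv hw x y h
    have h1 : v x = v y := hv h
    have h2 : w x = w y := hw h
    show v x + w x = v y + w y
    rw [h1, h2]
  zero_mem' := fun {_ _} _ => rfl
  smul_mem' := by
    intro c v hv x y h
    have h1 : v x = v y := hv h
    show c * v x = c * v y
    rw [h1]

theorem mem_invariants {s : Setoid α} {v : α → ℚ} : v ∈ invariants s ↔ s ≤ Setoid.ker v :=
  Iff.rfl

/-- Invariant functions are the functions on the quotient. -/
def invariantsEquiv (s : Setoid α) : invariants s ≃ₗ[ℚ] (Quotient s → ℚ) where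
  toFun v := Quotient.lift v.1 (fun _ _ h => v.2 h)
  invFun w := ⟨fun x => w (Quotient.mk s x), fun {_ _} h => congrArg w (Quotient.sound h)⟩
  map_add' v w := by
    ext c
    induction c using Quotient.inductionOn
    rfl
  map_smul' a w := by
    ext c
    induction c using Quotient.inductionOn
    rfl
  left_inv v := rfl
  right_inv w := by
    ext c
    induction c using Quotient.inductionOn
    rfl

theorem finrank_invariants [Finite α] (s : Setoid α) :
    Module.finrank ℚ (invariants s) = Nat.card (Quotient s) := by
  have := Fintype.ofFinite (Quotient s)
  rw [(invariantsEquiv s).finrank_eq, Module.finrank_fintype_fun_eq_card, Nat.card_eq_fintype_card]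

/-- The operator `v ↦ v ∘ σ - v`. -/
noncomputable def diffOp (σ : Perm α) : (α → ℚ) →ₗ[ℚ] (α → ℚ) :=
  LinearMap.funLeft ℚ ℚ σ - LinearMap.id

theorem diffOp_apply (σ : Perm α) (v : α → ℚ) (x : α) : diffOp σ v x = v (σ x) - v x := rfl

theorem ker_diffOp (σ : Perm α) : LinearMap.ker (diffOp σ) = invariants (orbitSetoid σ) := by
  ext v
  rw [LinearMap.mem_ker, mem_invariants, orbitSetoid_le_iff, funext_iff]
  refine forall_congr' fun x => ?_
  rw [diffOp_apply, Pi.zero_apply, sub_eq_zero]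
  exact eq_comm

theorem finrank_range_diffOp [Finite α] (σ : Perm α) :
    Module.finrank ℚ (LinearMap.range (diffOp σ)) + numOrbits σ = Nat.card α := by
  have := Fintype.ofFinite α
  have h := LinearMap.finrank_range_add_finrank_ker (diffOp σ)
  rw [ker_diffOp, finrank_invariants, Module.finrank_fintype_fun_eq_card,
    ← Nat.card_eq_fintype_card] at h
  exact h

theorem single_sub_single_mem [DecidableEq α] (σ : Perm α) (x : α) :
    (Pi.single x 1 - Pi.single (σ x) 1 : α → ℚ) ∈ LinearMap.range (diffOp σ) := by
  refine ⟨Pi.single (σ x) 1, ?_⟩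
  ext y
  rw [diffOp_apply]
  simp only [Pi.single_apply, Pi.sub_apply, EmbeddingLike.apply_eq_iff_eq]

theorem finrank_sup_range [Finite α] (a b : Perm α) :
    Nat.card α ≤ Module.finrank ℚ
      (LinearMap.range (diffOp a) ⊔ LinearMap.range (diffOp b) : Submodule ℚ (α → ℚ))
      + numJoin a b := by
  classical
  have := Fintype.ofFinite α
  set W := (LinearMap.range (diffOp a) ⊔ LinearMap.range (diffOp b) : Submodule ℚ (α → ℚ)) with hW
  have := Fintype.ofFinite (Quotient (orbitSetoid a ⊔ orbitSetoid b))
  let f : (Quotient (orbitSetoid a ⊔ orbitSetoid b) → ℚ) →ₗ[ℚ] (α → ℚ) ⧸ W :=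
    Fintype.linearCombination ℚ (fun c => W.mkQ (Pi.single c.out 1))
  let r : Setoid α := Setoid.ker (fun x => W.mkQ (Pi.single x 1))
  have hr : orbitSetoid a ⊔ orbitSetoid b ≤ r := by
    apply sup_le
    · rw [orbitSetoid_le_iff]
      intro x
      exact (Submodule.Quotient.eq W).2 (Submodule.mem_sup_left (single_sub_single_mem a x))
    · rw [orbitSetoid_le_iff]
      intro x
      exact (Submodule.Quotient.eq W).2 (Submodule.mem_sup_right (single_sub_single_mem b x))
  have hf : Function.Surjective f := by
    rw [← LinearMap.range_eq_top, eq_top_iff]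
    have htop : (⊤ : Submodule ℚ ((α → ℚ) ⧸ W)) = Submodule.map W.mkQ ⊤ := by
      rw [Submodule.map_top, Submodule.range_mkQ]
    rw [htop, ← (Pi.basisFun ℚ α).span_eq, Submodule.map_span, Submodule.span_le]
    rintro _ ⟨_, ⟨x, rfl⟩, rfl⟩
    refine ⟨Pi.single (Quotient.mk _ x) 1, ?_⟩
    have h1 : f (Pi.single (Quotient.mk _ x) 1) =
        W.mkQ (Pi.single (Quotient.mk (orbitSetoid a ⊔ orbitSetoid b) x).out 1) := by
      simp [f]
    rw [h1, Pi.basisFun_apply]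
    exact hr (Quotient.exact (Quotient.out_eq _))
  have h1 := LinearMap.finrank_le_finrank_of_surjective hf
  rw [Module.finrank_fintype_fun_eq_card, ← Nat.card_eq_fintype_card] at h1
  have h2 := Submodule.finrank_quotient_add_finrank W
  rw [Module.finrank_fintype_fun_eq_card, ← Nat.card_eq_fintype_card] at h2
  have h3 : Nat.card (Quotient (orbitSetoid a ⊔ orbitSetoid b)) = numJoin a b := rfl
  omega

theorem finrank_inf_range [Finite α] (a b : Perm α) :
    numOrbits (a * b) ≤ Module.finrank ℚ
      (LinearMap.range (diffOp a) ⊓ LinearMap.range (diffOp b) : Submodule ℚ (α → ℚ))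
      + numJoin a b := by
  have := Fintype.ofFinite α
  let g : invariants (orbitSetoid (a * b)) →ₗ[ℚ] (α → ℚ) := (diffOp a).domRestrict _
  have hker : Module.finrank ℚ (LinearMap.ker g) ≤ numJoin a b := by
    have h1 : Module.finrank ℚ (invariants (orbitSetoid a ⊔ orbitSetoid b)) = numJoin a b :=
      finrank_invariants _
    rw [← h1, LinearEquiv.finrank_eq (Submodule.equivMapOfInjective _
      (Submodule.injective_subtype _) (LinearMap.ker g))]
    apply Submodule.finrank_mono
    rintro _ ⟨⟨v, hv⟩, hk, rfl⟩
    have hva : v ∈ LinearMap.ker (diffOp a) := hk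
    rw [ker_diffOp] at hva
    refine (sup_le (mem_invariants.1 hva) ?_ : _ ≤ Setoid.ker v)
    rw [mem_invariants, orbitSetoid_le_iff] at hv hva
    rw [orbitSetoid_le_iff]
    intro x
    have h1 : v x = v (a (b x)) := hv x
    have h2 : v (b x) = v (a (b x)) := hva (b x)
    exact h1.trans h2.symm
  have hran : LinearMap.range g ≤ LinearMap.range (diffOp a) ⊓ LinearMap.range (diffOp b) := by
    rintro _ ⟨⟨v, hv⟩, rfl⟩
    refine ⟨⟨v, rfl⟩, ⟨-(v ∘ a), ?_⟩⟩
    rw [mem_invariants, orbitSetoid_le_iff] at hv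
    ext x
    have h1 : v x = v (a (b x)) := hv x
    show -(v (a (b x))) - -(v (a x)) = v (a x) - v x
    rw [← h1]
    ring
  have h1 := LinearMap.finrank_range_add_finrank_ker g
  have h2 : Module.finrank ℚ (invariants (orbitSetoid (a * b))) = numOrbits (a * b) :=
    finrank_invariants _
  have h3 := Submodule.finrank_mono hran
  omega

/-- The genus of a pair of permutations is nonnegative. -/
theorem genus_nonneg [Finite α] (a b : Perm α) :
    numOrbits a + numOrbits b + numOrbits (a * b) ≤ Nat.card α + 2 * numJoin a b := by
  have := Fintype.ofFinite α
  have h1 := finrank_range_diffOp a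
  have h2 := finrank_range_diffOp b
  have h3 := finrank_sup_range a b
  have h4 := finrank_inf_range a b
  have h5 := Submodule.finrank_sup_add_finrank_inf_eq
    (LinearMap.range (diffOp a)) (LinearMap.range (diffOp b))
  omega

theorem orbitSetoid_inv (σ : Perm α) : orbitSetoid σ⁻¹ = orbitSetoid σ := by
  ext x y
  exact Perm.sameCycle_inv

theorem numOrbits_inv (σ : Perm α) : numOrbits σ⁻¹ = numOrbits σ := by
  rw [numOrbits, orbitSetoid_inv, numOrbits]

theorem orbitSetoid_sup_inv_mul (π ρ : Perm α) :
    orbitSetoid π ⊔ orbitSetoid (π⁻¹ * ρ) = orbitSetoid π ⊔ orbitSetoid ρ := by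
  apply le_antisymm
  · refine sup_le le_sup_left ?_
    rw [← orbitSetoid_inv π, orbitSetoid_le_iff]
    intro x
    refine Setoid.trans' _ (Setoid.symm' _ ?_) ((?_ : (orbitSetoid π⁻¹ ⊔ orbitSetoid ρ) (ρ x) _))
    · have h := (orbitSetoid_le_iff ρ _).1 (le_sup_right : _ ≤ orbitSetoid π⁻¹ ⊔ orbitSetoid ρ) x
      exact Setoid.symm' _ h
    · exact (orbitSetoid_le_iff π⁻¹ _).1 (le_sup_left : _ ≤ orbitSetoid π⁻¹ ⊔ orbitSetoid ρ) _
  · refine sup_le le_sup_left ?_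
    rw [orbitSetoid_le_iff]
    intro x
    have h1 := (orbitSetoid_le_iff (π⁻¹ * ρ) _).1
      (le_sup_right : _ ≤ orbitSetoid π ⊔ orbitSetoid (π⁻¹ * ρ)) x
    have h2 := (orbitSetoid_le_iff π _).1
      (le_sup_left : _ ≤ orbitSetoid π ⊔ orbitSetoid (π⁻¹ * ρ)) ((π⁻¹ * ρ) x)
    have h3 := Setoid.trans' _ h1 h2
    simpa using h3

theorem numJoin_inv_mul (π ρ : Perm α) : numJoin π (π⁻¹ * ρ) = numJoin π ρ := by
  rw [numJoin, orbitSetoid_sup_inv_mul, numJoin]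

theorem genus_nonneg' [Finite α] (π ρ : Perm α) :
    numOrbits π + numOrbits (π⁻¹ * ρ) + numOrbits ρ ≤ Nat.card α + 2 * numJoin π ρ := by
  have h := genus_nonneg π (π⁻¹ * ρ)
  rwa [numJoin_inv_mul, mul_inv_cancel_left] at h

theorem card_quotient_le [Finite α] {s t : Setoid α} (h : s ≤ t) :
    Nat.card (Quotient t) ≤ Nat.card (Quotient s) :=
  Nat.card_le_card_of_surjective (Quotient.map' (s₂ := t) id (fun _ _ hxy => h hxy)) (by
    intro c
    induction c using Quotient.inductionOn with
    | h x => exact ⟨Quotient.mk s x, rfl⟩)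

theorem eq_of_card_quotient_le [Finite α] {s t : Setoid α} (h : s ≤ t)
    (hc : Nat.card (Quotient s) ≤ Nat.card (Quotient t)) : s = t := by
  refine le_antisymm h fun {x y} hxy => ?_
  let f : Quotient s → Quotient t := Quotient.map' id (fun _ _ hxy => h hxy)
  have hf : Function.Surjective f := by
    intro c
    induction c using Quotient.inductionOn with
    | h x => exact ⟨Quotient.mk s x, rfl⟩
  have hb : Function.Bijective f :=
    (Nat.bijective_iff_surjective_and_card f).2 ⟨hf, le_antisymm hc (card_quotient_le h)⟩
  exact Quotient.exact (hb.1 (a₁ := Quotient.mk s x) (a₂ := Quotient.mk s y) (Quotient.sound hxy))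

theorem numJoin_le_right [Finite α] (π ρ : Perm α) : numJoin π ρ ≤ numOrbits ρ :=
  card_quotient_le le_sup_right

/-- `π` lies on a geodesic from `1` to `ρ`. -/
def Geo (π ρ : Perm α) : Prop :=
  numOrbits π + numOrbits (π⁻¹ * ρ) = Nat.card α + numOrbits ρ

theorem orbits_triangle [Finite α] (π ρ : Perm α) :
    numOrbits π + numOrbits (π⁻¹ * ρ) ≤ Nat.card α + numOrbits ρ := by
  have h1 := genus_nonneg' π ρ
  have h2 := numJoin_le_right π ρ
  omega

theorem Geo.sameCycle [Finite α] {π ρ : Perm α} (h : Geo π ρ) {x y : α}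
    (hxy : π.SameCycle x y) : ρ.SameCycle x y := by
  have h1 := genus_nonneg' π ρ
  have h2 : orbitSetoid ρ = orbitSetoid π ⊔ orbitSetoid ρ :=
    eq_of_card_quotient_le le_sup_right (by
      have : numOrbits ρ ≤ numJoin π ρ := by
        unfold Geo at h
        omega
      exact this)
  have h3 : orbitSetoid π ≤ orbitSetoid ρ := by
    rw [h2]
    exact le_sup_left
  exact h3 hxy

theorem isNoncrossingOn_iff (π ρ : Perm α) : IsNoncrossingOn π ρ ↔
    numOrbits π + numOrbits (π⁻¹ * ρ) + numOrbits ρ = Nat.card α + 2 * numJoin π ρ := by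
  unfold IsNoncrossingOn euler
  omega

theorem permLe_iff_geo [Finite α] (π ρ : Perm α) : permLe π ρ ↔ Geo π ρ := by
  have key : (∀ x y, π.SameCycle x y → ρ.SameCycle x y) → numJoin π ρ = numOrbits ρ := by
    intro h
    have h1 : orbitSetoid π ≤ orbitSetoid ρ := fun {x y} hxy => h x y hxy
    rw [numJoin, sup_eq_right.2 h1, numOrbits]
  unfold permLe
  rw [isNoncrossingOn_iff]
  constructor
  · rintro ⟨h1, h2⟩
    have h3 := key h1
    unfold Geo
    omega
  · intro h
    have h1 : ∀ x y, π.SameCycle x y → ρ.SameCycle x y := fun x y => h.sameCycle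
    have h2 := key h1
    refine ⟨h1, ?_⟩
    unfold Geo at h
    omega

theorem numOrbits_permCongr (e : α ≃ β) (σ : Perm α) :
    numOrbits (e.permCongr σ) = numOrbits σ := by
  symm
  refine Nat.card_congr (Quotient.congr e ?_)
  intro x y
  constructor
  · intro h
    refine sameCycle_closed (r := Setoid.comap e (orbitSetoid (e.permCongr σ))) ?_ h
    intro z
    exact ⟨1, by simp [Equiv.permCongr_apply]⟩
  · intro h
    have := sameCycle_closed (r := Setoid.comap e.symm (orbitSetoid σ))
      (σ := e.permCongr σ) ?_ h
    · have h2 : orbitSetoid σ (e.symm (e x)) (e.symm (e y)) := this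
      rwa [Equiv.symm_apply_apply, Equiv.symm_apply_apply] at h2
    · intro z
      exact ⟨1, by simp [Equiv.permCongr_apply]⟩

theorem numOrbits_conj (g σ : Perm α) : numOrbits (g * σ * g⁻¹) = numOrbits σ := by
  rw [← numOrbits_permCongr g σ]
  rfl

theorem numOrbits_mul_comm (a b : Perm α) : numOrbits (a * b) = numOrbits (b * a) := by
  rw [← numOrbits_conj b (a * b)]
  congr 1
  group

theorem numOrbits_one : numOrbits (1 : Perm α) = Nat.card α := by
  symm
  refine Nat.card_congr (Equiv.ofBijective (Quotient.mk (orbitSetoid 1)) ⟨?_, Quotient.mk_surjective⟩)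
  intro x y h
  exact Perm.sameCycle_one.1 (Quotient.exact h)

theorem eq_one_of_numOrbits [Finite α] {σ : Perm α} (h : Nat.card α ≤ numOrbits σ) : σ = 1 := by
  have h1 : (⊥ : Setoid α) = orbitSetoid σ := eq_of_card_quotient_le bot_le (by
    have h2 : Nat.card (Quotient (⊥ : Setoid α)) ≤ Nat.card α :=
      Nat.card_le_card_of_surjective _ Quotient.mk_surjective
    exact h2.trans h)
  ext x
  have h2 : orbitSetoid σ x (σ x) := ⟨1, by simp⟩
  rw [← h1] at h2
  have h3 : x = σ x := h2
  exact h3.symm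

theorem sameCycle_permCongr (e : α ≃ β) (σ : Perm α) (x y : α) :
    (e.permCongr σ).SameCycle (e x) (e y) ↔ σ.SameCycle x y := by
  have h : ∀ i : ℤ, ((e.permCongr σ) ^ i) (e x) = e ((σ ^ i) x) := by
    intro i
    have : (e.permCongr σ) ^ i = e.permCongr (σ ^ i) :=
      (map_zpow (e.permCongrHom : Perm α ≃* Perm β) σ i).symm
    rw [this]
    simp [Equiv.permCongr_apply]
  constructor
  · rintro ⟨i, hi⟩
    exact ⟨i, e.injective (by rw [← h, hi])⟩
  · rintro ⟨i, hi⟩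
    exact ⟨i, by rw [h, hi]⟩

theorem permCongr_inv_mul (e : α ≃ β) (π ρ : Perm α) :
    (e.permCongr π)⁻¹ * e.permCongr ρ = e.permCongr (π⁻¹ * ρ) := by
  have h1 := map_inv (e.permCongrHom : Perm α ≃* Perm β) π
  have h2 := map_mul (e.permCongrHom : Perm α ≃* Perm β) π⁻¹ ρ
  rw [h1] at h2
  exact h2.symm

theorem geo_permCongr (e : α ≃ β) (π ρ : Perm α) :
    Geo (e.permCongr π) (e.permCongr ρ) ↔ Geo π ρ := by
  unfold Geo
  rw [permCongr_inv_mul, numOrbits_permCongr, numOrbits_permCongr, numOrbits_permCongr,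
    Nat.card_congr e]

end Orbits

end AnnNC

namespace AnnNC

section Words

open Equiv (Perm)
open Equiv.Perm

variable {α β A k : Type*}

/-- A family of functionals is cyclic when it is invariant under rotation of its arguments. -/
def Cyclic (κ : ∀ m : ℕ, (Fin m → A) → k) : Prop :=
  ∀ (m : ℕ) (x : Fin m → A), κ m (x ∘ finRotate m) = κ m x

/-- The entries `z x, z (π x), …` along an orbit. -/
def word (π : Perm α) (z : α → A) (x : α) (m : ℕ) : Fin m → A :=
  fun i => z ((π ^ (i : ℕ)) x)

/-- The value of a cyclic functional on the orbit of `x`. -/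
noncomputable def cyc (κ : ∀ m : ℕ, (Fin m → A) → k) (π : Perm α) (z : α → A) (x : α) : k :=
  κ (Function.minimalPeriod π x) (word π z x _)

theorem cyc_eq (κ : ∀ m : ℕ, (Fin m → A) → k) {π : Perm α} (z : α → A) {x : α} {m : ℕ}
    (h : Function.minimalPeriod π x = m) : cyc κ π z x = κ m (word π z x m) := by
  subst h
  rfl

theorem minimalPeriod_perm_pos [Finite α] (π : Perm α) (x : α) :
    0 < Function.minimalPeriod π x := by
  refine Function.minimalPeriod_pos_of_mem_periodicPts ?_
  exact (Function.Injective.mem_periodicPts π.injective x)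

theorem pow_minimalPeriod_apply (π : Perm α) (x : α) :
    (π ^ (Function.minimalPeriod π x)) x = x := by
  rw [Perm.coe_pow]
  exact Function.isPeriodicPt_minimalPeriod π x

theorem minimalPeriod_perm_apply [Finite α] (π : Perm α) (x : α) :
    Function.minimalPeriod π (π x) = Function.minimalPeriod π x :=
  Function.minimalPeriod_apply (Function.Injective.mem_periodicPts π.injective x)

theorem val_finRotate {m : ℕ} (i : Fin m) :
    ((finRotate m i : Fin m) : ℕ) = if (i : ℕ) + 1 = m then 0 else (i : ℕ) + 1 := by
  cases m with
  | zero => exact i.elim0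
  | succ m =>
    split_ifs with h
    · have : i = Fin.last m := Fin.ext (by simpa using h)
      subst this
      simp
    · rw [coe_finRotate_of_ne_last]
      intro h2
      subst h2
      simp at h

theorem word_apply {π : Perm α} (z : α → A) {x : α} {m : ℕ} (h : (π ^ m) x = x) :
    word π z (π x) m = word π z x m ∘ finRotate m := by
  funext i
  simp only [word, Function.comp_apply, val_finRotate]
  have h1 : (π ^ (i : ℕ)) (π x) = (π ^ ((i : ℕ) + 1)) x := by
    rw [pow_succ, Perm.mul_apply]
  rw [h1]
  split_ifs with h2
  · rw [h2, h]
    rfl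
  · rfl

theorem cyc_apply [Finite α] {κ : ∀ m : ℕ, (Fin m → A) → k} (hκ : Cyclic κ) (π : Perm α)
    (z : α → A) (x : α) : cyc κ π z (π x) = cyc κ π z x := by
  rw [cyc_eq κ z (minimalPeriod_perm_apply π x), word_apply z (pow_minimalPeriod_apply π x), hκ]
  rfl

/-- A function on `α` constant along the orbits of `π`. -/
def OrbInv (π : Perm α) (w : α → k) : Prop := ∀ x, w (π x) = w x

theorem OrbInv.sameCycle {π : Perm α} {w : α → k} (hw : OrbInv π w) {x y : α}
    (h : π.SameCycle x y) : w x = w y :=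
  sameCycle_closed (r := Setoid.ker w) (fun x => (hw x).symm) h

theorem cyc_orbInv [Finite α] {κ : ∀ m : ℕ, (Fin m → A) → k} (hκ : Cyclic κ) (π : Perm α)
    (z : α → A) : OrbInv π (cyc κ π z) :=
  cyc_apply hκ π z

theorem pow_semiconj {f : α → β} {σ : Perm α} {τ : Perm β} (h : ∀ x, f (σ x) = τ (f x)) (n : ℕ)
    (x : α) : f ((σ ^ n) x) = (τ ^ n) (f x) := by
  induction n with
  | zero => rfl
  | succ n ih => rw [pow_succ', pow_succ', Perm.mul_apply, Perm.mul_apply, h, ih]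

theorem minimalPeriod_semiconj {f : α → β} (hf : Function.Injective f) {σ : Perm α} {τ : Perm β}
    (h : ∀ x, f (σ x) = τ (f x)) (x : α) :
    Function.minimalPeriod τ (f x) = Function.minimalPeriod σ x := by
  rw [Function.minimalPeriod_eq_minimalPeriod_iff]
  intro n
  unfold Function.IsPeriodicPt Function.IsFixedPt
  rw [← Perm.coe_pow, ← Perm.coe_pow, ← pow_semiconj h, hf.eq_iff]

theorem word_semiconj {f : α → β} {σ : Perm α} {τ : Perm β}
    (h : ∀ x, f (σ x) = τ (f x)) (z : β → A) (x : α) (m : ℕ) :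
    word τ z (f x) m = word σ (z ∘ f) x m := by
  funext i
  simp only [word, Function.comp_apply, pow_semiconj h]

theorem cyc_semiconj (κ : ∀ m : ℕ, (Fin m → A) → k) {f : α → β} (hf : Function.Injective f)
    {σ : Perm α} {τ : Perm β} (h : ∀ x, f (σ x) = τ (f x)) (z : β → A) (x : α) :
    cyc κ τ z (f x) = cyc κ σ (z ∘ f) x := by
  rw [cyc_eq κ z (minimalPeriod_semiconj hf h x), word_semiconj h]
  rfl

theorem permCongr_semiconj (e : α ≃ β) (σ : Perm α) (x : α) : e (σ x) = e.permCongr σ (e x) := by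
  simp [Equiv.permCongr_apply]

theorem finRotate_pow_zero {n : ℕ} (i : ℕ) (hi : i < n) :
    ((finRotate n) ^ i) ⟨0, by omega⟩ = ⟨i, hi⟩ := by
  induction i with
  | zero => rfl
  | succ i ih =>
    rw [pow_succ', Perm.mul_apply, ih (by omega)]
    apply Fin.ext
    rw [val_finRotate, if_neg (by simp; omega)]

theorem minimalPeriod_finRotate {n : ℕ} (hn : 0 < n) :
    Function.minimalPeriod (finRotate n) ⟨0, hn⟩ = n := by
  have h0 : ((finRotate n) ^ n) ⟨0, hn⟩ = ⟨0, hn⟩ := by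
    obtain ⟨m, rfl⟩ : ∃ m, n = m + 1 := ⟨n - 1, by omega⟩
    rw [pow_succ', Perm.mul_apply, finRotate_pow_zero m (by omega)]
    apply Fin.ext
    rw [val_finRotate, if_pos rfl]
  apply le_antisymm
  · apply Function.IsPeriodicPt.minimalPeriod_le hn
    unfold Function.IsPeriodicPt Function.IsFixedPt
    rw [← Perm.coe_pow]
    exact h0
  · by_contra hlt
    push Not at hlt
    have h1 := pow_minimalPeriod_apply (finRotate n) ⟨0, hn⟩
    rw [finRotate_pow_zero _ hlt] at h1
    have h2 := minimalPeriod_perm_pos (finRotate n) ⟨0, hn⟩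
    have h3 := congrArg Fin.val h1
    simp only at h3
    omega

theorem word_finRotate {n : ℕ} (hn : 0 < n) (z : Fin n → A) :
    word (finRotate n) z ⟨0, hn⟩ n = z := by
  funext i
  simp only [word]
  rw [finRotate_pow_zero _ i.2]

theorem cyc_finRotate (κ : ∀ m : ℕ, (Fin m → A) → k) {n : ℕ} (hn : 0 < n) (z : Fin n → A) :
    cyc κ (finRotate n) z ⟨0, hn⟩ = κ n z := by
  rw [cyc_eq κ z (minimalPeriod_finRotate hn), word_finRotate]

theorem finRotate_sameCycle {n : ℕ} (i j : Fin n) : (finRotate n).SameCycle i j := by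
  have h : ∀ i : Fin n, (finRotate n).SameCycle ⟨0, i.pos⟩ i := fun i =>
    ⟨(i : ℕ), by rw [zpow_natCast, finRotate_pow_zero _ i.2]⟩
  exact (h i).symm.trans (h j)

theorem numOrbits_finRotate {n : ℕ} (hn : 0 < n) : numOrbits (finRotate n) = 1 := by
  unfold numOrbits
  rw [Nat.card_eq_one_iff_unique]
  refine ⟨⟨fun a b => ?_⟩, ⟨Quotient.mk _ ⟨0, hn⟩⟩⟩
  induction a using Quotient.inductionOn
  induction b using Quotient.inductionOn
  exact Quotient.sound (finRotate_sameCycle _ _)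

theorem sumCongr_zpow (σ : Perm α) (τ : Perm β) (i : ℤ) :
    (sumCongr σ τ) ^ i = sumCongr (σ ^ i) (τ ^ i) :=
  (map_zpow (sumCongrHom α β) (σ, τ) i).symm

theorem sameCycle_inl_inl (σ : Perm α) (τ : Perm β) (x y : α) :
    (sumCongr σ τ).SameCycle (Sum.inl x) (Sum.inl y) ↔ σ.SameCycle x y := by
  unfold SameCycle
  simp [sumCongr_zpow]

theorem sameCycle_inr_inr (σ : Perm α) (τ : Perm β) (x y : β) :
    (sumCongr σ τ).SameCycle (Sum.inr x) (Sum.inr y) ↔ τ.SameCycle x y := by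
  unfold SameCycle
  simp [sumCongr_zpow]

theorem not_sameCycle_inl_inr (σ : Perm α) (τ : Perm β) (x : α) (y : β) :
    ¬ (sumCongr σ τ).SameCycle (Sum.inl x) (Sum.inr y) := by
  unfold SameCycle
  simp [sumCongr_zpow]

/-- Orbits of a permutation of a disjoint union preserving both parts. -/
def orbitSumEquiv (σ : Perm α) (τ : Perm β) :
    Quotient (orbitSetoid σ) ⊕ Quotient (orbitSetoid τ) ≃ Quotient (orbitSetoid (sumCongr σ τ)) where
  toFun := Sum.elim
    (Quotient.map' Sum.inl (fun _ _ h => (sameCycle_inl_inl σ τ _ _).2 h))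
    (Quotient.map' Sum.inr (fun _ _ h => (sameCycle_inr_inr σ τ _ _).2 h))
  invFun := Quotient.lift
    (Sum.elim (fun x => Sum.inl (Quotient.mk _ x)) (fun y => Sum.inr (Quotient.mk _ y))) (by
      rintro (x | x) (y | y) h
      · exact congrArg Sum.inl (Quotient.sound ((sameCycle_inl_inl σ τ _ _).1 h))
      · exact absurd h (not_sameCycle_inl_inr σ τ _ _)
      · exact absurd (SameCycle.symm h) (not_sameCycle_inl_inr σ τ _ _)
      · exact congrArg Sum.inr (Quotient.sound ((sameCycle_inr_inr σ τ _ _).1 h)))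
  left_inv := by
    rintro (c | c) <;> induction c using Quotient.inductionOn <;> rfl
  right_inv := by
    intro c
    induction c using Quotient.inductionOn with
    | h x => cases x <;> rfl

theorem numOrbits_sumCongr [Finite α] [Finite β] (σ : Perm α) (τ : Perm β) :
    numOrbits (sumCongr σ τ) = numOrbits σ + numOrbits τ := by
  unfold numOrbits
  rw [← Nat.card_congr (orbitSumEquiv σ τ), Nat.card_sum]

theorem sumCongr_inv_mul (σ σ' : Perm α) (τ τ' : Perm β) :
    (sumCongr σ τ)⁻¹ * sumCongr σ' τ' = sumCongr (σ⁻¹ * σ') (τ⁻¹ * τ') := by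
  rw [sumCongr_inv, sumCongr_mul]

theorem geo_sumCongr [Finite α] [Finite β] (σ σ' : Perm α) (τ τ' : Perm β) :
    Geo (sumCongr σ τ) (sumCongr σ' τ') ↔ Geo σ σ' ∧ Geo τ τ' := by
  unfold Geo
  rw [sumCongr_inv_mul, numOrbits_sumCongr, numOrbits_sumCongr, numOrbits_sumCongr, Nat.card_sum]
  have h1 := orbits_triangle σ σ'
  have h2 := orbits_triangle τ τ'
  omega

theorem exists_sumCongr [Finite α] [Finite β] {ρ : Perm (α ⊕ β)}
    (h : ∀ x y, ¬ ρ.SameCycle (Sum.inl x) (Sum.inr y)) : ∃ σ τ, ρ = sumCongr σ τ := by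
  have h1 : ρ ∈ (sumCongrHom α β).range := by
    apply mem_sumCongrHom_range_of_perm_mapsTo_inl
    rintro _ ⟨x, rfl⟩
    cases hx : ρ (Sum.inl x) with
    | inl y => exact ⟨y, rfl⟩
    | inr y => exact absurd (⟨1, by simpa using hx⟩) (h x y)
  obtain ⟨⟨σ, τ⟩, rfl⟩ := h1
  exact ⟨σ, τ, rfl⟩

theorem Geo.exists_sumCongr [Finite α] [Finite β] {ρ : Perm (α ⊕ β)} {σ : Perm α} {τ : Perm β}
    (h : Geo ρ (sumCongr σ τ)) : ∃ σ' τ', ρ = sumCongr σ' τ' :=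
  AnnNC.exists_sumCongr fun x y hxy => not_sameCycle_inl_inr σ τ x y (h.sameCycle hxy)

theorem sumCongr_inj {σ σ' : Perm α} {τ τ' : Perm β} :
    sumCongr σ τ = sumCongr σ' τ' ↔ σ = σ' ∧ τ = τ' := by
  constructor
  · intro h
    have := sumCongrHom_injective (a₁ := (σ, τ)) (a₂ := (σ', τ')) h
    exact Prod.mk.inj this
  · rintro ⟨rfl, rfl⟩
    rfl

/-- A permutation splits as the orbit of `x` and a permutation of the complement. -/
theorem exists_split_orbit [Finite α] (π : Perm α) (x : α) :
    ∃ (π' : Perm {u // ¬ π.SameCycle x u})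
      (e : Fin (Function.minimalPeriod π x) ⊕ {u // ¬ π.SameCycle x u} ≃ α),
      (∀ i, e (Sum.inl i) = (π ^ (i : ℕ)) x) ∧ (∀ u, e (Sum.inr u) = u) ∧
      e.permCongr (sumCongr (finRotate _) π') = π := by
  set r := Function.minimalPeriod π x with hr
  have hpos : 0 < r := minimalPeriod_perm_pos π x
  let f : Fin r ⊕ {u // ¬ π.SameCycle x u} → α := Sum.elim (fun i => (π ^ (i : ℕ)) x) Subtype.val
  have hf : Function.Bijective f := by
    constructor
    · rintro (i | u) (j | v) h
      · have h1 : (π ^ (i : ℕ)) x = (π ^ (j : ℕ)) x := h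
        rw [Perm.coe_pow, Perm.coe_pow] at h1
        have h2 := (Function.iterate_injOn_Iio_minimalPeriod (f := π) (x := x)) i.2 j.2 h1
        exact congrArg Sum.inl (Fin.ext h2)
      · exact absurd ⟨(i : ℕ), by rw [zpow_natCast]; exact h⟩ v.2
      · exact absurd ⟨(j : ℕ), by rw [zpow_natCast]; exact h.symm⟩ u.2
      · exact congrArg Sum.inr (Subtype.ext h)
    · intro u
      by_cases hu : π.SameCycle x u
      · obtain ⟨i, hi⟩ := hu.exists_nat_pow_eq
        refine ⟨Sum.inl ⟨i % r, Nat.mod_lt _ hpos⟩, ?_⟩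
        show (π ^ (i % r)) x = u
        rw [← hi, Perm.coe_pow, Perm.coe_pow]
        exact Function.iterate_mod_minimalPeriod_eq
      · exact ⟨Sum.inr ⟨u, hu⟩, rfl⟩
  let e := Equiv.ofBijective f hf
  refine ⟨π.subtypePerm (fun u => by rw [sameCycle_apply_right]), e,
    fun i => rfl, fun u => rfl, ?_⟩
  ext u
  obtain ⟨v, rfl⟩ := e.surjective u
  rw [← permCongr_semiconj]
  cases v with
  | inl i =>
    show (π ^ ((finRotate r i : Fin r) : ℕ)) x = π ((π ^ (i : ℕ)) x)
    rw [val_finRotate, ← Perm.mul_apply, ← pow_succ']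
    split_ifs with h
    · rw [h, hr, pow_minimalPeriod_apply]
      rfl
    · rfl
  | inr v => rfl

end Words

end AnnNC

namespace AnnNC

section FiniteSums

variable {ι κ γ k : Type*}

theorem finprod_sum_type [CommMonoid k] [Finite ι] [Finite κ] (f : ι ⊕ κ → k) :
    ∏ᶠ c, f c = (∏ᶠ i, f (Sum.inl i)) * ∏ᶠ j, f (Sum.inr j) := by
  have := Fintype.ofFinite ι
  have := Fintype.ofFinite κ
  rw [finprod_eq_prod_of_fintype, finprod_eq_prod_of_fintype, finprod_eq_prod_of_fintype,
    Fintype.prod_sum_type]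

theorem finsum_sum_type [AddCommMonoid k] [Finite ι] [Finite κ] (f : ι ⊕ κ → k) :
    ∑ᶠ c, f c = (∑ᶠ i, f (Sum.inl i)) + ∑ᶠ j, f (Sum.inr j) := by
  have := Fintype.ofFinite ι
  have := Fintype.ofFinite κ
  rw [finsum_eq_sum_of_fintype, finsum_eq_sum_of_fintype, finsum_eq_sum_of_fintype,
    Fintype.sum_sum_type]

theorem finsum_mem_pairs [AddCommMonoid k] [Finite ι] [Finite κ] {s : Set ι} {t : Set κ}
    {S : Set γ} (m : ι → κ → γ) (hm : ∀ i j i' j', m i j = m i' j' → i = i' ∧ j = j')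
    (hS : ∀ c, c ∈ S ↔ ∃ i ∈ s, ∃ j ∈ t, m i j = c) (F : γ → k) :
    ∑ᶠ c ∈ S, F c = ∑ᶠ i ∈ s, ∑ᶠ j ∈ t, F (m i j) := by
  have h1 : ∑ᶠ c ∈ S, F c = ∑ᶠ p ∈ s ×ˢ t, F (m p.1 p.2) := by
    symm
    refine finsum_mem_eq_of_bijOn (fun p => m p.1 p.2) ⟨?_, ?_, ?_⟩ (fun _ _ => rfl)
    · rintro ⟨i, j⟩ ⟨hi, hj⟩
      exact (hS _).2 ⟨i, hi, j, hj, rfl⟩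
    · rintro ⟨i, j⟩ _ ⟨i', j'⟩ _ h
      obtain ⟨rfl, rfl⟩ := hm _ _ _ _ h
      rfl
    · intro c hc
      obtain ⟨i, hi, j, hj, rfl⟩ := (hS c).1 hc
      exact ⟨(i, j), ⟨hi, hj⟩, rfl⟩
  rw [h1, finsum_mem_def, finsum_curry _ (Set.toFinite _), finsum_mem_def]
  refine finsum_congr fun i => ?_
  by_cases hi : i ∈ s
  · rw [Set.indicator_of_mem hi, finsum_mem_def]
    refine finsum_congr fun j => ?_
    by_cases hj : j ∈ t
    · rw [Set.indicator_of_mem hj, Set.indicator_of_mem (Set.mk_mem_prod hi hj)]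
    · rw [Set.indicator_of_notMem hj, Set.indicator_of_notMem fun h => hj h.2]
  · rw [Set.indicator_of_notMem hi]
    rw [← finsum_zero (α := κ)]
    refine finsum_congr fun j => ?_
    rw [Set.indicator_of_notMem fun h => hi h.1]

theorem finsum_mem_mul_finsum_mem [CommRing k] [NoZeroDivisors k] (s : Set ι) (t : Set κ)
    (f : ι → k) (g : κ → k) :
    (∑ᶠ i ∈ s, f i) * (∑ᶠ j ∈ t, g j) = ∑ᶠ i ∈ s, ∑ᶠ j ∈ t, f i * g j := by
  rw [finsum_mem_mul]
  exact finsum_mem_congr rfl fun i _ => mul_finsum_mem _ _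

end FiniteSums

section OrbitProducts

open Equiv (Perm)
open Equiv.Perm
open scoped Classical

variable {α β k : Type*}

theorem OrbInv.out {π : Perm α} {w : α → k} (hw : OrbInv π w) (x : α) :
    w (Quotient.mk (orbitSetoid π) x).out = w x :=
  hw.sameCycle (Quotient.exact (Quotient.out_eq (Quotient.mk (orbitSetoid π) x)))

/-- Orbits are transported by a bijection. -/
def orbitCongr (e : α ≃ β) (σ : Perm α) :
    Quotient (orbitSetoid σ) ≃ Quotient (orbitSetoid (e.permCongr σ)) :=
  Quotient.congr e fun x y => (sameCycle_permCongr e σ x y).symm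

theorem OrbInv.comp_permCongr {e : α ≃ β} {σ : Perm α} {w : β → k}
    (hw : OrbInv (e.permCongr σ) w) : OrbInv σ (w ∘ e) := by
  intro x
  show w (e (σ x)) = w (e x)
  rw [permCongr_semiconj]
  exact hw _

theorem OrbInv.out_orbitCongr {e : α ≃ β} {σ : Perm α} {w : β → k}
    (hw : OrbInv (e.permCongr σ) w) (c : Quotient (orbitSetoid σ)) :
    w (orbitCongr e σ c).out = (w ∘ e) c.out := by
  induction c using Quotient.inductionOn with
  | h x =>
    rw [hw.comp_permCongr.out]
    exact hw.out (e x)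

theorem OrbInv.comp_inl {σ : Perm α} {τ : Perm β} {w : α ⊕ β → k}
    (hw : OrbInv (sumCongr σ τ) w) : OrbInv σ (w ∘ Sum.inl) :=
  fun x => hw (Sum.inl x)

theorem OrbInv.comp_inr {σ : Perm α} {τ : Perm β} {w : α ⊕ β → k}
    (hw : OrbInv (sumCongr σ τ) w) : OrbInv τ (w ∘ Sum.inr) :=
  fun x => hw (Sum.inr x)

theorem OrbInv.out_inl {σ : Perm α} {τ : Perm β} {w : α ⊕ β → k}
    (hw : OrbInv (sumCongr σ τ) w) (c : Quotient (orbitSetoid σ)) :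
    w (orbitSumEquiv σ τ (Sum.inl c)).out = (w ∘ Sum.inl) c.out := by
  induction c using Quotient.inductionOn with
  | h x =>
    rw [hw.comp_inl.out]
    exact hw.out (Sum.inl x)

theorem OrbInv.out_inr {σ : Perm α} {τ : Perm β} {w : α ⊕ β → k}
    (hw : OrbInv (sumCongr σ τ) w) (c : Quotient (orbitSetoid τ)) :
    w (orbitSumEquiv σ τ (Sum.inr c)).out = (w ∘ Sum.inr) c.out := by
  induction c using Quotient.inductionOn with
  | h x =>
    rw [hw.comp_inr.out]
    exact hw.out (Sum.inr x)

variable [CommRing k]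

/-- The product of an orbit weight over all orbits. -/
noncomputable def orbProd (π : Perm α) (w : α → k) : k :=
  ∏ᶠ c : Quotient (orbitSetoid π), w c.out

/-- The product of an orbit weight over all orbits but one. -/
noncomputable def orbRest (π : Perm α) (w : α → k) (a : Quotient (orbitSetoid π)) : k :=
  ∏ᶠ c : Quotient (orbitSetoid π), if c = a then 1 else w c.out

/-- The sum over a marked orbit of the weight `g` of the marked orbit times the product of the
weights `w` of the others. -/
noncomputable def markSum (π : Perm α) (w g : α → k) : k :=
  ∑ᶠ a : Quotient (orbitSetoid π), orbRest π w a * g a.out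

theorem orbProd_permCongr {e : α ≃ β} {σ : Perm α} {w : β → k}
    (hw : OrbInv (e.permCongr σ) w) : orbProd (e.permCongr σ) w = orbProd σ (w ∘ e) := by
  unfold orbProd
  rw [← finprod_comp_equiv (orbitCongr e σ)]
  exact finprod_congr fun c => hw.out_orbitCongr c

theorem orbRest_permCongr {e : α ≃ β} {σ : Perm α} {w : β → k}
    (hw : OrbInv (e.permCongr σ) w) (a : Quotient (orbitSetoid σ)) :
    orbRest (e.permCongr σ) w (orbitCongr e σ a) = orbRest σ (w ∘ e) a := by
  unfold orbRest
  rw [← finprod_comp_equiv (orbitCongr e σ)]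
  refine finprod_congr fun c => ?_
  rw [hw.out_orbitCongr c]
  simp only [EmbeddingLike.apply_eq_iff_eq]

theorem markSum_permCongr {e : α ≃ β} {σ : Perm α} {w g : β → k}
    (hw : OrbInv (e.permCongr σ) w) (hg : OrbInv (e.permCongr σ) g) :
    markSum (e.permCongr σ) w g = markSum σ (w ∘ e) (g ∘ e) := by
  unfold markSum
  rw [← finsum_comp_equiv (orbitCongr e σ)]
  refine finsum_congr fun c => ?_
  rw [orbRest_permCongr hw, hg.out_orbitCongr]

theorem orbProd_sumCongr [Finite α] [Finite β] {σ : Perm α} {τ : Perm β} {w : α ⊕ β → k}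
    (hw : OrbInv (sumCongr σ τ) w) :
    orbProd (sumCongr σ τ) w = orbProd σ (w ∘ Sum.inl) * orbProd τ (w ∘ Sum.inr) := by
  unfold orbProd
  rw [← finprod_comp_equiv (orbitSumEquiv σ τ), finprod_sum_type]
  congr 1
  · exact finprod_congr fun c => hw.out_inl c
  · exact finprod_congr fun c => hw.out_inr c

theorem orbRest_sumCongr_inl [Finite α] [Finite β] {σ : Perm α} {τ : Perm β} {w : α ⊕ β → k}
    (hw : OrbInv (sumCongr σ τ) w) (a : Quotient (orbitSetoid σ)) :
    orbRest (sumCongr σ τ) w (orbitSumEquiv σ τ (Sum.inl a)) =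
      orbRest σ (w ∘ Sum.inl) a * orbProd τ (w ∘ Sum.inr) := by
  unfold orbProd orbRest
  rw [← finprod_comp_equiv (orbitSumEquiv σ τ), finprod_sum_type]
  congr 1
  · refine finprod_congr fun c => ?_
    rw [hw.out_inl c]
    simp only [EmbeddingLike.apply_eq_iff_eq, Sum.inl.injEq]
  · refine finprod_congr fun c => ?_
    rw [hw.out_inr c, if_neg]
    simp

theorem orbRest_sumCongr_inr [Finite α] [Finite β] {σ : Perm α} {τ : Perm β} {w : α ⊕ β → k}
    (hw : OrbInv (sumCongr σ τ) w) (a : Quotient (orbitSetoid τ)) :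
    orbRest (sumCongr σ τ) w (orbitSumEquiv σ τ (Sum.inr a)) =
      orbProd σ (w ∘ Sum.inl) * orbRest τ (w ∘ Sum.inr) a := by
  unfold orbProd orbRest
  rw [← finprod_comp_equiv (orbitSumEquiv σ τ), finprod_sum_type]
  congr 1
  · refine finprod_congr fun c => ?_
    rw [hw.out_inl c, if_neg]
    simp
  · refine finprod_congr fun c => ?_
    rw [hw.out_inr c]
    simp only [EmbeddingLike.apply_eq_iff_eq, Sum.inr.injEq]

theorem markSum_sumCongr [NoZeroDivisors k] [Finite α] [Finite β] {σ : Perm α} {τ : Perm β}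
    {w g : α ⊕ β → k} (hw : OrbInv (sumCongr σ τ) w) (hg : OrbInv (sumCongr σ τ) g) :
    markSum (sumCongr σ τ) w g =
      markSum σ (w ∘ Sum.inl) (g ∘ Sum.inl) * orbProd τ (w ∘ Sum.inr) +
      orbProd σ (w ∘ Sum.inl) * markSum τ (w ∘ Sum.inr) (g ∘ Sum.inr) := by
  unfold markSum
  rw [← finsum_comp_equiv (orbitSumEquiv σ τ), finsum_sum_type, finsum_mul', mul_finsum']
  · congr 1
    · refine finsum_congr fun c => ?_
      rw [hg.out_inl, orbRest_sumCongr_inl hw]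
      ring
    · refine finsum_congr fun c => ?_
      rw [hg.out_inr, orbRest_sumCongr_inr hw]
      ring
  · exact Set.toFinite _
  · exact Set.toFinite _

theorem markSum_finsum_mem [NoZeroDivisors k] [Finite α] {ι : Type*} {s : Set ι} (hs : s.Finite)
    (π : Perm α) (w : α → k) (g : ι → α → k) :
    markSum π w (fun x => ∑ᶠ i ∈ s, g i x) = ∑ᶠ i ∈ s, markSum π w (g i) := by
  unfold markSum
  have h1 : ∀ a : Quotient (orbitSetoid π), orbRest π w a * ∑ᶠ i ∈ s, g i a.out =
      ∑ᶠ i ∈ s, orbRest π w a * g i a.out := fun a => mul_finsum_mem _ _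
  rw [finsum_congr h1, ← finsum_mem_univ, finsum_mem_comm _ (Set.toFinite _) hs]
  exact finsum_mem_congr rfl fun i _ => finsum_mem_univ _

theorem markSum_comm [NoZeroDivisors k] [Finite α] [Finite β]
    (σ : Perm α) (τ : Perm β) (w : α → k) (v : β → k) (g : α → β → k) :
    markSum σ w (fun x => markSum τ v (g x)) = markSum τ v (fun y => markSum σ w (fun x => g x y)) := by
  unfold markSum
  have h : ∀ (a : Quotient (orbitSetoid σ)),
      orbRest σ w a * ∑ᶠ b : Quotient (orbitSetoid τ), orbRest τ v b * g a.out b.out =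
      ∑ᶠ b : Quotient (orbitSetoid τ), orbRest σ w a * (orbRest τ v b * g a.out b.out) :=
    fun a => mul_finsum _ _
  have h' : ∀ (b : Quotient (orbitSetoid τ)),
      orbRest τ v b * ∑ᶠ a : Quotient (orbitSetoid σ), orbRest σ w a * g a.out b.out =
      ∑ᶠ a : Quotient (orbitSetoid σ), orbRest τ v b * (orbRest σ w a * g a.out b.out) :=
    fun a => mul_finsum _ _
  simp_rw [h, h']
  have := Fintype.ofFinite (Quotient (orbitSetoid σ))
  have := Fintype.ofFinite (Quotient (orbitSetoid τ))
  simp_rw [finsum_eq_sum_of_fintype]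
  rw [Finset.sum_comm]
  refine Finset.sum_congr rfl fun b _ => Finset.sum_congr rfl fun a _ => ?_
  ring

theorem orbProd_finRotate {n : ℕ} (hn : 0 < n) {w : Fin n → k} (hw : OrbInv (finRotate n) w) :
    orbProd (finRotate n) w = w ⟨0, hn⟩ := by
  unfold orbProd
  rw [finprod_eq_single _ (Quotient.mk _ ⟨0, hn⟩)]
  · exact hw.out _
  · intro c hc
    induction c using Quotient.inductionOn with
    | h x => exact absurd (Quotient.sound (finRotate_sameCycle _ _)) hc

theorem orbRest_finRotate {n : ℕ} (hn : 0 < n) (w : Fin n → k) :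
    orbRest (finRotate n) w (Quotient.mk _ ⟨0, hn⟩) = 1 := by
  unfold orbRest
  rw [finprod_eq_one_of_forall_eq_one]
  intro c
  rw [if_pos]
  induction c using Quotient.inductionOn with
  | h x => exact Quotient.sound (finRotate_sameCycle _ _)

theorem markSum_finRotate {n : ℕ} (hn : 0 < n) {w g : Fin n → k} (hg : OrbInv (finRotate n) g) :
    markSum (finRotate n) w g = g ⟨0, hn⟩ := by
  unfold markSum
  rw [finsum_eq_single _ (Quotient.mk _ ⟨0, hn⟩)]
  · rw [orbRest_finRotate, one_mul]
    exact hg.out _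
  · intro c hc
    induction c using Quotient.inductionOn with
    | h x => exact absurd (Quotient.sound (finRotate_sameCycle _ _)) hc

end OrbitProducts

section FirstOrder

open Equiv (Perm)
open Equiv.Perm

universe u

variable {α β : Type u} {A k : Type*}

theorem permCongr_self {n : ℕ} (g : Perm (Fin n)) (σ : Perm (Fin n)) (h : g * σ = σ * g) :
    (Equiv.permCongr g) σ = σ := by
  ext x
  rw [Equiv.permCongr_apply]
  have h1 := congrArg (fun p : Perm (Fin n) => p (g.symm x)) h
  simp only [Perm.mul_apply, Equiv.apply_symm_apply] at h1
  rw [h1]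

theorem cyc_comp_permCongr {α β : Type*} (κ : ∀ m : ℕ, (Fin m → A) → k) (e : α ≃ β) (σ : Perm α)
    (z : β → A) : cyc κ (e.permCongr σ) z ∘ e = cyc κ σ (z ∘ e) := by
  funext x
  exact cyc_semiconj κ e.injective (permCongr_semiconj e σ) z x

theorem cyc_comp_inl {α β : Type*} (κ : ∀ m : ℕ, (Fin m → A) → k) (σ : Perm α) (τ : Perm β)
    (z : α ⊕ β → A) : cyc κ (sumCongr σ τ) z ∘ Sum.inl = cyc κ σ (z ∘ Sum.inl) := by
  funext x
  exact cyc_semiconj κ Sum.inl_injective (fun _ => rfl) z x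

theorem cyc_comp_inr {α β : Type*} (κ : ∀ m : ℕ, (Fin m → A) → k) (σ : Perm α) (τ : Perm β)
    (z : α ⊕ β → A) : cyc κ (sumCongr σ τ) z ∘ Sum.inr = cyc κ τ (z ∘ Sum.inr) := by
  funext x
  exact cyc_semiconj κ Sum.inr_injective (fun _ => rfl) z x

variable [CommRing k]

/-- The multiplicative extension of a cyclic family of functionals to permutations. -/
noncomputable def kprod (κ : ∀ m : ℕ, (Fin m → A) → k) (π : Perm α) (z : α → A) : k :=
  orbProd π (cyc κ π z)

theorem kprod_permCongr {α β : Type*} [Finite β] {κ : ∀ m : ℕ, (Fin m → A) → k} (hκ : Cyclic κ)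
    (e : α ≃ β) (σ : Perm α) (z : β → A) :
    kprod κ (e.permCongr σ) z = kprod κ σ (z ∘ e) := by
  unfold kprod
  rw [orbProd_permCongr (cyc_orbInv hκ _ _), cyc_comp_permCongr]

theorem kprod_sumCongr {α β : Type*} [Finite α] [Finite β] {κ : ∀ m : ℕ, (Fin m → A) → k}
    (hκ : Cyclic κ) (σ : Perm α) (τ : Perm β) (z : α ⊕ β → A) :
    kprod κ (sumCongr σ τ) z = kprod κ σ (z ∘ Sum.inl) * kprod κ τ (z ∘ Sum.inr) := by
  unfold kprod
  rw [orbProd_sumCongr (cyc_orbInv hκ _ _), cyc_comp_inl, cyc_comp_inr]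

theorem kprod_finRotate {κ : ∀ m : ℕ, (Fin m → A) → k} (hκ : Cyclic κ) {n : ℕ} (hn : 0 < n)
    (z : Fin n → A) : kprod κ (finRotate n) z = κ n z := by
  unfold kprod
  rw [orbProd_finRotate hn (cyc_orbInv hκ _ _), cyc_finRotate]

/-- The geodesic interval below a permutation. -/
def Below {α : Type*} (π : Perm α) : Set (Perm α) := {ρ | Geo ρ π}

theorem sum_below_permCongr {α β M : Type*} [AddCommMonoid M] (e : α ≃ β) (σ : Perm α)
    (F : Perm β → M) :
    ∑ᶠ ρ ∈ Below (e.permCongr σ), F ρ = ∑ᶠ ρ ∈ Below σ, F (e.permCongr ρ) := by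
  symm
  refine finsum_mem_eq_of_bijOn e.permCongr ⟨?_, e.permCongr.injective.injOn, ?_⟩ (fun _ _ => rfl)
  · intro ρ hρ
    exact (geo_permCongr e ρ σ).2 hρ
  · intro ρ hρ
    obtain ⟨ρ', rfl⟩ := e.permCongr.surjective ρ
    exact ⟨ρ', (geo_permCongr e ρ' σ).1 hρ, rfl⟩

theorem sum_below_sumCongr {α β M : Type*} [Finite α] [Finite β] [AddCommMonoid M]
    (σ : Perm α) (τ : Perm β) (F : Perm (α ⊕ β) → M) :
    ∑ᶠ ρ ∈ Below (sumCongr σ τ), F ρ = ∑ᶠ σ' ∈ Below σ, ∑ᶠ τ' ∈ Below τ, F (sumCongr σ' τ') := by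
  refine finsum_mem_pairs (fun σ' τ' => sumCongr σ' τ') (fun _ _ _ _ h => sumCongr_inj.1 h) ?_ F
  intro ρ
  constructor
  · intro h
    obtain ⟨σ', τ', rfl⟩ := Geo.exists_sumCongr h
    obtain ⟨h1, h2⟩ := (geo_sumCongr _ _ _ _).1 h
    exact ⟨σ', h1, τ', h2, rfl⟩
  · rintro ⟨σ', h1, τ', h2, rfl⟩
    exact (geo_sumCongr _ _ _ _).2 ⟨h1, h2⟩

theorem card_complement_lt {α : Type*} [Finite α] (π : Perm α) (x : α) :
    Nat.card {u // ¬ π.SameCycle x u} < Nat.card α :=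
  Finite.card_subtype_lt (x := x) (fun h => h (SameCycle.refl π x))

theorem markSum_cyc_permCongr {α β : Type*} [Finite β] {κ g : ∀ m : ℕ, (Fin m → A) → k}
    (hκ : Cyclic κ) (hg : Cyclic g) (e : α ≃ β) (σ : Perm α) (z : β → A) :
    markSum (e.permCongr σ) (cyc κ (e.permCongr σ) z) (cyc g (e.permCongr σ) z) =
      markSum σ (cyc κ σ (z ∘ e)) (cyc g σ (z ∘ e)) := by
  rw [markSum_permCongr (cyc_orbInv hκ _ _) (cyc_orbInv hg _ _), cyc_comp_permCongr,
    cyc_comp_permCongr]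

/-- The marked moment functional attached to a marked cumulant functional. -/
noncomputable def markedMoment (κ g : ∀ m : ℕ, (Fin m → A) → k) (n : ℕ) (x : Fin n → A) : k :=
  ∑ᶠ ρ ∈ Below (finRotate n), markSum ρ (cyc κ ρ x) (cyc g ρ x)

theorem markedMoment_cyclic {κ g : ∀ m : ℕ, (Fin m → A) → k} (hκ : Cyclic κ) (hg : Cyclic g) :
    Cyclic (markedMoment κ g) := by
  intro n x
  unfold markedMoment
  conv_rhs => rw [← permCongr_self (finRotate n) (finRotate n) rfl]
  rw [sum_below_permCongr]
  exact finsum_mem_congr rfl fun ρ _ => (markSum_cyc_permCongr hκ hg _ ρ x).symm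

variable [NoZeroDivisors k]

/-- Induction on permutations of finite types, peeling off one orbit at a time. -/
theorem perm_induction {P : ∀ (α : Type u) [Finite α], Perm α → Prop}
    (hempty : ∀ (α : Type u) [Finite α] [IsEmpty α] (π : Perm α), P α π)
    (hcongr : ∀ (α β : Type u) [Finite α] [Finite β] (e : α ≃ β) (σ : Perm α), P α σ →
      P β (e.permCongr σ))
    (hsum : ∀ (n : ℕ) (_ : 0 < n) (β : Type u) [Finite β] (τ : Perm β), P β τ →
      P (Fin n ⊕ β) (sumCongr (finRotate n) τ)) :
    ∀ (α : Type u) [Finite α] (π : Perm α), P α π := by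
  have key : ∀ (N : ℕ) (α : Type u) [Finite α] (π : Perm α), Nat.card α = N → P α π := by
    intro N
    induction N using Nat.strong_induction_on with
    | _ N ih =>
      intro α _ π hN
      rcases isEmpty_or_nonempty α with h | ⟨⟨x⟩⟩
      · exact hempty α π
      · obtain ⟨π', e, -, -, h⟩ := exists_split_orbit π x
        rw [← h]
        refine hcongr _ _ e _ (hsum _ (minimalPeriod_perm_pos π x) _ _ ?_)
        exact ih _ (hN ▸ card_complement_lt π x) _ _ rfl
  exact fun α _ π => key _ α π rfl

theorem below_of_isEmpty {α : Type*} [IsEmpty α] (π : Perm α) : Below π = {π} := by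
  ext ρ
  simp only [Set.mem_singleton_iff]
  constructor
  · intro _
    exact Subsingleton.elim _ _
  · rintro rfl
    have h1 : numOrbits ρ = 0 := by
      unfold numOrbits
      have : IsEmpty (Quotient (orbitSetoid ρ)) := Quotient.instIsEmpty
      exact Nat.card_of_isEmpty
    show Geo ρ ρ
    unfold Geo
    rw [inv_mul_cancel, numOrbits_one, h1, Nat.card_of_isEmpty]

/-- The moment–cumulant relation on a single cycle. -/
def MomentCumulant (f κ : ∀ m : ℕ, (Fin m → A) → k) : Prop :=
  ∀ n : ℕ, 1 ≤ n → ∀ x : Fin n → A, f n x = ∑ᶠ π ∈ Below (finRotate n), kprod κ π x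

/-- First-order moments along a permutation are sums of cumulants over the interval below it. -/
theorem kprod_eq_sum_below [Finite α] {f κ : ∀ m : ℕ, (Fin m → A) → k} (hf : Cyclic f)
    (hκ : Cyclic κ) (h : MomentCumulant f κ) (π : Perm α) (z : α → A) :
    kprod f π z = ∑ᶠ ρ ∈ Below π, kprod κ ρ z := by
  revert z
  refine perm_induction (P := fun α _ π => ∀ z : α → A,
    kprod f π z = ∑ᶠ ρ ∈ Below π, kprod κ ρ z) ?_ ?_ ?_ α π
  · intro α _ _ π z
    rw [below_of_isEmpty, finsum_mem_singleton]
    unfold kprod orbProd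
    have : IsEmpty (Quotient (orbitSetoid π)) := Quotient.instIsEmpty
    rw [finprod_of_isEmpty, finprod_of_isEmpty]
  · intro α β _ _ e σ ih z
    rw [kprod_permCongr hf, ih, sum_below_permCongr]
    exact finsum_mem_congr rfl fun ρ _ => (kprod_permCongr hκ e ρ z).symm
  · intro n hn β _ τ ih z
    rw [kprod_sumCongr hf, kprod_finRotate hf hn, ih, h n hn, sum_below_sumCongr,
      finsum_mem_mul_finsum_mem]
    exact finsum_mem_congr rfl fun ρ _ => finsum_mem_congr rfl fun ρ' _ =>
      (kprod_sumCongr hκ ρ ρ' z).symm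

theorem finsum_mem_add_mul_add {ι κ : Type*} [Finite ι] [Finite κ] (s : Set ι) (t : Set κ)
    (a b : ι → k) (c d : κ → k) :
    ∑ᶠ i ∈ s, ∑ᶠ j ∈ t, (a i * c j + b i * d j) =
      (∑ᶠ i ∈ s, a i) * (∑ᶠ j ∈ t, c j) + (∑ᶠ i ∈ s, b i) * (∑ᶠ j ∈ t, d j) := by
  rw [finsum_mem_mul_finsum_mem, finsum_mem_mul_finsum_mem,
    ← finsum_mem_add_distrib (Set.toFinite _)]
  exact finsum_mem_congr rfl fun i _ => finsum_mem_add_distrib (Set.toFinite _)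

theorem sum_markSum_below [Finite α] {f κ g : ∀ m : ℕ, (Fin m → A) → k} (hf : Cyclic f)
    (hκ : Cyclic κ) (hg : Cyclic g) (h : MomentCumulant f κ) (π : Perm α) (z : α → A) :
    ∑ᶠ ρ ∈ Below π, markSum ρ (cyc κ ρ z) (cyc g ρ z) =
      markSum π (cyc f π z) (cyc (markedMoment κ g) π z) := by
  have hY := markedMoment_cyclic hκ hg
  revert z
  refine perm_induction (P := fun α _ π => ∀ z : α → A,
    ∑ᶠ ρ ∈ Below π, markSum ρ (cyc κ ρ z) (cyc g ρ z) =
      markSum π (cyc f π z) (cyc (markedMoment κ g) π z)) ?_ ?_ ?_ α π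
  · intro α _ _ π z
    rw [below_of_isEmpty, finsum_mem_singleton]
    unfold markSum
    have : IsEmpty (Quotient (orbitSetoid π)) := Quotient.instIsEmpty
    rw [finsum_of_isEmpty, finsum_of_isEmpty]
  · intro α β _ _ e σ ih z
    rw [sum_below_permCongr, markSum_cyc_permCongr hf hY, ← ih]
    exact finsum_mem_congr rfl fun ρ _ => markSum_cyc_permCongr hκ hg e ρ z
  · intro n hn β _ τ ih z
    have hsplit : ∀ (κ g : ∀ m : ℕ, (Fin m → A) → k) (_ : Cyclic κ) (_ : Cyclic g)
        (ρ : Perm (Fin n)) (ρ' : Perm β),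
        markSum (sumCongr ρ ρ') (cyc κ (sumCongr ρ ρ') z) (cyc g (sumCongr ρ ρ') z) =
        markSum ρ (cyc κ ρ (z ∘ Sum.inl)) (cyc g ρ (z ∘ Sum.inl)) * kprod κ ρ' (z ∘ Sum.inr) +
        kprod κ ρ (z ∘ Sum.inl) * markSum ρ' (cyc κ ρ' (z ∘ Sum.inr)) (cyc g ρ' (z ∘ Sum.inr)) := by
      intro κ g hκ hg ρ ρ'
      rw [markSum_sumCongr (cyc_orbInv hκ _ _) (cyc_orbInv hg _ _)]
      simp only [cyc_comp_inl, cyc_comp_inr]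
      rfl
    rw [sum_below_sumCongr, hsplit f _ hf hY, markSum_finRotate hn (cyc_orbInv hY _ _),
      cyc_finRotate, kprod_finRotate hf hn, ← ih, h n hn, kprod_eq_sum_below hf hκ h]
    unfold markedMoment
    rw [← finsum_mem_add_mul_add]
    exact finsum_mem_congr rfl fun ρ _ => finsum_mem_congr rfl fun ρ' _ => hsplit κ g hκ hg ρ ρ'

end FirstOrder

end AnnNC

namespace AnnNC

section Bridges

open Equiv (Perm)
open Equiv.Perm

variable {γ : Type*}

theorem numJoin_lt [Finite γ] {ρ π : Perm γ} {x y : γ} (hxy : ρ.SameCycle x y)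
    (hn : ¬ π.SameCycle x y) : numJoin ρ π + 1 ≤ numOrbits π := by
  by_contra hcon
  have h := eq_of_card_quotient_le (s := orbitSetoid π) (t := orbitSetoid ρ ⊔ orbitSetoid π)
    le_sup_right (by unfold numJoin numOrbits at hcon; omega)
  have h1 : (orbitSetoid ρ ⊔ orbitSetoid π) x y :=
    (le_sup_left : orbitSetoid ρ ≤ orbitSetoid ρ ⊔ orbitSetoid π) hxy
  rw [← h] at h1
  exact hn h1

/-- The triangle inequality improves by two once an orbit is not contained in one of `π`. -/
theorem orbits_triangle_of_merge [Finite γ] {ρ π : Perm γ} {x y : γ} (hxy : ρ.SameCycle x y)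
    (hn : ¬ π.SameCycle x y) :
    numOrbits ρ + numOrbits (ρ⁻¹ * π) + 2 ≤ Nat.card γ + numOrbits π := by
  have h1 := numJoin_lt hxy hn
  have h2 := genus_nonneg' ρ π
  omega

open scoped Classical in
/-- In the case of equality only two orbits of `π` are merged. -/
theorem merge_cases [Finite γ] {ρ π : Perm γ}
    (h : numOrbits ρ + numOrbits (ρ⁻¹ * π) + 2 = Nat.card γ + numOrbits π) {x y : γ}
    (hxy : ρ.SameCycle x y) (hn : ¬ π.SameCycle x y) {u v : γ} (huv : ρ.SameCycle u v) :
    π.SameCycle u v ∨ (π.SameCycle x u ∧ π.SameCycle y v) ∨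
      (π.SameCycle y u ∧ π.SameCycle x v) := by
  let f : γ → Quotient (orbitSetoid π) := fun u =>
    if π.SameCycle y u then Quotient.mk _ x else Quotient.mk _ u
  have hπ : orbitSetoid π ≤ Setoid.ker f := by
    intro u v huv
    have huv' : π.SameCycle u v := huv
    have h1 : π.SameCycle y u ↔ π.SameCycle y v :=
      ⟨fun h => h.trans huv', fun h => h.trans huv'.symm⟩
    show f u = f v
    simp only [f, h1]
    split_ifs
    · rfl
    · exact Quotient.sound huv
  have hJ : Setoid.ker f ≤ orbitSetoid ρ ⊔ orbitSetoid π := by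
    have key : ∀ u v, f u = Quotient.mk _ v → (orbitSetoid ρ ⊔ orbitSetoid π) u v := by
      intro u v huv
      simp only [f] at huv
      split_ifs at huv with h1
      · refine Setoid.trans' _ ?_ ((le_sup_right : orbitSetoid π ≤ _) (Quotient.exact huv))
        refine Setoid.symm' _ (Setoid.trans' _ ?_ ((le_sup_right : orbitSetoid π ≤ _) h1))
        exact (le_sup_left : orbitSetoid ρ ≤ _) hxy
      · exact (le_sup_right : orbitSetoid π ≤ _) (Quotient.exact huv)
    intro u v huv
    have huv' : f u = f v := huv
    have h1 := key u (f u).out (Quotient.out_eq _).symm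
    have h2 := key v (f u).out (by rw [← huv']; exact (Quotient.out_eq _).symm)
    exact Setoid.trans' _ h1 (Setoid.symm' _ h2)
  have hcard : Nat.card (Quotient (Setoid.ker f)) + 1 ≤ numOrbits π := by
    have hne : Quotient.mk (orbitSetoid π) y ∉ Set.range f := by
      rintro ⟨u, hu⟩
      simp only [f] at hu
      split_ifs at hu with h1
      · exact hn (Quotient.exact hu)
      · exact h1 (Setoid.symm' (orbitSetoid π) (Quotient.exact hu))
    rw [Nat.card_congr (Setoid.quotientKerEquivRange f)]
    have : Nat.card (Set.range f) < Nat.card (Quotient (orbitSetoid π)) :=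
      Finite.card_subtype_lt hne
    exact this
  have heq := eq_of_card_quotient_le hJ (by
    have h2 := genus_nonneg' ρ π
    unfold numJoin at h2
    omega)
  have h1 : (orbitSetoid ρ ⊔ orbitSetoid π) u v := (le_sup_left : orbitSetoid ρ ≤ _) huv
  rw [← heq] at h1
  have h2 : f u = f v := h1
  simp only [f] at h2
  split_ifs at h2 with hu hv hv
  · exact Or.inl (hu.symm.trans hv)
  · exact Or.inr (Or.inr ⟨hu, Quotient.exact h2⟩)
  · exact Or.inr (Or.inl ⟨SameCycle.symm (Quotient.exact h2), hv⟩)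
  · exact Or.inl (Quotient.exact h2)

variable {α β : Type*}

/-- Some orbit meets both summands. -/
def Cross (ρ : Perm (α ⊕ β)) : Prop := ∃ x y, ρ.SameCycle (Sum.inl x) (Sum.inr y)

/-- The permutations with a bridge that are annular noncrossing on a pair of orbits of `π`, one on
each side, and disc noncrossing on the others. -/
def AnnOn (π : Perm (α ⊕ β)) : Set (Perm (α ⊕ β)) :=
  {ρ | Cross ρ ∧ numOrbits ρ + numOrbits (ρ⁻¹ * π) + 2 = Nat.card (α ⊕ β) + numOrbits π}

theorem Cross.orbits_triangle [Finite α] [Finite β] {ρ : Perm (α ⊕ β)} (h : Cross ρ) (σ : Perm α)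
    (τ : Perm β) : numOrbits ρ + numOrbits (ρ⁻¹ * sumCongr σ τ) + 2 ≤
      Nat.card (α ⊕ β) + numOrbits (sumCongr σ τ) := by
  obtain ⟨x, y, h⟩ := h
  exact orbits_triangle_of_merge h (not_sameCycle_inl_inr σ τ x y)

/-- The part of `AnnOn` with bridges between the orbits of `x` and `y`. -/
def AnnAt (σ : Perm α) (τ : Perm β) (x : α) (y : β) : Set (Perm (α ⊕ β)) :=
  {ρ | (∃ x' y', σ.SameCycle x x' ∧ τ.SameCycle y y' ∧ ρ.SameCycle (Sum.inl x') (Sum.inr y')) ∧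
    numOrbits ρ + numOrbits (ρ⁻¹ * sumCongr σ τ) + 2 =
      Nat.card (α ⊕ β) + numOrbits (sumCongr σ τ)}

theorem annAt_merge_cases [Finite α] [Finite β] {σ : Perm α} {τ : Perm β} {x : α} {y : β}
    {ρ : Perm (α ⊕ β)} (h : ρ ∈ AnnAt σ τ x y) {u v : α ⊕ β} (huv : ρ.SameCycle u v) :
    (sumCongr σ τ).SameCycle u v ∨
      ((sumCongr σ τ).SameCycle (Sum.inl x) u ∧ (sumCongr σ τ).SameCycle (Sum.inr y) v) ∨
      ((sumCongr σ τ).SameCycle (Sum.inr y) u ∧ (sumCongr σ τ).SameCycle (Sum.inl x) v) := by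
  obtain ⟨⟨x', y', hx, hy, hxy⟩, hn⟩ := h
  have hx' := (sameCycle_inl_inl σ τ x x').2 hx
  have hy' := (sameCycle_inr_inr σ τ y y').2 hy
  rcases merge_cases hn hxy (not_sameCycle_inl_inr σ τ x' y') huv with h | ⟨h1, h2⟩ | ⟨h1, h2⟩
  · exact Or.inl h
  · exact Or.inr (Or.inl ⟨hx'.trans h1, hy'.trans h2⟩)
  · exact Or.inr (Or.inr ⟨hy'.trans h1, hx'.trans h2⟩)

theorem sum_annOn [Finite α] [Finite β] {M : Type*} [AddCommMonoid M] (σ : Perm α) (τ : Perm β)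
    (F : Perm (α ⊕ β) → M) :
    ∑ᶠ ρ ∈ AnnOn (sumCongr σ τ), F ρ =
      ∑ᶠ (a : Quotient (orbitSetoid σ)) (b : Quotient (orbitSetoid τ)),
        ∑ᶠ ρ ∈ AnnAt σ τ a.out b.out, F ρ := by
  have h1 : AnnOn (sumCongr σ τ) =
      ⋃ p : Quotient (orbitSetoid σ) × Quotient (orbitSetoid τ), AnnAt σ τ p.1.out p.2.out := by
    ext ρ
    simp only [Set.mem_iUnion]
    constructor
    · rintro ⟨⟨x, y, h⟩, hn⟩
      exact ⟨(Quotient.mk _ x, Quotient.mk _ y), ⟨x, y,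
        Quotient.exact (Quotient.out_eq (Quotient.mk (orbitSetoid σ) x)),
        Quotient.exact (Quotient.out_eq (Quotient.mk (orbitSetoid τ) y)), h⟩, hn⟩
    · rintro ⟨p, ⟨x, y, -, -, h⟩, hn⟩
      exact ⟨⟨x, y, h⟩, hn⟩
  rw [h1, finsum_mem_iUnion]
  · rw [finsum_curry _ (Set.toFinite _)]
  · intro p p' hp
    show _root_.Disjoint _ _
    rw [Set.disjoint_left]
    intro ρ hρ hρ'
    apply hp
    obtain ⟨x, y, hx, hy, hxy⟩ := hρ'.1
    rcases annAt_merge_cases hρ hxy with h | ⟨h1, h2⟩ | ⟨h1, h2⟩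
    · exact absurd h (not_sameCycle_inl_inr σ τ x y)
    · rw [sameCycle_inl_inl] at h1
      rw [sameCycle_inr_inr] at h2
      refine Prod.ext ?_ ?_
      · rw [← Quotient.out_eq p.1, ← Quotient.out_eq p'.1]
        exact Quotient.sound (h1.trans hx.symm)
      · rw [← Quotient.out_eq p.2, ← Quotient.out_eq p'.2]
        exact Quotient.sound (h2.trans hy.symm)
    · exact absurd h1.symm (not_sameCycle_inl_inr σ τ _ _)
  · exact fun _ => Set.toFinite _

theorem not_sameCycle_split {α δ : Type*} {n : ℕ} {σ : Perm α} {e : Fin n ⊕ δ ≃ α} {π' : Perm δ}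
    (he : e.permCongr (sumCongr (finRotate n) π') = σ) (i : Fin n) (u : δ) :
    ¬ σ.SameCycle (e (Sum.inl i)) (e (Sum.inr u)) := by
  rw [← he, sameCycle_permCongr]
  exact not_sameCycle_inl_inr _ _ _ _

theorem sameCycle_split {α δ : Type*} {n : ℕ} {σ : Perm α} {e : Fin n ⊕ δ ≃ α} {π' : Perm δ}
    (he : e.permCongr (sumCongr (finRotate n) π') = σ) (i j : Fin n) :
    σ.SameCycle (e (Sum.inl i)) (e (Sum.inl j)) := by
  rw [← he, sameCycle_permCongr, sameCycle_inl_inl]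
  exact finRotate_sameCycle _ _

/-- Splitting one orbit off each side. -/
theorem sum_annAt [Finite α] [Finite β] {M δ ε : Type*} [Finite δ] [Finite ε] [AddCommMonoid M]
    {r s : ℕ} (hr : 0 < r) (hs : 0 < s)
    {σ : Perm α} {τ : Perm β} {e : Fin r ⊕ δ ≃ α} {e' : Fin s ⊕ ε ≃ β} {σ' : Perm δ} {τ' : Perm ε}
    (he : e.permCongr (sumCongr (finRotate r) σ') = σ)
    (he' : e'.permCongr (sumCongr (finRotate s) τ') = τ)
    (F : Perm (α ⊕ β) → M) :
    ∑ᶠ ρ ∈ AnnAt σ τ (e (Sum.inl ⟨0, hr⟩)) (e' (Sum.inl ⟨0, hs⟩)), F ρ =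
      ∑ᶠ ρ₁ ∈ AnnOn (sumCongr (finRotate r) (finRotate s)), ∑ᶠ ρ₂ ∈ Below (sumCongr σ' τ'),
        F (((Equiv.sumSumSumComm (Fin r) (Fin s) δ ε).trans (Equiv.sumCongr e e')).permCongr
          (sumCongr ρ₁ ρ₂)) := by
  set E := (Equiv.sumSumSumComm (Fin r) (Fin s) δ ε).trans (Equiv.sumCongr e e') with hE
  have hπ : E.permCongr (sumCongr (sumCongr (finRotate r) (finRotate s)) (sumCongr σ' τ')) =
      sumCongr σ τ := by
    subst he he'
    refine Equiv.ext fun w => ?_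
    obtain ⟨((i | j) | (u | v)), rfl⟩ := E.surjective w <;> rw [← permCongr_semiconj]
    · exact congrArg Sum.inl (permCongr_semiconj e (sumCongr (finRotate r) σ') (Sum.inl i))
    · exact congrArg Sum.inr (permCongr_semiconj e' (sumCongr (finRotate s) τ') (Sum.inl j))
    · exact congrArg Sum.inl (permCongr_semiconj e (sumCongr (finRotate r) σ') (Sum.inr u))
    · exact congrArg Sum.inr (permCongr_semiconj e' (sumCongr (finRotate s) τ') (Sum.inr v))
  have hcard : Nat.card (α ⊕ β) = Nat.card (Fin r ⊕ Fin s) + Nat.card (δ ⊕ ε) := by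
    rw [← Nat.card_sum]
    exact (Nat.card_congr E).symm
  have hnum : ∀ (ρ₁ : Perm (Fin r ⊕ Fin s)) (ρ₂ : Perm (δ ⊕ ε)),
      numOrbits (E.permCongr (sumCongr ρ₁ ρ₂)) = numOrbits ρ₁ + numOrbits ρ₂ ∧
      numOrbits ((E.permCongr (sumCongr ρ₁ ρ₂))⁻¹ * sumCongr σ τ) =
        numOrbits (ρ₁⁻¹ * sumCongr (finRotate r) (finRotate s)) +
        numOrbits (ρ₂⁻¹ * sumCongr σ' τ') := by
    intro ρ₁ ρ₂
    rw [← hπ, permCongr_inv_mul, numOrbits_permCongr, numOrbits_permCongr, sumCongr_inv_mul,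
      numOrbits_sumCongr, numOrbits_sumCongr]
    exact ⟨rfl, rfl⟩
  have hnumπ : numOrbits (sumCongr σ τ) =
      numOrbits (sumCongr (finRotate r) (finRotate s)) + numOrbits (sumCongr σ' τ') := by
    rw [← hπ, numOrbits_permCongr, numOrbits_sumCongr]
  refine finsum_mem_pairs (fun ρ₁ ρ₂ => E.permCongr (sumCongr ρ₁ ρ₂))
    (fun _ _ _ _ h => sumCongr_inj.1 (E.permCongr.injective h)) ?_ F
  intro ρ
  constructor
  · intro h
    obtain ⟨ρ', rfl⟩ := E.permCongr.surjective ρ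
    have hsep : ∀ x y, ¬ ρ'.SameCycle (Sum.inl x) (Sum.inr y) := by
      intro x y hxy
      have hxy' := annAt_merge_cases h ((sameCycle_permCongr E ρ' _ _).2 hxy)
      rcases hxy' with h1 | ⟨h1, h2⟩ | ⟨h1, h2⟩
      · rw [← hπ, sameCycle_permCongr] at h1
        exact not_sameCycle_inl_inr _ _ _ _ h1
      · have h3 : ¬ (sumCongr σ τ).SameCycle (Sum.inr (e' (Sum.inl ⟨0, hs⟩))) (E (Sum.inr y)) := by
          rw [show (Sum.inr (e' (Sum.inl ⟨0, hs⟩)) : α ⊕ β) = E (Sum.inl (Sum.inr ⟨0, hs⟩)) from rfl,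
            ← hπ, sameCycle_permCongr]
          exact not_sameCycle_inl_inr _ _ _ _
        exact h3 h2
      · have h3 : ¬ (sumCongr σ τ).SameCycle (Sum.inl (e (Sum.inl ⟨0, hr⟩))) (E (Sum.inr y)) := by
          rw [show (Sum.inl (e (Sum.inl ⟨0, hr⟩)) : α ⊕ β) = E (Sum.inl (Sum.inl ⟨0, hr⟩)) from rfl,
            ← hπ, sameCycle_permCongr]
          exact not_sameCycle_inl_inr _ _ _ _
        exact h3 h2
    obtain ⟨ρ₁, ρ₂, rfl⟩ := exists_sumCongr hsep
    have hcross : Cross ρ₁ := by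
      obtain ⟨⟨x, y, hx, hy, hxy⟩, -⟩ := h
      obtain ⟨i | u, rfl⟩ := e.surjective x
      · obtain ⟨j | v, rfl⟩ := e'.surjective y
        · refine ⟨i, j, ?_⟩
          rw [← sameCycle_inl_inl ρ₁ ρ₂, ← sameCycle_permCongr E]
          exact hxy
        · exact absurd hy (not_sameCycle_split he' _ _)
      · exact absurd hx (not_sameCycle_split he _ _)
    have h1 := hcross.orbits_triangle (finRotate r) (finRotate s)
    have h2 := AnnNC.orbits_triangle ρ₂ (sumCongr σ' τ')
    have h3 := h.2
    obtain ⟨h4, h5⟩ := hnum ρ₁ ρ₂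
    rw [h4, h5, hnumπ, hcard] at h3
    refine ⟨ρ₁, ⟨hcross, ?_⟩, ρ₂, ?_, rfl⟩
    · omega
    · show Geo _ _
      unfold Geo
      omega
  · rintro ⟨ρ₁, ⟨⟨i, j, hij⟩, h1⟩, ρ₂, h2, rfl⟩
    refine ⟨⟨e (Sum.inl i), e' (Sum.inl j), sameCycle_split he _ _, sameCycle_split he' _ _, ?_⟩, ?_⟩
    · rw [← sameCycle_inl_inl ρ₁ ρ₂, ← sameCycle_permCongr E] at hij
      exact hij
    · obtain ⟨h4, h5⟩ := hnum ρ₁ ρ₂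
      rw [h4, h5, hnumπ, hcard]
      have h2' : Geo ρ₂ _ := h2
      unfold Geo at h2'
      omega

variable {A k : Type*} [CommRing k]

theorem orbRest_split {α δ : Type*} [Finite α] [Finite δ] {f : ∀ m : ℕ, (Fin m → A) → k}
    (hf : Cyclic f) {n : ℕ} (hn : 0 < n) {σ : Perm α} {e : Fin n ⊕ δ ≃ α} {π' : Perm δ}
    (he : e.permCongr (sumCongr (finRotate n) π') = σ) (z : α → A) {a : Quotient (orbitSetoid σ)}
    (ha : a = Quotient.mk _ (e (Sum.inl ⟨0, hn⟩))) :
    orbRest σ (cyc f σ z) a = kprod f π' (z ∘ e ∘ Sum.inr) := by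
  subst he ha
  have h1 := orbRest_permCongr (cyc_orbInv hf (e.permCongr (sumCongr (finRotate n) π')) z)
    (orbitSumEquiv _ _ (Sum.inl (Quotient.mk _ ⟨0, hn⟩)))
  rw [orbRest_sumCongr_inl (cyc_orbInv hf _ _).comp_permCongr, orbRest_finRotate, one_mul,
    cyc_comp_permCongr, cyc_comp_inr] at h1
  exact h1

/-- The contribution of the annular noncrossing permutations of a pair of cycles. -/
noncomputable def annSum (κ : ∀ m : ℕ, (Fin m → A) → k) (r s : ℕ) (x : Fin r → A) (y : Fin s → A) :
    k :=
  ∑ᶠ ρ ∈ AnnOn (sumCongr (finRotate r) (finRotate s)), kprod κ ρ (Sum.elim x y)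

/-- The value of a two-variable family of functionals on a pair of orbits. -/
noncomputable def cyc₂ (g : ∀ r s : ℕ, (Fin r → A) → (Fin s → A) → k) (σ : Perm α) (τ : Perm β)
    (x : α → A) (y : β → A) (a : α) (b : β) : k :=
  g (Function.minimalPeriod σ a) (Function.minimalPeriod τ b) (word σ x a _) (word τ y b _)

/-- Marking one orbit on each side. -/
noncomputable def markSum₂ (κ : ∀ m : ℕ, (Fin m → A) → k)
    (g : ∀ r s : ℕ, (Fin r → A) → (Fin s → A) → k) (σ : Perm α) (τ : Perm β)
    (x : α → A) (y : β → A) : k :=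
  markSum σ (cyc κ σ x) fun a => markSum τ (cyc κ τ y) fun b => cyc₂ g σ τ x y a b

theorem sum_annOn_kprod [NoZeroDivisors k] [Finite α] [Finite β] {f κ : ∀ m : ℕ, (Fin m → A) → k}
    (hf : Cyclic f) (hκ : Cyclic κ) (h : MomentCumulant f κ) (σ : Perm α) (τ : Perm β)
    (z : α ⊕ β → A) :
    ∑ᶠ ρ ∈ AnnOn (sumCongr σ τ), kprod κ ρ z =
      markSum₂ f (annSum κ) σ τ (z ∘ Sum.inl) (z ∘ Sum.inr) := by
  rw [sum_annOn]
  unfold markSum₂ markSum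
  refine finsum_congr fun a => ?_
  rw [mul_finsum]
  refine finsum_congr fun b => ?_
  obtain ⟨σ', e, he0, heu, he⟩ := exists_split_orbit σ a.out
  obtain ⟨τ', e', he0', heu', he'⟩ := exists_split_orbit τ b.out
  have hr := minimalPeriod_perm_pos σ a.out
  have hs := minimalPeriod_perm_pos τ b.out
  have ha : e (Sum.inl ⟨0, hr⟩) = a.out := by rw [he0]; rfl
  have hb : e' (Sum.inl ⟨0, hs⟩) = b.out := by rw [he0']; rfl
  have h1 := sum_annAt hr hs he he' (fun ρ => kprod κ ρ z)
  rw [ha, hb] at h1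
  rw [h1, orbRest_split hf hr he _ (by rw [ha, Quotient.out_eq]),
    orbRest_split hf hs he' _ (by rw [hb, Quotient.out_eq])]
  set E := (Equiv.sumSumSumComm (Fin (Function.minimalPeriod σ a.out))
    (Fin (Function.minimalPeriod τ b.out)) _ _).trans (Equiv.sumCongr e e') with hE
  have hzl : (z ∘ E) ∘ Sum.inl = Sum.elim (word σ (z ∘ Sum.inl) a.out _)
      (word τ (z ∘ Sum.inr) b.out _) := by
    funext i
    rcases i with i | i
    · show z (Sum.inl (e (Sum.inl i))) = _
      rw [he0]
      rfl
    · show z (Sum.inr (e' (Sum.inl i))) = _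
      rw [he0']
      rfl
  have h2 : ∀ ρ₁ ρ₂, kprod κ (E.permCongr (sumCongr ρ₁ ρ₂)) z =
      kprod κ ρ₁ (Sum.elim (word σ (z ∘ Sum.inl) a.out _) (word τ (z ∘ Sum.inr) b.out _)) *
      kprod κ ρ₂ ((z ∘ E) ∘ Sum.inr) := by
    intro ρ₁ ρ₂
    rw [kprod_permCongr hκ, kprod_sumCongr hκ, hzl]
  simp only [h2]
  rw [← finsum_mem_mul_finsum_mem, ← kprod_eq_sum_below hf hκ h, kprod_sumCongr hf]
  show _ = kprod f σ' _ * (kprod f τ' _ * annSum κ _ _ _ _)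
  unfold annSum
  rw [mul_comm, mul_assoc]
  rfl

end Bridges

end AnnNC

namespace AnnNC

section TwoSided

open Equiv (Perm)
open Equiv.Perm

universe u v

variable {α β A k : Type*}

/-- Invariance of a two-variable family under rotating either of the arguments. -/
def BiCyclic (g : ∀ r s : ℕ, (Fin r → A) → (Fin s → A) → k) : Prop :=
  (∀ (s : ℕ) (y : Fin s → A), Cyclic fun r x => g r s x y) ∧
    ∀ (r : ℕ) (x : Fin r → A), Cyclic fun s y => g r s x y

theorem cyc₂_eq_left (g : ∀ r s : ℕ, (Fin r → A) → (Fin s → A) → k) (σ : Perm α) (τ : Perm β)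
    (x : α → A) (y : β → A) (a : α) (b : β) :
    cyc₂ g σ τ x y a b =
      cyc (fun r u => g r (Function.minimalPeriod τ b) u (word τ y b _)) σ x a := rfl

theorem cyc₂_eq_right (g : ∀ r s : ℕ, (Fin r → A) → (Fin s → A) → k) (σ : Perm α) (τ : Perm β)
    (x : α → A) (y : β → A) (a : α) (b : β) :
    cyc₂ g σ τ x y a b =
      cyc (fun s v => g (Function.minimalPeriod σ a) s (word σ x a _) v) τ y b := rfl

theorem orbInv_cyc₂_right [Finite β] {g : ∀ r s : ℕ, (Fin r → A) → (Fin s → A) → k}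
    (hg : BiCyclic g) (σ : Perm α) (τ : Perm β) (x : α → A) (y : β → A) (a : α) :
    OrbInv τ (cyc₂ g σ τ x y a) :=
  cyc_orbInv (hg.2 _ _) τ y

theorem minimalPeriod_inv (τ : Perm β) (b : β) :
    Function.minimalPeriod (τ⁻¹ : Perm β) b = Function.minimalPeriod τ b := by
  have h : ∀ (σ : Perm β) (n : ℕ), Function.IsPeriodicPt σ n b → Function.IsPeriodicPt (σ⁻¹ : Perm β) n b := by
    intro σ n h
    unfold Function.IsPeriodicPt Function.IsFixedPt at h ⊢
    rw [Equiv.Perm.iterate_eq_pow] at h ⊢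
    rw [inv_pow, Equiv.Perm.inv_eq_iff_eq]
    exact h.symm
  apply Nat.dvd_antisymm
  · exact ((h τ _ (Function.isPeriodicPt_minimalPeriod _ _))).minimalPeriod_dvd
  · have := h τ⁻¹ _ (Function.isPeriodicPt_minimalPeriod _ b)
    rw [inv_inv] at this
    exact this.minimalPeriod_dvd

theorem word_inv (τ : Perm β) (T : A → A) (y : β → A) {b : β} {m : ℕ} (h : (τ ^ m) b = b) :
    word τ⁻¹ (T ∘ y) (τ⁻¹ b) m = T ∘ word τ y b m ∘ Fin.rev := by
  funext i
  show T (y _) = T (y _)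
  congr 2
  rw [Fin.val_rev, ← Perm.mul_apply, ← pow_succ, inv_pow, Equiv.Perm.inv_eq_iff_eq,
    ← Perm.mul_apply, ← pow_add, show (i : ℕ) + 1 + (m - (i + 1)) = m by omega, h]

theorem cyc_inv [Finite β] {f : ∀ m : ℕ, (Fin m → A) → k} (hf : Cyclic f) (T : A → A) (τ : Perm β)
    (y : β → A) (b : β) :
    cyc f τ⁻¹ (T ∘ y) b = cyc (fun m v => f m (T ∘ v ∘ Fin.rev)) τ y b := by
  rw [← cyc_orbInv hf τ⁻¹ (T ∘ y) b, cyc_eq f _ (m := Function.minimalPeriod τ b),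
    word_inv τ T y (pow_minimalPeriod_apply τ b)]
  · rfl
  · rw [minimalPeriod_perm_apply, minimalPeriod_inv]

variable [CommRing k]

theorem orbInv_markSum_cyc₂ [Finite α] {g : ∀ r s : ℕ, (Fin r → A) → (Fin s → A) → k}
    (hg : BiCyclic g) (σ : Perm α) (τ : Perm β) (x : α → A) (y : β → A) (w : β → k) :
    OrbInv σ (fun a => markSum τ w fun b => cyc₂ g σ τ x y a b) := by
  intro a
  have h : ∀ b, cyc₂ g σ τ x y (σ a) b = cyc₂ g σ τ x y a b :=
    fun b => cyc_orbInv (hg.1 _ _) σ x a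
  simp only [h]

theorem markSum₂_permCongr_right {β' : Type*} [Finite β]
    {f : ∀ m : ℕ, (Fin m → A) → k} (hf : Cyclic f)
    {g : ∀ r s : ℕ, (Fin r → A) → (Fin s → A) → k}
    (hg : BiCyclic g) (σ : Perm α) (e : β' ≃ β) (τ : Perm β') (x : α → A) (y : β → A) :
    markSum₂ f g σ (e.permCongr τ) x y = markSum₂ f g σ τ x (y ∘ e) := by
  unfold markSum₂
  congr 1
  funext a
  rw [markSum_permCongr (cyc_orbInv hf _ _) (orbInv_cyc₂_right hg _ _ _ _ _), cyc_comp_permCongr]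
  congr 1
  exact cyc_comp_permCongr (fun s v => g (Function.minimalPeriod σ a) s (word σ x a _) v) e τ y

theorem markSum₂_permCongr_left {α' : Type*} [Finite α]
    {f : ∀ m : ℕ, (Fin m → A) → k} (hf : Cyclic f)
    {g : ∀ r s : ℕ, (Fin r → A) → (Fin s → A) → k}
    (hg : BiCyclic g) (e : α' ≃ α) (σ : Perm α') (τ : Perm β) (x : α → A) (y : β → A) :
    markSum₂ f g (e.permCongr σ) τ x y = markSum₂ f g σ τ (x ∘ e) y := by
  unfold markSum₂
  rw [markSum_permCongr (cyc_orbInv hf _ _) (orbInv_markSum_cyc₂ hg _ _ _ _ _), cyc_comp_permCongr]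
  congr 1
  funext a
  show markSum (k := k) τ _ _ = markSum τ _ _
  congr 1
  funext b
  exact congrFun (cyc_comp_permCongr
    (fun r u => g r (Function.minimalPeriod τ b) u (word τ y b _)) e σ x) a

theorem markSum_inv (τ : Perm β) (w g : β → k) : markSum τ⁻¹ w g = markSum τ w g := by
  unfold markSum orbRest
  rw [orbitSetoid_inv]

theorem markSum₂_inv [Finite β] {f : ∀ m : ℕ, (Fin m → A) → k} (hf : Cyclic f)
    {g : ∀ r s : ℕ, (Fin r → A) → (Fin s → A) → k} (hg : BiCyclic g) {T : A → A}
    (hT : ∀ m v, f m (T ∘ v ∘ Fin.rev) = f m v) (σ : Perm α) (τ : Perm β) (x : α → A)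
    (y : β → A) :
    markSum₂ f g σ τ⁻¹ x (T ∘ y) =
      markSum₂ f (fun r s u v => g r s u (T ∘ v ∘ Fin.rev)) σ τ x y := by
  unfold markSum₂
  congr 1
  funext a
  rw [markSum_inv]
  congr 1
  · funext b
    rw [cyc_inv hf]
    simp only [hT]
  · funext b
    rw [cyc₂_eq_right, cyc_inv (hg.2 _ _)]
    rfl

theorem sum_annOn_permCongr {α' β' M : Type*} [AddCommMonoid M] (e : α ≃ α') (e' : β ≃ β')
    (π : Perm (α ⊕ β)) (F : Perm (α' ⊕ β') → M) :
    ∑ᶠ ρ ∈ AnnOn ((Equiv.sumCongr e e').permCongr π), F ρ =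
      ∑ᶠ ρ ∈ AnnOn π, F ((Equiv.sumCongr e e').permCongr ρ) := by
  symm
  set E := Equiv.sumCongr e e' with hE
  have hmem : ∀ ρ, E.permCongr ρ ∈ AnnOn (E.permCongr π) ↔ ρ ∈ AnnOn π := by
    intro ρ
    have h1 : Cross (E.permCongr ρ) ↔ Cross ρ := by
      constructor
      · rintro ⟨x, y, h⟩
        obtain ⟨x, rfl⟩ := e.surjective x
        obtain ⟨y, rfl⟩ := e'.surjective y
        exact ⟨x, y, (sameCycle_permCongr E ρ _ _).1 h⟩
      · rintro ⟨x, y, h⟩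
        exact ⟨e x, e' y, (sameCycle_permCongr E ρ _ _).2 h⟩
    show _ ∧ _ ↔ _ ∧ _
    rw [h1, permCongr_inv_mul, numOrbits_permCongr, numOrbits_permCongr, numOrbits_permCongr,
      Nat.card_congr E]
  refine finsum_mem_eq_of_bijOn E.permCongr ⟨?_, E.permCongr.injective.injOn, ?_⟩ (fun _ _ => rfl)
  · intro ρ hρ
    exact (hmem ρ).2 hρ
  · intro ρ hρ
    obtain ⟨ρ', rfl⟩ := E.permCongr.surjective ρ
    exact ⟨ρ', (hmem ρ').1 hρ, rfl⟩

theorem sumCongr_permCongr {α' β' : Type*} (e : α ≃ α') (e' : β ≃ β') (σ : Perm α) (τ : Perm β) :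
    (Equiv.sumCongr e e').permCongr (sumCongr σ τ) = sumCongr (e.permCongr σ) (e'.permCongr τ) := by
  ext (a | b) <;> rfl

theorem annSum_biCyclic {κ : ∀ m : ℕ, (Fin m → A) → k} (hκ : Cyclic κ) : BiCyclic (annSum κ) := by
  have key : ∀ (r s : ℕ) (g : Perm (Fin r)) (g' : Perm (Fin s)) (x : Fin r → A) (y : Fin s → A),
      g.permCongr (finRotate r) = finRotate r → g'.permCongr (finRotate s) = finRotate s →
      annSum κ r s (x ∘ g) (y ∘ g') = annSum κ r s x y := by
    intro r s g g' x y hg hg'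
    unfold annSum
    conv_rhs => rw [← hg, ← hg', ← sumCongr_permCongr]
    rw [sum_annOn_permCongr]
    refine finsum_mem_congr rfl fun ρ _ => ?_
    rw [kprod_permCongr hκ]
    congr 1
    funext i
    rcases i with i | i <;> rfl
  constructor
  · intro s y r x
    exact key r s (finRotate r) 1 x y (permCongr_self _ _ rfl) (permCongr_self _ _ rfl)
  · intro r x s y
    exact key r s 1 (finRotate s) x y (permCongr_self _ _ rfl) (permCongr_self _ _ rfl)

/-- The marked moments attached to a two-variable family. -/
noncomputable def markedMoment₂ (κ : ∀ m : ℕ, (Fin m → A) → k)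
    (g : ∀ r s : ℕ, (Fin r → A) → (Fin s → A) → k) (r s : ℕ) (x : Fin r → A) (y : Fin s → A) : k :=
  ∑ᶠ ρ ∈ Below (finRotate r), ∑ᶠ ρ' ∈ Below (finRotate s), markSum₂ κ g ρ ρ' x y

theorem sum_markSum₂_below [NoZeroDivisors k] {α : Type u} {β : Type v} [Finite α] [Finite β]
    {f κ : ∀ m : ℕ, (Fin m → A) → k} {g : ∀ r s : ℕ, (Fin r → A) → (Fin s → A) → k}
    (hf : Cyclic f) (hκ : Cyclic κ) (hg : BiCyclic g) (h : MomentCumulant f κ)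
    (σ : Perm α) (τ : Perm β) (x : α → A) (y : β → A) :
    ∑ᶠ σ' ∈ Below σ, ∑ᶠ τ' ∈ Below τ, markSum₂ κ g σ' τ' x y =
      markSum₂ f (markedMoment₂ κ g) σ τ x y := by
  let H : ∀ m : ℕ, (Fin m → A) → k := fun m u =>
    markSum τ (cyc f τ y) (cyc (markedMoment κ fun s v => g m s u v) τ y)
  have hH : Cyclic H := by
    intro m u
    show markSum τ _ _ = markSum τ _ _
    congr 2
    funext s v
    unfold markedMoment
    refine finsum_mem_congr rfl fun ρ _ => ?_
    congr 1
    funext b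
    exact hg.1 _ _ m u
  have h1 : ∀ σ' : Perm α, ∑ᶠ τ' ∈ Below τ, markSum₂ κ g σ' τ' x y =
      markSum σ' (cyc κ σ' x) (cyc H σ' x) := by
    intro σ'
    unfold markSum₂
    rw [← markSum_finsum_mem (Set.toFinite _)]
    congr 1
    funext a
    exact sum_markSum_below hf hκ (hg.2 _ _) h τ y
  have h2 : ∀ m u, markedMoment κ H m u =
      markSum τ (cyc f τ y) fun b => 
        markedMoment₂ κ g m (Function.minimalPeriod τ b) u (word τ y b _) := by
    intro m u
    unfold markedMoment markedMoment₂
    rw [markSum_finsum_mem (Set.toFinite _)]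
    refine finsum_mem_congr rfl fun ρ _ => ?_
    show markSum ρ _ (fun a => markSum τ _ fun b => _) = _
    rw [markSum_comm]
    congr 1
    funext b
    unfold markSum₂
    rw [← markSum_finsum_mem (Set.toFinite _)]
    rfl
  rw [finsum_mem_congr rfl fun σ' _ => h1 σ', sum_markSum_below hf hκ hH h]
  unfold markSum₂
  congr 1
  funext a
  exact h2 _ _

end TwoSided

end AnnNC

namespace AnnNC

section Intervals

open Equiv (Perm)
open Equiv.Perm

variable {γ : Type*}

theorem Geo.trans [Finite γ] {a b c : Perm γ} (hab : Geo a b) (hbc : Geo b c) : Geo a c := by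
  have h1 := orbits_triangle (a⁻¹ * b) (a⁻¹ * c)
  have h2 := orbits_triangle a c
  rw [show (a⁻¹ * b)⁻¹ * (a⁻¹ * c) = b⁻¹ * c by group] at h1
  unfold Geo at *
  omega

theorem numOrbits_complement (T π ρ : Perm γ) :
    numOrbits ((ρ⁻¹ * T)⁻¹ * (π⁻¹ * T)) = numOrbits (π⁻¹ * ρ) := by
  rw [← numOrbits_conj T, show T * ((ρ⁻¹ * T)⁻¹ * (π⁻¹ * T)) * T⁻¹ = ρ * π⁻¹ by group,
    numOrbits_mul_comm]

theorem numOrbits_complement_complement (T π : Perm γ) :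
    numOrbits ((π⁻¹ * T)⁻¹ * T) = numOrbits π := by
  rw [← numOrbits_conj T, show T * ((π⁻¹ * T)⁻¹ * T) * T⁻¹ = π by group]

theorem geo_self [Finite γ] (π : Perm γ) : Geo π π := by
  unfold Geo
  rw [inv_mul_cancel, numOrbits_one, add_comm]

theorem geo_one (π : Perm γ) : Geo 1 π := by
  unfold Geo
  rw [numOrbits_one, inv_one, one_mul]

theorem Geo.numOrbits_lt [Finite γ] {π ρ : Perm γ} (h : Geo π ρ) (hne : ρ ≠ π) :
    numOrbits ρ < numOrbits π := by
  by_contra hcon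
  unfold Geo at h
  have h1 : π⁻¹ * ρ = 1 := eq_one_of_numOrbits (by omega)
  exact hne (inv_mul_eq_one.1 h1).symm

theorem geo_complement_iff {T π ρ : Perm γ} (hπ : Geo π T) (hρ : Geo ρ T) :
    Geo (ρ⁻¹ * T) (π⁻¹ * T) ↔ Geo π ρ := by
  unfold Geo at *
  rw [numOrbits_complement]
  omega

theorem geo_complement {T π : Perm γ} (hπ : Geo π T) : Geo (π⁻¹ * T) T := by
  unfold Geo at *
  rw [numOrbits_complement_complement]
  omega

variable {α β : Type*} {σ₀ : Perm α} {τ₀ : Perm β}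

theorem not_cross_sumCongr (σ : Perm α) (τ : Perm β) : ¬ Cross (sumCongr σ τ) :=
  fun ⟨x, y, h⟩ => not_sameCycle_inl_inr σ τ x y h

theorem Cross.ne_one {ρ : Perm (α ⊕ β)} (h : Cross ρ) : ρ ≠ 1 := by
  rintro rfl
  exact not_cross_sumCongr 1 1 (by rwa [Equiv.Perm.sumCongr_one])

variable [Finite α] [Finite β]

theorem exists_sumCongr_of_not_cross {ρ : Perm (α ⊕ β)} (h : ¬ Cross ρ) :
    ∃ σ τ, ρ = sumCongr σ τ :=
  exists_sumCongr fun x y hxy => h ⟨x, y, hxy⟩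

theorem Geo.not_cross {ρ : Perm (α ⊕ β)} {σ : Perm α} {τ : Perm β} (h : Geo ρ (sumCongr σ τ)) :
    ¬ Cross ρ := by
  obtain ⟨σ', τ', rfl⟩ := h.exists_sumCongr
  exact not_cross_sumCongr σ' τ'

theorem annOn_subset {π : Perm (α ⊕ β)} (hπ : Geo π (sumCongr σ₀ τ₀)) :
    AnnOn π ⊆ AnnOn (sumCongr σ₀ τ₀) := by
  rintro ρ ⟨hc, h⟩
  refine ⟨hc, ?_⟩
  have h1 := orbits_triangle (ρ⁻¹ * π) (ρ⁻¹ * sumCongr σ₀ τ₀)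
  rw [show (ρ⁻¹ * π)⁻¹ * (ρ⁻¹ * sumCongr σ₀ τ₀) = π⁻¹ * sumCongr σ₀ τ₀ by group] at h1
  have h2 := hc.orbits_triangle σ₀ τ₀
  unfold Geo at hπ
  omega

theorem below_annOn (hσ : numOrbits σ₀ = 1) (hτ : numOrbits τ₀ = 1)
    {π ρ : Perm (α ⊕ β)} (hπ : π ∈ AnnOn (sumCongr σ₀ τ₀)) (h : Geo ρ π) :
    Geo ρ (sumCongr σ₀ τ₀) ∨ ρ ∈ AnnOn (sumCongr σ₀ τ₀) := by
  have hT : numOrbits (sumCongr σ₀ τ₀) = 2 := by rw [numOrbits_sumCongr, hσ, hτ]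
  obtain ⟨hc, hπ⟩ := hπ
  have heq : (ρ⁻¹ * π) * (π⁻¹ * sumCongr σ₀ τ₀) = ρ⁻¹ * sumCongr σ₀ τ₀ := by group
  have h1 := orbits_triangle (ρ⁻¹ * π) (ρ⁻¹ * sumCongr σ₀ τ₀)
  rw [show (ρ⁻¹ * π)⁻¹ * (ρ⁻¹ * sumCongr σ₀ τ₀) = π⁻¹ * sumCongr σ₀ τ₀ by group] at h1
  unfold Geo at h
  by_cases hρ : Cross ρ
  · right
    refine ⟨hρ, ?_⟩
    have h2 := hρ.orbits_triangle σ₀ τ₀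
    omega
  · left
    obtain ⟨σ, τ, rfl⟩ := exists_sumCongr_of_not_cross hρ
    have hb : ∃ x y, ((sumCongr σ τ)⁻¹ * π).SameCycle (Sum.inl x) (Sum.inr y) := by
      by_contra hcon
      push Not at hcon
      obtain ⟨σ', τ', h'⟩ := exists_sumCongr hcon
      rw [inv_mul_eq_iff_eq_mul, Equiv.Perm.sumCongr_mul] at h'
      rw [h'] at hc
      exact not_cross_sumCongr _ _ hc
    obtain ⟨x, y, hxy⟩ := hb
    have hJ := numJoin_lt (π := (sumCongr σ τ)⁻¹ * sumCongr σ₀ τ₀) hxy (by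
      rw [sumCongr_inv_mul]
      exact not_sameCycle_inl_inr _ _ _ _)
    have h2 := genus_nonneg ((sumCongr σ τ)⁻¹ * π) (π⁻¹ * sumCongr σ₀ τ₀)
    rw [heq, show π⁻¹ * sumCongr σ₀ τ₀ =
      ((sumCongr σ τ)⁻¹ * π)⁻¹ * ((sumCongr σ τ)⁻¹ * sumCongr σ₀ τ₀) by group,
      numJoin_inv_mul, show ((sumCongr σ τ)⁻¹ * π)⁻¹ * ((sumCongr σ τ)⁻¹ * sumCongr σ₀ τ₀) =
      π⁻¹ * sumCongr σ₀ τ₀ by group] at h2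
    have h3 := orbits_triangle (sumCongr σ τ) (sumCongr σ₀ τ₀)
    unfold Geo
    omega

theorem complement_mem_annOn (hσ : numOrbits σ₀ = 1) (hτ : numOrbits τ₀ = 1)
    {π : Perm (α ⊕ β)} (hπ : π ∈ AnnOn (sumCongr σ₀ τ₀)) :
    π⁻¹ * sumCongr σ₀ τ₀ ∈ AnnOn (sumCongr σ₀ τ₀) := by
  have hT : numOrbits (sumCongr σ₀ τ₀) = 2 := by rw [numOrbits_sumCongr, hσ, hτ]
  obtain ⟨hc, hπ⟩ := hπ
  constructor
  · by_contra hcon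
    obtain ⟨σ, τ, h⟩ := exists_sumCongr_of_not_cross hcon
    rw [inv_mul_eq_iff_eq_mul, ← mul_inv_eq_iff_eq_mul, Equiv.Perm.sumCongr_inv,
      Equiv.Perm.sumCongr_mul] at h
    rw [← h] at hc
    exact not_cross_sumCongr _ _ hc
  · rw [numOrbits_complement_complement]
    omega

theorem geo_complement_iff_annOn (hσ : numOrbits σ₀ = 1) (hτ : numOrbits τ₀ = 1)
    {π ρ : Perm (α ⊕ β)} (hπ : π ∈ AnnOn (sumCongr σ₀ τ₀))
    (hρ : ρ ∈ AnnOn (sumCongr σ₀ τ₀)) :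
    Geo (ρ⁻¹ * sumCongr σ₀ τ₀) (π⁻¹ * sumCongr σ₀ τ₀) ↔ Geo π ρ := by
  have hT : numOrbits (sumCongr σ₀ τ₀) = 2 := by rw [numOrbits_sumCongr, hσ, hτ]
  obtain ⟨-, hπ⟩ := hπ
  obtain ⟨-, hρ⟩ := hρ
  unfold Geo
  rw [numOrbits_complement]
  omega

theorem geo_complement_iff_mem_annOn (hσ : numOrbits σ₀ = 1) (hτ : numOrbits τ₀ = 1)
    {π ρ : Perm (α ⊕ β)} (hπ : π ∈ AnnOn (sumCongr σ₀ τ₀))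
    (hρ : Geo ρ (sumCongr σ₀ τ₀)) :
    Geo (ρ⁻¹ * sumCongr σ₀ τ₀) (π⁻¹ * sumCongr σ₀ τ₀) ↔ π ∈ AnnOn ρ := by
  have hT : numOrbits (sumCongr σ₀ τ₀) = 2 := by rw [numOrbits_sumCongr, hσ, hτ]
  have h1 : π ∈ AnnOn ρ ↔ numOrbits π + numOrbits (π⁻¹ * ρ) + 2 =
      Nat.card (α ⊕ β) + numOrbits ρ := ⟨fun h => h.2, fun h => ⟨hπ.1, h⟩⟩
  rw [h1]
  obtain ⟨-, hπ⟩ := hπ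
  unfold Geo at *
  rw [numOrbits_complement]
  omega

theorem complement_mem_annOn_complement_iff (hσ : numOrbits σ₀ = 1) (hτ : numOrbits τ₀ = 1)
    {π ρ : Perm (α ⊕ β)} (hπ : Geo π (sumCongr σ₀ τ₀))
    (hρ : ρ ∈ AnnOn (sumCongr σ₀ τ₀)) :
    ρ⁻¹ * sumCongr σ₀ τ₀ ∈ AnnOn (π⁻¹ * sumCongr σ₀ τ₀) ↔ Geo π ρ := by
  have hT : numOrbits (sumCongr σ₀ τ₀) = 2 := by rw [numOrbits_sumCongr, hσ, hτ]
  have h1 : ρ⁻¹ * sumCongr σ₀ τ₀ ∈ AnnOn (π⁻¹ * sumCongr σ₀ τ₀) ↔ _ =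
      Nat.card (α ⊕ β) + numOrbits (π⁻¹ * sumCongr σ₀ τ₀) :=
    ⟨fun h => h.2, fun h => ⟨(complement_mem_annOn hσ hτ hρ).1, h⟩⟩
  rw [h1]
  obtain ⟨-, hρ⟩ := hρ
  unfold Geo at *
  rw [numOrbits_complement]
  omega

theorem complement_bijOn_below (T : Perm γ) :
    Set.BijOn (fun π => π⁻¹ * T) (Below T) (Below T) := by
  refine ⟨fun π hπ => geo_complement hπ, ?_, ?_⟩
  · intro π _ ρ _ h
    exact inv_injective (mul_right_cancel h)
  · intro π hπ
    refine ⟨T * π⁻¹, ?_, by group⟩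
    have h : Geo π T := hπ
    show Geo _ _
    unfold Geo at *
    rw [← numOrbits_conj T⁻¹ (T * π⁻¹), show T⁻¹ * (T * π⁻¹) * T⁻¹⁻¹ = π⁻¹ * T by group,
      show (T * π⁻¹)⁻¹ * T = π by group]
    omega

theorem complement_bijOn_annOn (hσ : numOrbits σ₀ = 1) (hτ : numOrbits τ₀ = 1)
    : Set.BijOn (fun π => π⁻¹ * sumCongr σ₀ τ₀)
    (AnnOn (sumCongr σ₀ τ₀)) (AnnOn (sumCongr σ₀ τ₀)) := by
  have hinj : Set.InjOn (fun π => π⁻¹ * sumCongr σ₀ τ₀) (AnnOn (sumCongr σ₀ τ₀)) := by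
    intro π _ ρ _ h
    exact inv_injective (mul_right_cancel h)
  have hmaps : Set.MapsTo (fun π => π⁻¹ * sumCongr σ₀ τ₀) (AnnOn (sumCongr σ₀ τ₀))
      (AnnOn (sumCongr σ₀ τ₀)) := fun π hπ => complement_mem_annOn hσ hτ hπ
  refine ⟨hmaps, hinj, ?_⟩
  exact (Set.eq_of_subset_of_ncard_le hmaps.image_subset
    hinj.ncard_image.ge).ge

end Intervals

end AnnNC

namespace AnnNC

section MobiusPairs

open Equiv (Perm)
open Equiv.Perm

variable {k : Type*} [CommRing k]

open scoped Classical in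
theorem finsum_mem_sep {ι M : Type*} [AddCommMonoid M] (s : Set ι) (R : ι → Prop) (F : ι → M) :
    ∑ᶠ i ∈ {i | i ∈ s ∧ R i}, F i = ∑ᶠ i ∈ s, if R i then F i else 0 := by
  refine finsum_congr fun i => ?_
  by_cases hi : i ∈ s <;> by_cases hR : R i <;> simp [hi, hR]

open scoped Classical in
theorem finsum_mem_ite_eq_mul {ι : Type*} {s : Set ι} {a : ι} (ha : a ∈ s) (F : ι → k) :
    ∑ᶠ i ∈ s, (if i = a then 1 else 0) * F i = F a := by
  rw [← finsum_mem_inter_support_eq' _ {a}, finsum_mem_singleton, if_pos rfl, one_mul]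
  intro i hi
  have : i = a := by
    by_contra hne
    exact hi (by simp [hne])
  simp [this, ha]

theorem finsum_mem_mul_finsum_mem_comm [NoZeroDivisors k] {ι κ : Type*} [Finite ι] [Finite κ]
    (s : Set ι) (t : Set κ) (R : ι → κ → Prop) (a : ι → k) (F : κ → k) :
    ∑ᶠ i ∈ s, a i * ∑ᶠ j ∈ {j | j ∈ t ∧ R i j}, F j =
      ∑ᶠ j ∈ t, (∑ᶠ i ∈ {i | i ∈ s ∧ R i j}, a i) * F j := by
  classical
  rw [finsum_mem_congr rfl (g := fun i => ∑ᶠ j ∈ t, if R i j then a i * F j else 0),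
    finsum_mem_comm _ (Set.toFinite _) (Set.toFinite _)]
  · refine finsum_mem_congr rfl fun j _ => ?_
    rw [finsum_mem_sep, finsum_mem_mul]
    exact finsum_mem_congr rfl fun i _ => by split_ifs <;> simp
  · intro i _
    rw [finsum_mem_sep, mul_finsum_mem]
    exact finsum_mem_congr rfl fun j _ => by split_ifs <;> simp

theorem eq_zero_of_sum_above {γ : Type*} [Finite γ] {S : Set (Perm γ)} {d : Perm γ → k}
    (h : ∀ π ∈ S, ∑ᶠ ρ ∈ {ρ | ρ ∈ S ∧ Geo π ρ}, d ρ = 0) : ∀ π ∈ S, d π = 0 := by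
  have key : ∀ (N : ℕ), ∀ π ∈ S, numOrbits π = N → d π = 0 := by
    intro N
    induction N using Nat.strong_induction_on with
    | _ N ih =>
      rintro π hπ rfl
      have h1 := h π hπ
      rwa [← Set.insert_sdiff_self_of_mem (show π ∈ {ρ | ρ ∈ S ∧ Geo π ρ} from ⟨hπ, geo_self π⟩),
        finsum_mem_insert _ (by simp) (Set.toFinite _),
        finsum_mem_eq_zero_of_forall_eq_zero, add_zero] at h1
      rintro ρ ⟨⟨hρ, hg⟩, hne⟩
      exact ih _ (hg.numOrbits_lt hne) ρ hρ rfl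
  exact fun π hπ => key _ π hπ rfl

theorem eq_of_sum_above {γ : Type*} [Finite γ] {S : Set (Perm γ)} {d d' : Perm γ → k}
    (h : ∀ π ∈ S, ∑ᶠ ρ ∈ {ρ | ρ ∈ S ∧ Geo π ρ}, d ρ = ∑ᶠ ρ ∈ {ρ | ρ ∈ S ∧ Geo π ρ}, d' ρ) :
    ∀ π ∈ S, d π = d' π := by
  intro π hπ
  refine sub_eq_zero.1 (eq_zero_of_sum_above (S := S) (d := fun ρ => d ρ - d' ρ) ?_ π hπ)
  intro π hπ
  exact (finsum_mem_sub_distrib _ _ (Set.toFinite _)).trans (sub_eq_zero.2 (h π hπ))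

variable {α β : Type*} [Finite α] [Finite β]

open scoped Classical in
/-- The recursions satisfied by the Möbius function `μ(·, 1)` of the self-dual annular poset, on
unhatted (`u`) and hatted (`v`) permutations. -/
structure MobiusPair (σ₀ : Perm α) (τ₀ : Perm β) (u v : Perm (α ⊕ β) → k) : Prop where
  hat : ∀ π ∈ Below (sumCongr σ₀ τ₀),
    ∑ᶠ ρ ∈ {ρ | ρ ∈ Below (sumCongr σ₀ τ₀) ∧ Geo π ρ}, v ρ = if π = sumCongr σ₀ τ₀ then 1 else 0
  disc : ∀ π ∈ Below (sumCongr σ₀ τ₀),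
    ∑ᶠ ρ ∈ {ρ | ρ ∈ Below (sumCongr σ₀ τ₀) ∧ Geo π ρ}, u ρ +
      ∑ᶠ ρ ∈ {ρ | ρ ∈ AnnOn (sumCongr σ₀ τ₀) ∧ Geo π ρ}, u ρ +
      (if π = sumCongr σ₀ τ₀ then 1 else 0) = 0
  ann : ∀ π ∈ AnnOn (sumCongr σ₀ τ₀),
    ∑ᶠ ρ ∈ {ρ | ρ ∈ AnnOn (sumCongr σ₀ τ₀) ∧ Geo π ρ}, u ρ +
      ∑ᶠ ρ ∈ {ρ | ρ ∈ Below (sumCongr σ₀ τ₀) ∧ π ∈ AnnOn ρ}, v ρ = 0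

variable {σ₀ : Perm α} {τ₀ : Perm β} {u v : Perm (α ⊕ β) → k}

theorem MobiusPair.sum_hat [NoZeroDivisors k] (H : MobiusPair σ₀ τ₀ u v) (F : Perm (α ⊕ β) → k) :
    ∑ᶠ π ∈ Below (sumCongr σ₀ τ₀), v π * ∑ᶠ ρ ∈ Below π, F ρ = F (sumCongr σ₀ τ₀) := by
  classical
  rw [finsum_mem_congr rfl (g := fun π =>
    v π * ∑ᶠ ρ ∈ {ρ | ρ ∈ Below (sumCongr σ₀ τ₀) ∧ Geo ρ π}, F ρ)]
  · rw [finsum_mem_mul_finsum_mem_comm, ← finsum_mem_ite_eq_mul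
      (show sumCongr σ₀ τ₀ ∈ Below (sumCongr σ₀ τ₀) from geo_self _) F]
    exact finsum_mem_congr rfl fun ρ hρ => by rw [H.hat ρ hρ]
  · intro π hπ
    congr 2
    ext ρ
    exact finsum_congr_Prop (propext ⟨fun h => ⟨Geo.trans h hπ, h⟩, fun h => h.2⟩) fun _ => rfl

theorem MobiusPair.sum_disc_add_ann [NoZeroDivisors k] (H : MobiusPair σ₀ τ₀ u v)
    (hσ : numOrbits σ₀ = 1) (hτ : numOrbits τ₀ = 1) (F : Perm (α ⊕ β) → k) :
    ∑ᶠ π ∈ Below (sumCongr σ₀ τ₀), u π * ∑ᶠ ρ ∈ Below π, F ρ +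
      ∑ᶠ π ∈ AnnOn (sumCongr σ₀ τ₀), u π * ∑ᶠ ρ ∈ Below π, F ρ +
      ∑ᶠ π ∈ Below (sumCongr σ₀ τ₀), v π * (∑ᶠ ρ ∈ Below π, F ρ + ∑ᶠ ρ ∈ AnnOn π, F ρ) = 0 := by
  classical
  set T := sumCongr σ₀ τ₀ with hT
  have h1 : ∑ᶠ π ∈ Below T, u π * ∑ᶠ ρ ∈ Below π, F ρ =
      ∑ᶠ ρ ∈ Below T, (∑ᶠ π ∈ {π | π ∈ Below T ∧ Geo ρ π}, u π) * F ρ := by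
    rw [← finsum_mem_mul_finsum_mem_comm]
    refine finsum_mem_congr rfl fun π hπ => ?_
    congr 2
    ext ρ
    exact finsum_congr_Prop (propext ⟨fun h => ⟨Geo.trans h hπ, h⟩, fun h => h.2⟩) fun _ => rfl
  have h2 : ∑ᶠ π ∈ AnnOn T, u π * ∑ᶠ ρ ∈ Below π, F ρ =
      ∑ᶠ ρ ∈ Below T, (∑ᶠ π ∈ {π | π ∈ AnnOn T ∧ Geo ρ π}, u π) * F ρ +
      ∑ᶠ ρ ∈ AnnOn T, (∑ᶠ π ∈ {π | π ∈ AnnOn T ∧ Geo ρ π}, u π) * F ρ := by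
    rw [← finsum_mem_mul_finsum_mem_comm, ← finsum_mem_mul_finsum_mem_comm,
      ← finsum_mem_add_distrib (Set.toFinite _)]
    refine finsum_mem_congr rfl fun π hπ => ?_
    rw [← mul_add, ← finsum_mem_union _ (Set.toFinite _) (Set.toFinite _)]
    · congr 2
      ext ρ
      refine finsum_congr_Prop (propext ⟨fun h => ?_, fun h => ?_⟩) fun _ => rfl
      · exact (below_annOn hσ hτ hπ h).imp (fun h' => ⟨h', h⟩) (fun h' => ⟨h', h⟩)
      · exact h.elim (fun h' => h'.2) (fun h' => h'.2)
    · rw [Set.disjoint_left]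
      rintro ρ ⟨h, -⟩ ⟨h', -⟩
      exact Geo.not_cross h h'.1
  have h3 : ∑ᶠ π ∈ Below T, v π * ∑ᶠ ρ ∈ AnnOn π, F ρ =
      ∑ᶠ ρ ∈ AnnOn T, (∑ᶠ π ∈ {π | π ∈ Below T ∧ ρ ∈ AnnOn π}, v π) * F ρ := by
    rw [← finsum_mem_mul_finsum_mem_comm]
    refine finsum_mem_congr rfl fun π hπ => ?_
    congr 2
    ext ρ
    exact finsum_congr_Prop (propext ⟨fun h => ⟨annOn_subset hπ h, h⟩, fun h => h.2⟩) fun _ => rfl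
  have h4 : F T = ∑ᶠ ρ ∈ Below T, (if ρ = T then 1 else 0) * F ρ := by
    rw [finsum_mem_ite_eq_mul (show T ∈ Below T from geo_self _)]
  simp only [mul_add]
  rw [finsum_mem_add_distrib (Set.toFinite _), H.sum_hat, h1, h2, h3, h4]
  have h5 : ∀ {a b c d e : k}, a + c + e = 0 → b + d = 0 → a + (c + b) + (e + d) = 0 := by
    intro a b c d e h h'
    linear_combination h + h'
  apply h5
  · rw [← finsum_mem_add_distrib (Set.toFinite _), ← finsum_mem_add_distrib (Set.toFinite _)]
    refine finsum_mem_eq_zero_of_forall_eq_zero fun ρ hρ => ?_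
    rw [← add_mul, ← add_mul, H.disc ρ hρ, zero_mul]
  · rw [← finsum_mem_add_distrib (Set.toFinite _)]
    refine finsum_mem_eq_zero_of_forall_eq_zero fun ρ hρ => ?_
    rw [← add_mul, H.ann ρ hρ, zero_mul]

end MobiusPairs

end AnnNC

namespace AnnNC

section Recursion

open Equiv (Perm)
open Equiv.Perm

open scoped Classical in
theorem exists_recursive {ι R : Type*} [Zero R] (size : ι → ℕ) (Φ : ι → (ι → R) → R) :
    ∃ c : ι → R, ∀ i, c i = Φ i fun j => if size j < size i then c j else 0 := by
  let wf := (measure size).wf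
  let F : ∀ i, (∀ j, size j < size i → R) → R :=
    fun i c => Φ i fun j => if h : size j < size i then c j h else 0
  refine ⟨wf.fix F, fun i => ?_⟩
  rw [wf.fix_eq]
  show Φ i _ = _
  congr 1

theorem minimalPeriod_lt {n : ℕ} {π : Perm (Fin n)} (h : numOrbits π ≠ 1) (a : Fin n) :
    Function.minimalPeriod π a < n := by
  have hle : Function.minimalPeriod π a ≤ n := by
    have := Function.minimalPeriod_le_card (f := π) (x := a)
    simpa using this
  refine lt_of_le_of_ne hle fun heq => h ?_
  have hinj : Function.Injective fun i : Fin n => (π ^ (i : ℕ)) a := by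
    intro i j hij
    simp only [← Equiv.Perm.iterate_eq_pow] at hij
    refine Fin.ext (Function.iterate_injOn_Iio_minimalPeriod ?_ ?_ hij)
    · rw [Set.mem_Iio, heq]; exact i.2
    · rw [Set.mem_Iio, heq]; exact j.2
  have hsurj := Finite.surjective_of_injective hinj
  unfold numOrbits
  rw [Nat.card_eq_one_iff_unique]
  refine ⟨⟨fun x y => ?_⟩, ⟨Quotient.mk _ a⟩⟩
  have key : ∀ x : Quotient (orbitSetoid π), x = Quotient.mk _ a := by
    intro x
    induction x using Quotient.inductionOn with
    | _ x =>
      obtain ⟨i, hi⟩ := hsurj x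
      exact Quotient.sound (SameCycle.symm ⟨i, by simpa using hi⟩)
  rw [key x, key y]

theorem numOrbits_ne_one_of_below {n : ℕ} (hn : 0 < n) {π : Perm (Fin n)}
    (h : π ∈ Below (finRotate n)) (hne : π ≠ finRotate n) : numOrbits π ≠ 1 := by
  have := Geo.numOrbits_lt (show Geo π (finRotate n) from h) (Ne.symm hne)
  rw [numOrbits_finRotate hn] at this
  omega

theorem below_finRotate {n : ℕ} :
    Below (finRotate n) = insert (finRotate n) (Below (finRotate n) \ {finRotate n}) := by
  rw [Set.insert_sdiff_self_of_mem]
  exact geo_self _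

theorem sum_below_finRotate {M : Type*} [AddCommMonoid M] {n : ℕ} (F : Perm (Fin n) → M) :
    ∑ᶠ ρ ∈ Below (finRotate n), F ρ =
      F (finRotate n) + ∑ᶠ ρ ∈ Below (finRotate n) \ {finRotate n}, F ρ := by
  conv_lhs => rw [below_finRotate]
  rw [finsum_mem_insert _ (by simp) (Set.toFinite _)]

variable {A k : Type*} [CommRing k]

theorem kprod_congr {α : Type*} {κ κ' : ∀ m : ℕ, (Fin m → A) → k} {π : Perm α}
    (h : ∀ a x, κ (Function.minimalPeriod π a) x = κ' (Function.minimalPeriod π a) x) (z : α → A) :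
    kprod κ π z = kprod κ' π z := by
  unfold kprod orbProd cyc
  exact finprod_congr fun c => h _ _

/-- The indicator of arity one, the moments of the constant variable under which all free cumulant
products cancel over nontrivial intervals. -/
def unitMoment (m : ℕ) (_ : Fin m → Unit) : k := if m = 1 then 1 else 0

theorem unitMoment_cyclic : Cyclic (unitMoment (k := k)) := fun _ _ => rfl

open scoped Classical in
theorem kprod_unitMoment {α : Type*} [Finite α] (π : Perm α) (z : α → Unit) :
    kprod (unitMoment (k := k)) π z = if π = 1 then 1 else 0 := by
  unfold kprod orbProd
  have hc : ∀ a, cyc (unitMoment (k := k)) π z a = if π a = a then 1 else 0 := by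
    intro a
    show (if _ then _ else _) = _
    simp only [Function.minimalPeriod_eq_one_iff_isFixedPt, Function.IsFixedPt]
  split_ifs with h
  · subst h
    simp [hc]
  · have : ∃ a, π a ≠ a := by
      by_contra hcon
      push Not at hcon
      exact h (Equiv.ext hcon)
    obtain ⟨a, ha⟩ := this
    cases nonempty_fintype α
    rw [finprod_eq_prod_of_fintype]
    refine Finset.prod_eq_zero (Finset.mem_univ (Quotient.mk _ a)) ?_
    rw [(cyc_orbInv unitMoment_cyclic π z).out, hc, if_neg ha]

theorem exists_unitCumulant : ∃ κ : ∀ m : ℕ, (Fin m → Unit) → k,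
    MomentCumulant unitMoment κ ∧ Cyclic κ := by
  classical
  obtain ⟨c, hc⟩ := exists_recursive (R := k) (fun n : ℕ => n) fun n d =>
    unitMoment n (fun _ => ()) -
      ∑ᶠ π ∈ Below (finRotate n) \ {finRotate n}, kprod (fun m _ => d m) π fun _ => ()
  have hcyc : Cyclic (A := Unit) fun m _ => c m := fun _ _ => rfl
  refine ⟨fun m _ => c m, fun n hn x => ?_, hcyc⟩
  rw [sum_below_finRotate, kprod_finRotate hcyc hn, hc n]
  have : ∀ π ∈ Below (finRotate n) \ {finRotate n},
      kprod (A := Unit) (fun m _ => if m < n then c m else 0) π (fun _ => ()) =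
        kprod (fun m _ => c m) π x := by
    rintro π ⟨hπ, hne⟩
    refine kprod_congr (fun a _ => ?_) _
    rw [if_pos (minimalPeriod_lt (numOrbits_ne_one_of_below hn hπ hne) a)]
  rw [finsum_mem_congr rfl this]
  simp [unitMoment]

variable {α β : Type} {σ₀ : Perm α} {τ₀ : Perm β}

theorem geo_conj_inv {e : Perm β} {τ τ' : Perm β} :
    Geo (e.permCongr τ⁻¹) (e.permCongr τ'⁻¹) ↔ Geo τ τ' := by
  rw [geo_permCongr]
  unfold Geo
  rw [numOrbits_inv, numOrbits_inv, inv_inv, ← numOrbits_inv (τ * τ'⁻¹), mul_inv_rev, inv_inv,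
    numOrbits_mul_comm]

open scoped Classical in
/-- Reversing the second factor of a permutation of a disjoint union. -/
noncomputable def flipRight (e : Perm β) (ρ : Perm (α ⊕ β)) : Perm (α ⊕ β) :=
  if h : ∃ σ τ, ρ = sumCongr σ τ then sumCongr h.choose (e.permCongr h.choose_spec.choose⁻¹) else ρ

theorem flipRight_sumCongr (e : Perm β) (σ : Perm α) (τ : Perm β) :
    flipRight e (sumCongr σ τ) = sumCongr σ (e.permCongr τ⁻¹) := by
  have h : ∃ σ' τ', sumCongr σ τ = sumCongr σ' τ' := ⟨σ, τ, rfl⟩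
  unfold flipRight
  rw [dif_pos h]
  obtain ⟨h1, h2⟩ := sumCongr_inj.1 h.choose_spec.choose_spec
  exact sumCongr_inj.2 ⟨h1.symm, by rw [← h2]⟩

variable [Finite α] [Finite β] {e : Perm β}

theorem flip_mem (hτe : e.permCongr τ₀⁻¹ = τ₀)
    {ρ : Perm (α ⊕ β)} (h : ρ ∈ Below (sumCongr σ₀ τ₀)) :
    flipRight e ρ ∈ Below (sumCongr σ₀ τ₀) := by
  obtain ⟨σ, τ, rfl⟩ := Geo.exists_sumCongr h
  rw [flipRight_sumCongr]
  obtain ⟨h1, h2⟩ := (geo_sumCongr _ _ _ _).1 h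
  refine (geo_sumCongr _ _ _ _).2 ⟨h1, ?_⟩
  rw [← hτe]
  exact geo_conj_inv.2 h2

theorem flip_flip (he : e * e = 1)
    {ρ : Perm (α ⊕ β)} (h : ρ ∈ Below (sumCongr σ₀ τ₀)) :
    flipRight e (flipRight e ρ) = ρ := by
  obtain ⟨σ, τ, rfl⟩ := Geo.exists_sumCongr h
  rw [flipRight_sumCongr, flipRight_sumCongr, sumCongr_inj]
  refine ⟨rfl, ?_⟩
  have he' : e⁻¹ = e := inv_eq_of_mul_eq_one_left he
  have hp : ∀ t : Perm β, e.permCongr t = e * t * e⁻¹ := fun t => rfl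
  rw [hp, hp, he', mul_inv_rev, mul_inv_rev, he', inv_inv, ← mul_assoc, ← mul_assoc, he, one_mul,
    mul_assoc, he, mul_one]

theorem geo_flip_iff {π ρ : Perm (α ⊕ β)} (hπ : π ∈ Below (sumCongr σ₀ τ₀))
    (hρ : ρ ∈ Below (sumCongr σ₀ τ₀)) : Geo (flipRight e π) (flipRight e ρ) ↔ Geo π ρ := by
  obtain ⟨σ, τ, rfl⟩ := Geo.exists_sumCongr hπ
  obtain ⟨σ', τ', rfl⟩ := Geo.exists_sumCongr hρ
  rw [flipRight_sumCongr, flipRight_sumCongr, geo_sumCongr, geo_sumCongr, geo_conj_inv]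

theorem sum_flip (he : e * e = 1) (hτe : e.permCongr τ₀⁻¹ = τ₀)
    {M : Type*} [AddCommMonoid M] {π : Perm (α ⊕ β)}
    (hπ : π ∈ Below (sumCongr σ₀ τ₀)) (F : Perm (α ⊕ β) → M) :
    ∑ᶠ ρ ∈ {ρ | ρ ∈ Below (sumCongr σ₀ τ₀) ∧ Geo π ρ}, F (flipRight e ρ) =
      ∑ᶠ ρ ∈ {ρ | ρ ∈ Below (sumCongr σ₀ τ₀) ∧ Geo (flipRight e π) ρ}, F ρ := by
  refine finsum_mem_eq_of_bijOn (flipRight e) ⟨?_, ?_, ?_⟩ fun _ _ => rfl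
  · rintro ρ ⟨hρ, h⟩
    exact ⟨flip_mem hτe hρ, (geo_flip_iff hπ hρ).2 h⟩
  · rintro ρ ⟨hρ, _⟩ ρ' ⟨hρ', _⟩ h
    rw [← flip_flip he hρ, h, flip_flip he hρ']
  · rintro ρ ⟨hρ, h⟩
    refine ⟨flipRight e ρ, ⟨flip_mem hτe hρ, ?_⟩, flip_flip he hρ⟩
    rw [← flip_flip he hπ]
    exact (geo_flip_iff (flip_mem hτe hπ) hρ).2 h

theorem flip_eq_top_iff (he : e * e = 1) (hτe : e.permCongr τ₀⁻¹ = τ₀)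
    {π : Perm (α ⊕ β)} (hπ : π ∈ Below (sumCongr σ₀ τ₀)) :
    flipRight e π = sumCongr σ₀ τ₀ ↔ π = sumCongr σ₀ τ₀ := by
  have hT : flipRight e (sumCongr σ₀ τ₀) = sumCongr σ₀ τ₀ := by rw [flipRight_sumCongr, hτe]
  constructor
  · intro h
    rw [← flip_flip he hπ, h, hT]
  · rintro rfl
    exact hT

variable {u v : Perm (α ⊕ β) → k}

theorem MobiusPair.hat_flip (he : e * e = 1) (hτe : e.permCongr τ₀⁻¹ = τ₀)
    (H : MobiusPair σ₀ τ₀ u v) {π : Perm (α ⊕ β)}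
    (hπ : π ∈ Below (sumCongr σ₀ τ₀)) : v (flipRight e π) = v π := by
  classical
  refine eq_of_sum_above (d := fun ρ => v (flipRight e ρ)) (fun π hπ => ?_) π hπ
  rw [sum_flip he hτe hπ, H.hat _ hπ, H.hat _ (flip_mem hτe hπ)]
  exact if_congr (flip_eq_top_iff he hτe hπ) rfl rfl

variable [NoZeroDivisors k]

theorem sum_below_unitCumulant {γ : Type*} [Finite γ] {κ : ∀ m : ℕ, (Fin m → Unit) → k}
    (hm : MomentCumulant unitMoment κ) (hκ : Cyclic κ) {π : Perm γ} (h : π ≠ 1) :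
    ∑ᶠ ρ ∈ Below π, kprod κ ρ (fun _ => ()) = 0 := by
  classical
  rw [← kprod_eq_sum_below unitMoment_cyclic hκ hm, kprod_unitMoment, if_neg h]

theorem sum_complement {γ M : Type*} [Finite γ] [AddCommMonoid M] {T π : Perm γ}
    (hπ : Geo π T) (F : Perm γ → M) :
    ∑ᶠ ρ ∈ {ρ | ρ ∈ Below T ∧ Geo π ρ}, F (ρ⁻¹ * T) = ∑ᶠ ρ ∈ Below (π⁻¹ * T), F ρ := by
  refine finsum_mem_eq_of_bijOn (fun ρ => ρ⁻¹ * T) ⟨?_, ?_, ?_⟩ fun _ _ => rfl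
  · rintro ρ ⟨hρ, h⟩
    exact (geo_complement_iff hπ hρ).2 h
  · rintro ρ ⟨hρ, _⟩ ρ' ⟨hρ', _⟩ h
    exact (complement_bijOn_below T).injOn hρ hρ' h
  · intro ρ hρ
    obtain ⟨ρ', h, rfl⟩ := (complement_bijOn_below T).surjOn (Geo.trans hρ (geo_complement hπ))
    exact ⟨ρ', ⟨h, (geo_complement_iff hπ h).1 hρ⟩, rfl⟩

theorem MobiusPair.hat_eq (H : MobiusPair σ₀ τ₀ u v) {κ : ∀ m : ℕ, (Fin m → Unit) → k}
    (hm : MomentCumulant unitMoment κ) (hκ : Cyclic κ) {π : Perm (α ⊕ β)}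
    (hπ : π ∈ Below (sumCongr σ₀ τ₀)) :
    v π = kprod κ (π⁻¹ * sumCongr σ₀ τ₀) (fun _ => ()) := by
  classical
  refine eq_of_sum_above (d' := fun ρ => kprod κ (ρ⁻¹ * sumCongr σ₀ τ₀) (fun _ => ()))
    (fun π hπ => ?_) π hπ
  rw [H.hat π hπ, sum_complement hπ fun ρ => kprod κ ρ (fun _ => ()),
    ← kprod_eq_sum_below unitMoment_cyclic hκ hm, kprod_unitMoment]
  simp only [inv_mul_eq_one]

theorem sum_complement_annOn (hσ : numOrbits σ₀ = 1) (hτ : numOrbits τ₀ = 1)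
    {M : Type*} [AddCommMonoid M] {π : Perm (α ⊕ β)}
    (hπ : π ∈ Below (sumCongr σ₀ τ₀)) (F : Perm (α ⊕ β) → M) :
    ∑ᶠ ρ ∈ {ρ | ρ ∈ AnnOn (sumCongr σ₀ τ₀) ∧ Geo π ρ}, F (ρ⁻¹ * sumCongr σ₀ τ₀) =
      ∑ᶠ ρ ∈ AnnOn (π⁻¹ * sumCongr σ₀ τ₀), F ρ := by
  have hK := complement_bijOn_annOn hσ hτ
  refine finsum_mem_eq_of_bijOn (fun ρ => ρ⁻¹ * sumCongr σ₀ τ₀) ⟨?_, ?_, ?_⟩ fun _ _ => rfl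
  · rintro ρ ⟨hρ, h⟩
    exact (complement_mem_annOn_complement_iff hσ hτ hπ hρ).2 h
  · rintro ρ ⟨hρ, _⟩ ρ' ⟨hρ', _⟩ h
    exact hK.injOn hρ hρ' h
  · intro ρ hρ
    obtain ⟨ρ', h, rfl⟩ := hK.surjOn (annOn_subset (geo_complement hπ) hρ)
    exact ⟨ρ', ⟨h, (complement_mem_annOn_complement_iff hσ hτ hπ h).1 hρ⟩, rfl⟩

theorem MobiusPair.ann_eq (hσ : numOrbits σ₀ = 1) (hτ : numOrbits τ₀ = 1)
    (H : MobiusPair σ₀ τ₀ u v) {κ : ∀ m : ℕ, (Fin m → Unit) → k}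
    (hm : MomentCumulant unitMoment κ) (hκ : Cyclic κ) {π : Perm (α ⊕ β)}
    (hπ : π ∈ AnnOn (sumCongr σ₀ τ₀)) :
    u π = kprod κ (π⁻¹ * sumCongr σ₀ τ₀) (fun _ => ()) := by
  set T := sumCongr σ₀ τ₀ with hT
  have hK := complement_bijOn_annOn hσ hτ
  refine eq_of_sum_above (d' := fun ρ => kprod κ (ρ⁻¹ * T) (fun _ => ())) (fun π hπ => ?_) π hπ
  have hπ' := complement_mem_annOn hσ hτ hπ
  have h1 : ∑ᶠ ρ ∈ {ρ | ρ ∈ Below T ∧ π ∈ AnnOn ρ}, v ρ =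
      ∑ᶠ ρ ∈ {ρ | ρ ∈ Below T ∧ Geo ρ (π⁻¹ * T)}, kprod κ ρ (fun _ => ()) := by
    refine finsum_mem_eq_of_bijOn (fun ρ => ρ⁻¹ * T) ⟨?_, ?_, ?_⟩ ?_
    · rintro ρ ⟨hρ, h⟩
      exact ⟨geo_complement hρ, (geo_complement_iff_mem_annOn hσ hτ hπ hρ).2 h⟩
    · rintro ρ ⟨hρ, _⟩ ρ' ⟨hρ', _⟩ h
      exact (complement_bijOn_below T).injOn hρ hρ' h
    · rintro ρ ⟨hρ, h⟩
      obtain ⟨ρ', h', rfl⟩ := (complement_bijOn_below T).surjOn hρ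
      exact ⟨ρ', ⟨h', (geo_complement_iff_mem_annOn hσ hτ hπ h').1 h⟩, rfl⟩
    · rintro ρ ⟨hρ, _⟩
      exact H.hat_eq hm hκ hρ
  have h2 : ∑ᶠ ρ ∈ {ρ | ρ ∈ AnnOn T ∧ Geo π ρ}, kprod κ (ρ⁻¹ * T) (fun _ => ()) =
      ∑ᶠ ρ ∈ {ρ | ρ ∈ AnnOn T ∧ Geo ρ (π⁻¹ * T)}, kprod κ ρ (fun _ => ()) := by
    refine finsum_mem_eq_of_bijOn (fun ρ => ρ⁻¹ * T) ⟨?_, ?_, ?_⟩ fun _ _ => rfl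
    · rintro ρ ⟨hρ, h⟩
      exact ⟨hK.mapsTo hρ, (geo_complement_iff_annOn hσ hτ hπ hρ).2 h⟩
    · rintro ρ ⟨hρ, _⟩ ρ' ⟨hρ', _⟩ h
      exact hK.injOn hρ hρ' h
    · rintro ρ ⟨hρ, h⟩
      obtain ⟨ρ', h', rfl⟩ := hK.surjOn hρ
      exact ⟨ρ', ⟨h', (geo_complement_iff_annOn hσ hτ hπ h').1 h⟩, rfl⟩
  have h3 := H.ann π hπ
  rw [h1] at h3
  rw [h2, eq_neg_of_add_eq_zero_left h3, neg_eq_iff_add_eq_zero, add_comm,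
    ← finsum_mem_union _ (Set.toFinite _) (Set.toFinite _),
    ← sum_below_unitCumulant hm hκ (Cross.ne_one hπ'.1)]
  · refine finsum_mem_congr ?_ fun _ _ => rfl
    ext ρ
    constructor
    · rintro (⟨-, h⟩ | ⟨-, h⟩) <;> exact h
    · intro h
      exact (below_annOn hσ hτ hπ' h).symm.imp (fun h' => ⟨h', h⟩) (fun h' => ⟨h', h⟩)
  · rw [Set.disjoint_left]
    rintro ρ ⟨h, -⟩ ⟨h', -⟩
    exact Geo.not_cross h' h.1

theorem MobiusPair.disc_flip (he : e * e = 1) (hτe : e.permCongr τ₀⁻¹ = τ₀) (hσ : numOrbits σ₀ = 1) (hτ : numOrbits τ₀ = 1)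
    (H : MobiusPair σ₀ τ₀ u v) {π : Perm (α ⊕ β)}
    (hπ : π ∈ Below (sumCongr σ₀ τ₀)) : u (flipRight e π) = u π := by
  obtain ⟨κ, hm, hκ⟩ := exists_unitCumulant (k := k)
  have hB : ∀ π ∈ Below (sumCongr σ₀ τ₀),
      ∑ᶠ ρ ∈ {ρ | ρ ∈ AnnOn (sumCongr σ₀ τ₀) ∧ Geo π ρ}, u ρ =
        ∑ᶠ ρ ∈ AnnOn (π⁻¹ * sumCongr σ₀ τ₀), kprod κ ρ (fun _ => ()) := by
    intro π hπ
    rw [← sum_complement_annOn hσ hτ hπ]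
    exact finsum_mem_congr rfl fun ρ hρ => H.ann_eq hσ hτ hm hκ hρ.1
  have hBflip : ∀ π ∈ Below (sumCongr σ₀ τ₀),
      ∑ᶠ ρ ∈ {ρ | ρ ∈ AnnOn (sumCongr σ₀ τ₀) ∧ Geo (flipRight e π) ρ}, u ρ =
        ∑ᶠ ρ ∈ {ρ | ρ ∈ AnnOn (sumCongr σ₀ τ₀) ∧ Geo π ρ}, u ρ := by
    intro π hπ
    rw [hB π hπ, hB _ (flip_mem hτe hπ)]
    obtain ⟨σ, τ, rfl⟩ := Geo.exists_sumCongr hπ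
    have hq : (e.permCongr τ⁻¹)⁻¹ * τ₀ = e.permCongr (τ₀.permCongr (τ⁻¹ * τ₀))⁻¹ := by
      have hp : ∀ s t : Perm β, s.permCongr t = s * t * s⁻¹ := fun s t => rfl
      conv_lhs => rw [← hτe]
      simp only [hp]
      group
    have hg := annSum_biCyclic hκ
    rw [flipRight_sumCongr, sumCongr_inv_mul, sumCongr_inv_mul, hq,
      sum_annOn_kprod unitMoment_cyclic hκ hm, sum_annOn_kprod unitMoment_cyclic hκ hm,
      markSum₂_permCongr_right unitMoment_cyclic hg]
    exact (markSum₂_inv unitMoment_cyclic hg (T := id) (fun _ _ => rfl) _ _ _ _).trans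
      (markSum₂_permCongr_right unitMoment_cyclic hg _ _ _ _ _)
  classical
  refine eq_of_sum_above (d := fun ρ => u (flipRight e ρ)) (fun π hπ => ?_) π hπ
  have h1 := H.disc π hπ
  have h2 := H.disc _ (flip_mem hτe hπ)
  rw [hBflip π hπ] at h2
  rw [if_congr (flip_eq_top_iff he hτe hπ) rfl rfl] at h2
  rw [sum_flip he hτe hπ]
  exact add_right_cancel (add_right_cancel (h2.trans h1.symm))

end Recursion

end AnnNC

namespace AnnNC

section SecondOrder

open Equiv (Perm)
open Equiv.Perm

variable {A k : Type*} [CommRing k]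

theorem markSum₂_congr {α β : Type*} {κ : ∀ m : ℕ, (Fin m → A) → k}
    {g g' : ∀ r s : ℕ, (Fin r → A) → (Fin s → A) → k} {σ : Perm α} {τ : Perm β}
    (h : ∀ a b u v, g (Function.minimalPeriod σ a) (Function.minimalPeriod τ b) u v =
      g' (Function.minimalPeriod σ a) (Function.minimalPeriod τ b) u v) (x : α → A) (y : β → A) :
    markSum₂ κ g σ τ x y = markSum₂ κ g' σ τ x y := by
  unfold markSum₂ cyc₂
  simp only [h]

theorem markSum_add {γ : Type*} [Finite γ] (π : Perm γ) (w a b : γ → k) :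
    markSum π w (fun c => a c + b c) = markSum π w a + markSum π w b := by
  unfold markSum
  simp only [mul_add]
  exact finsum_add_distrib (Set.toFinite _) (Set.toFinite _)

theorem markSum₂_add {α β : Type*} [Finite α] [Finite β] (κ : ∀ m : ℕ, (Fin m → A) → k)
    (g g' : ∀ r s : ℕ, (Fin r → A) → (Fin s → A) → k) (σ : Perm α) (τ : Perm β)
    (x : α → A) (y : β → A) :
    markSum₂ κ (fun r s u v => g r s u v + g' r s u v) σ τ x y =
      markSum₂ κ g σ τ x y + markSum₂ κ g' σ τ x y := by
  show markSum σ _ (fun a => markSum τ _ fun b => cyc₂ g σ τ x y a b + cyc₂ g' σ τ x y a b) = _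
  simp only [markSum_add]
  rfl

theorem markSum₂_finRotate {κ : ∀ m : ℕ, (Fin m → A) → k}
    {g : ∀ r s : ℕ, (Fin r → A) → (Fin s → A) → k} (hg : BiCyclic g) {r s : ℕ} (hr : 0 < r)
    (hs : 0 < s) (x : Fin r → A) (y : Fin s → A) :
    markSum₂ κ g (finRotate r) (finRotate s) x y = g r s x y := by
  unfold markSum₂
  rw [markSum_finRotate hr (orbInv_markSum_cyc₂ hg _ _ _ _ _),
    markSum_finRotate hs (orbInv_cyc₂_right hg _ _ _ _ _), cyc₂_eq_left, cyc_finRotate]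
  exact cyc_finRotate (fun s v => g r s x v) hs y

theorem markedMoment₂_biCyclic {κ : ∀ m : ℕ, (Fin m → A) → k} (hκ : Cyclic κ)
    {g : ∀ r s : ℕ, (Fin r → A) → (Fin s → A) → k} (hg : BiCyclic g) :
    BiCyclic (markedMoment₂ κ g) := by
  constructor
  · intro s y r x
    unfold markedMoment₂
    dsimp only
    conv_rhs => rw [← permCongr_self (finRotate r) (finRotate r) rfl, sum_below_permCongr]
    exact finsum_mem_congr rfl fun ρ _ => finsum_mem_congr rfl fun ρ' _ =>
      (markSum₂_permCongr_left hκ hg _ _ _ _ _).symm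
  · intro r x s y
    unfold markedMoment₂
    dsimp only
    conv_rhs => rw [← permCongr_self (finRotate s) (finRotate s) rfl]
    refine finsum_mem_congr rfl fun ρ _ => ?_
    rw [sum_below_permCongr]
    exact finsum_mem_congr rfl fun ρ' _ => (markSum₂_permCongr_right hκ hg _ _ _ _ _).symm

open scoped Classical in
/-- The restriction of a two-variable family of functionals to total arity below `N`. -/
noncomputable def truncate (g : ∀ r s : ℕ, (Fin r → A) → (Fin s → A) → k) (N : ℕ) :
    ∀ r s : ℕ, (Fin r → A) → (Fin s → A) → k :=
  fun r s x y => if r + s < N then g r s x y else 0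

theorem markedMoment₂_eq_add_truncate {κ : ∀ m : ℕ, (Fin m → A) → k}
    {g : ∀ r s : ℕ, (Fin r → A) → (Fin s → A) → k} (hg : BiCyclic g) {r s : ℕ} (hr : 0 < r)
    (hs : 0 < s) (x : Fin r → A) (y : Fin s → A) :
    markedMoment₂ κ g r s x y = g r s x y + markedMoment₂ κ (truncate g (r + s)) r s x y := by
  have h1 : ∀ (ρ : Perm (Fin r)) (ρ' : Perm (Fin s)), ρ ∈ Below (finRotate r) →
      ρ' ∈ Below (finRotate s) → ¬ (ρ = finRotate r ∧ ρ' = finRotate s) →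
      markSum₂ κ g ρ ρ' x y = markSum₂ κ (truncate g (r + s)) ρ ρ' x y := by
    intro ρ ρ' hρ hρ' hne
    refine markSum₂_congr (fun a b u v => ?_) x y
    have ha : Function.minimalPeriod ρ a ≤ r := by
      simpa using Function.minimalPeriod_le_card (f := ρ) (x := a)
    have hb : Function.minimalPeriod ρ' b ≤ s := by
      simpa using Function.minimalPeriod_le_card (f := ρ') (x := b)
    have : Function.minimalPeriod ρ a + Function.minimalPeriod ρ' b < r + s := by
      by_cases h : ρ = finRotate r
      · have := minimalPeriod_lt (numOrbits_ne_one_of_below hs hρ' fun h' => hne ⟨h, h'⟩) b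
        omega
      · have := minimalPeriod_lt (numOrbits_ne_one_of_below hr hρ h) a
        omega
    exact (if_pos this).symm
  have h2 : BiCyclic (truncate g (r + s)) := by
    refine ⟨fun s' y' r' x' => ?_, fun r' x' s' y' => ?_⟩
    · exact congrArg (fun t => if r' + s' < r + s then t else 0) (hg.1 s' y' r' x')
    · exact congrArg (fun t => if r' + s' < r + s then t else 0) (hg.2 r' x' s' y')
  unfold markedMoment₂
  rw [sum_below_finRotate, sum_below_finRotate, sum_below_finRotate,
    sum_below_finRotate (fun ρ' => markSum₂ κ (truncate g (r + s)) (finRotate r) ρ' x y),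
    markSum₂_finRotate hg hr hs, markSum₂_finRotate h2 hr hs, add_assoc, add_assoc]
  have h3 : truncate g (r + s) r s x y = 0 := if_neg (lt_irrefl _)
  rw [h3, zero_add]
  congr 1
  congr 1
  · exact finsum_mem_congr rfl fun ρ' hρ' => h1 _ _ (geo_self _) hρ'.1 fun h => hρ'.2 h.2
  · exact finsum_mem_congr rfl fun ρ hρ => finsum_mem_congr rfl fun ρ' hρ' =>
      h1 _ _ hρ.1 hρ' fun h => hρ.2 h.1

theorem exists_markedMoment₂_eq {κ : ∀ m : ℕ, (Fin m → A) → k} (hκ : Cyclic κ)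
    {ψ : ∀ r s : ℕ, (Fin r → A) → (Fin s → A) → k} (hψ : BiCyclic ψ) :
    ∃ g : ∀ r s : ℕ, (Fin r → A) → (Fin s → A) → k, BiCyclic g ∧
      ∀ r s, 0 < r → 0 < s → ∀ x y, markedMoment₂ κ g r s x y = ψ r s x y := by
  classical
  obtain ⟨c, hc⟩ := exists_recursive (R := k)
    (ι := Σ r : ℕ, Σ s : ℕ, (Fin r → A) × (Fin s → A)) (fun i => i.1 + i.2.1)
    fun i d => ψ i.1 i.2.1 i.2.2.1 i.2.2.2 -
      markedMoment₂ κ (fun r s x y => d ⟨r, s, x, y⟩) i.1 i.2.1 i.2.2.1 i.2.2.2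
  let g : ∀ r s : ℕ, (Fin r → A) → (Fin s → A) → k := fun r s x y => c ⟨r, s, x, y⟩
  have hrec : ∀ r s x y, g r s x y =
      ψ r s x y - markedMoment₂ κ (truncate g (r + s)) r s x y := fun r s x y => hc ⟨r, s, x, y⟩
  have key : ∀ N, BiCyclic (truncate g N) := by
    intro N
    induction N with
    | zero => exact ⟨fun s y r x => rfl, fun r x s y => rfl⟩
    | succ N ih =>
      have hm := markedMoment₂_biCyclic hκ ih
      refine ⟨fun s y r x => ?_, fun r x s y => ?_⟩
      · rcases lt_trichotomy (r + s) N with h | h | h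
        · have := ih.1 s y r x
          simp only [truncate, if_pos h] at this
          simpa only [truncate, if_pos (Nat.lt_succ_of_lt h)] using this
        · subst h
          simp only [truncate, if_pos (Nat.lt_succ_self _)]
          rw [hrec, hrec]
          exact congrArg₂ _ (hψ.1 s y r x) (hm.1 s y r x)
        · simp only [truncate, if_neg (show ¬ r + s < N + 1 by omega)]
      · rcases lt_trichotomy (r + s) N with h | h | h
        · have := ih.2 r x s y
          simp only [truncate, if_pos h] at this
          simpa only [truncate, if_pos (Nat.lt_succ_of_lt h)] using this
        · subst h
          simp only [truncate, if_pos (Nat.lt_succ_self _)]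
          rw [hrec, hrec]
          exact congrArg₂ _ (hψ.2 r x s y) (hm.2 r x s y)
        · simp only [truncate, if_neg (show ¬ r + s < N + 1 by omega)]
  have hg : BiCyclic g := by
    refine ⟨fun s y r x => ?_, fun r x s y => ?_⟩
    · have := (key (r + s + 1)).1 s y r x
      simpa only [truncate, if_pos (Nat.lt_succ_self _)] using this
    · have := (key (r + s + 1)).2 r x s y
      simpa only [truncate, if_pos (Nat.lt_succ_self _)] using this
  refine ⟨g, hg, fun r s hr hs x y => ?_⟩
  rw [markedMoment₂_eq_add_truncate hg hr hs, hrec]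
  exact sub_add_cancel _ _

variable {f κ : ∀ m : ℕ, (Fin m → A) → k} {T : A → A}

theorem kprod_inv {β : Type*} [Finite β] (hf : Cyclic f) (hT : ∀ m v, f m (T ∘ v ∘ Fin.rev) = f m v)
    (τ : Perm β) (y : β → A) : kprod f τ⁻¹ (T ∘ y) = kprod f τ y := by
  unfold kprod orbProd
  rw [orbitSetoid_inv]
  refine finprod_congr fun c => ?_
  rw [cyc_inv hf]
  simp only [hT]

theorem sum_below_flip {α β : Type} [Finite α] [Finite β] {σ₀ : Perm α} {τ₀ e : Perm β}
    (he : e * e = 1) (hτe : e.permCongr τ₀⁻¹ = τ₀) {M : Type*} [AddCommMonoid M]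
    (F : Perm (α ⊕ β) → M) :
    ∑ᶠ ρ ∈ Below (sumCongr σ₀ τ₀), F (flipRight e ρ) = ∑ᶠ ρ ∈ Below (sumCongr σ₀ τ₀), F ρ := by
  refine finsum_mem_eq_of_bijOn (flipRight e) ⟨fun ρ hρ => flip_mem hτe hρ, ?_, ?_⟩ fun _ _ => rfl
  · intro ρ hρ ρ' hρ' h
    rw [← flip_flip he hρ, h, flip_flip he hρ']
  · intro ρ hρ
    exact ⟨flipRight e ρ, flip_mem hτe hρ, flip_flip he hρ⟩

theorem revPerm_permCongr_finRotate_inv (n : ℕ) :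
    (Fin.revPerm (n := n)).permCongr (finRotate n)⁻¹ = finRotate n := by
  rcases n with _ | n
  · ext i; exact i.elim0
  ext i
  rw [Equiv.permCongr_apply]
  have h : (finRotate (n + 1))⁻¹ (Fin.rev i) = Fin.rev (finRotate (n + 1) i) := by
    rw [Equiv.Perm.inv_eq_iff_eq, finRotate_apply, finRotate_apply]
    rcases Fin.lastCases (motive := fun i => i = Fin.last n ∨ ∃ j : Fin n, i = j.castSucc)
      (Or.inl rfl) (fun j => Or.inr ⟨j, rfl⟩) i with rfl | ⟨j, rfl⟩
    · simp
    · rw [Fin.coeSucc_eq_succ, Fin.rev_castSucc, Fin.rev_succ, Fin.coeSucc_eq_succ]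
  show ((Fin.rev ((finRotate (n + 1))⁻¹ (Fin.rev i)) : Fin (n + 1)) : ℕ) = _
  rw [h, Fin.rev_rev]

/-- Inversion of the second-order moment-cumulant relation by a Möbius pair. -/
theorem MobiusPair.cumulant_eq [NoZeroDivisors k] {p q : ℕ} (hp : 0 < p) (hq : 0 < q)
    {u v : Perm (Fin p ⊕ Fin q) → k}
    (H : MobiusPair (finRotate p) (finRotate q) u v) (hf : Cyclic f) (hκ : Cyclic κ)
    (h : MomentCumulant f κ) (hT : ∀ m v, f m (T ∘ v ∘ Fin.rev) = f m v)
    {ψ g : ∀ r s : ℕ, (Fin r → A) → (Fin s → A) → k} (hg : BiCyclic g)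
    (hrel : ∀ r s, 0 < r → 0 < s → ∀ x y, ψ r s x y =
      annSum κ r s x y + annSum κ r s x (T ∘ y ∘ Fin.rev) + markedMoment₂ κ g r s x y)
    (x : Fin p → A) (y : Fin q → A) {V : Perm (Fin p ⊕ Fin q) → k}
    (hV : ∀ σ τ, V (sumCongr σ τ) = markSum₂ f ψ σ τ x y) :
    g p q x y =
      2 * ∑ᶠ π ∈ Below (sumCongr (finRotate p) (finRotate q)),
        (u π + v π) * kprod f π (Sum.elim x y) +
      ∑ᶠ π ∈ AnnOn (sumCongr (finRotate p) (finRotate q)), u π * kprod f π (Sum.elim x y) +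
      ∑ᶠ π ∈ AnnOn (sumCongr (finRotate p) (finRotate q)),
        u π * kprod f π (Sum.elim x (T ∘ y ∘ Fin.rev)) +
      ∑ᶠ π ∈ Below (sumCongr (finRotate p) (finRotate q)), v π * V π := by
  have hσ := numOrbits_finRotate hp
  have hτ := numOrbits_finRotate hq
  have he : (Fin.revPerm : Perm (Fin q)) * Fin.revPerm = 1 := by
    ext i
    simp
  have hτe := revPerm_permCongr_finRotate_inv q
  have hann := annSum_biCyclic hκ
  set D := Below (sumCongr (finRotate p) (finRotate q)) with hD
  set w := Sum.elim x (T ∘ y ∘ Fin.rev) with hw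
  set z := Sum.elim x y with hz
  classical
  let G : Perm (Fin p ⊕ Fin q) → k := fun ρ =>
    if hρ : ∃ σ τ, ρ = sumCongr σ τ then markSum₂ κ g hρ.choose hρ.choose_spec.choose x y else 0
  have hG : ∀ σ τ, G (sumCongr σ τ) = markSum₂ κ g σ τ x y := by
    intro σ τ
    have h0 : ∃ σ' τ', sumCongr σ τ = sumCongr σ' τ' := ⟨σ, τ, rfl⟩
    obtain ⟨h1, h2⟩ := sumCongr_inj.1 h0.choose_spec.choose_spec
    show (if hρ : _ then _ else _) = _
    rw [dif_pos h0]
    exact congrArg₂ (fun a b => markSum₂ κ g a b x y) h1.symm h2.symm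
  have hflipw : ∀ π ∈ D, kprod f (flipRight Fin.revPerm π) w = kprod f π z := by
    intro π hπ
    obtain ⟨σ, τ, rfl⟩ := Geo.exists_sumCongr hπ
    rw [flipRight_sumCongr, kprod_sumCongr hf, kprod_sumCongr hf, kprod_permCongr hf]
    congr 1
    refine Eq.trans ?_ (kprod_inv hf hT τ y)
    congr 1
    funext i
    simp [hw]
  have hVeq : ∀ π ∈ D, V π = ∑ᶠ ρ ∈ AnnOn π, kprod κ ρ z +
      ∑ᶠ ρ ∈ AnnOn (flipRight Fin.revPerm π), kprod κ ρ w + ∑ᶠ ρ ∈ Below π, G ρ := by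
    intro π hπ
    obtain ⟨σ, τ, rfl⟩ := Geo.exists_sumCongr hπ
    rw [hV, markSum₂_congr (g' := fun r s u v => annSum κ r s u v +
        annSum κ r s u (T ∘ v ∘ Fin.rev) + markedMoment₂ κ g r s u v)
      (fun a b u v => hrel _ _ (minimalPeriod_perm_pos σ a) (minimalPeriod_perm_pos τ b) u v),
      markSum₂_add f (fun r s u v => annSum κ r s u v + annSum κ r s u (T ∘ v ∘ Fin.rev))
        (markedMoment₂ κ g),
      markSum₂_add f (annSum κ) fun r s u v => annSum κ r s u (T ∘ v ∘ Fin.rev), ← sum_markSum₂_below hf hκ hg h,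
      flipRight_sumCongr, sum_annOn_kprod hf hκ h, sum_annOn_kprod hf hκ h,
      markSum₂_permCongr_right hf hann, sum_below_sumCongr]
    congr 1
    · congr 1
      rw [← markSum₂_inv hf hann hT]
      congr 1
      funext i
      simp [hw]
    · simp only [hG]
  have Z1 := H.sum_disc_add_ann hσ hτ fun ρ => kprod κ ρ z
  have Z2 := H.sum_disc_add_ann hσ hτ fun ρ => kprod κ ρ w
  have Y := H.sum_hat G
  simp only [← kprod_eq_sum_below hf hκ h] at Z1 Z2
  rw [hG, markSum₂_finRotate hg hp hq] at Y
  have e1 : ∑ᶠ π ∈ D, u π * kprod f π w = ∑ᶠ π ∈ D, u π * kprod f π z := by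
    rw [hD, ← sum_below_flip he hτe]
    exact finsum_mem_congr rfl fun π hπ => by rw [H.disc_flip he hτe hσ hτ hπ, hflipw π hπ]
  have e2 : ∑ᶠ π ∈ D, v π * (kprod f π w + ∑ᶠ ρ ∈ AnnOn π, kprod κ ρ w) =
      ∑ᶠ π ∈ D, v π * (kprod f π z + ∑ᶠ ρ ∈ AnnOn (flipRight Fin.revPerm π), kprod κ ρ w) := by
    rw [hD, ← sum_below_flip he hτe]
    exact finsum_mem_congr rfl fun π hπ => by rw [H.hat_flip he hτe hπ, hflipw π hπ]
  rw [e1, e2] at Z2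
  rw [finsum_mem_congr rfl fun π hπ => congrArg (v π * ·) (hVeq π hπ)]
  simp only [mul_add, add_mul] at Z1 Z2 ⊢
  simp only [finsum_mem_add_distrib (Set.toFinite _)] at Z1 Z2 ⊢
  linear_combination -Y - Z1 - Z2

end SecondOrder

end AnnNC

namespace AnnNC

section Representatives

open Equiv (Perm)
open Equiv.Perm

variable {k : Type*} [CommRing k] {n : ℕ}

theorem minReps_bijOn (π : Perm (Fin n)) :
    Set.BijOn (Quotient.mk (orbitSetoid π)) (minReps π) Set.univ := by
  refine ⟨fun _ _ => Set.mem_univ _, ?_, ?_⟩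
  · intro a ha b hb hab
    have h : π.SameCycle a b := Quotient.exact hab
    exact le_antisymm (ha b h) (hb a h.symm)
  · intro c _
    induction c using Quotient.inductionOn with
    | h x =>
      obtain ⟨a, ha, hmin⟩ := Set.exists_min_image {y | π.SameCycle x y} id (Set.toFinite _)
        ⟨x, SameCycle.refl π x⟩
      exact ⟨a, fun b hb => hmin b (SameCycle.trans ha hb), Quotient.sound (SameCycle.symm ha)⟩

theorem finprod_mem_minReps {π : Perm (Fin n)} {w : Fin n → k} (hw : OrbInv π w) :
    ∏ᶠ a ∈ minReps π, w a = orbProd π w := by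
  unfold orbProd
  refine Eq.trans ?_ (finprod_mem_univ _)
  exact finprod_mem_eq_of_bijOn (g := fun c : Quotient (orbitSetoid π) => w c.out) _
    (minReps_bijOn π) fun a _ => (hw.out a).symm

theorem finprod_mem_minReps_diff {π : Perm (Fin n)} {w : Fin n → k} (hw : OrbInv π w)
    {a : Fin n} (ha : a ∈ minReps π) :
    ∏ᶠ c ∈ minReps π \ {a}, w c = orbRest π w (Quotient.mk _ a) := by
  classical
  unfold orbRest
  have h : ∏ᶠ c ∈ minReps π \ {a}, w c = ∏ᶠ c ∈ minReps π, if c = a then 1 else w c := by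
    rw [← finprod_mem_inter_mulSupport (fun c => if c = a then 1 else w c),
      ← finprod_mem_inter_mulSupport w]
    have hs : minReps π ∩ Function.mulSupport (fun c => if c = a then 1 else w c) =
        minReps π \ {a} ∩ Function.mulSupport w := by
      ext c
      by_cases hc : c = a <;> simp [hc]
    rw [hs]
    exact finprod_mem_congr rfl fun c hc => (if_neg hc.1.2).symm
  refine h.trans (Eq.trans ?_ (finprod_mem_univ _))
  refine finprod_mem_eq_of_bijOn (g := fun c : Quotient (orbitSetoid π) =>
    if c = Quotient.mk _ a then 1 else w c.out) _ (minReps_bijOn π) fun c hc => ?_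
  by_cases hca : c = a
  · rw [if_pos hca, if_pos (by rw [hca])]
  · rw [if_neg hca, if_neg fun h' => hca ((minReps_bijOn π).2.1 hc ha h')]
    exact (hw.out c).symm

theorem finsum_mem_minReps {π : Perm (Fin n)} {w g : Fin n → k} (hw : OrbInv π w)
    (hg : OrbInv π g) :
    ∑ᶠ a ∈ minReps π, (∏ᶠ c ∈ minReps π \ {a}, w c) * g a = markSum π w g := by
  unfold markSum
  refine Eq.trans ?_ (finsum_mem_univ _)
  refine finsum_mem_eq_of_bijOn (g := fun c : Quotient (orbitSetoid π) =>
    orbRest π w c * g c.out) _ (minReps_bijOn π) fun a ha => ?_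
  rw [finprod_mem_minReps_diff hw ha, hg.out]

theorem minReps_finRotate (hn : 0 < n) : minReps (finRotate n) = {⟨0, hn⟩} := by
  ext a
  constructor
  · intro ha
    exact le_antisymm (ha _ (finRotate_sameCycle _ _)) (Nat.zero_le _)
  · rintro rfl b _
    exact Nat.zero_le _

variable {A : Type*} {p q : ℕ}

/-- The sum over pairs of marked orbits, written with minimal representatives of the orbits. -/
noncomputable def repSum (κ : ∀ m : ℕ, (Fin m → A) → k)
    (g : ∀ r s : ℕ, (Fin r → A) → (Fin s → A) → k) (σ : Perm (Fin p)) (τ : Perm (Fin q))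
    (x : Fin p → A) (y : Fin q → A) : k :=
  ∑ᶠ i ∈ minReps σ, ∑ᶠ j ∈ minReps τ,
    (∏ᶠ c ∈ minReps σ \ {i}, cyc κ σ x c) * (∏ᶠ c ∈ minReps τ \ {j}, cyc κ τ y c) *
      cyc₂ g σ τ x y i j

theorem repSum_eq_markSum₂ [NoZeroDivisors k] {κ : ∀ m : ℕ, (Fin m → A) → k} (hκ : Cyclic κ)
    {g : ∀ r s : ℕ, (Fin r → A) → (Fin s → A) → k} (hg : BiCyclic g) (σ : Perm (Fin p))
    (τ : Perm (Fin q)) (x : Fin p → A) (y : Fin q → A) :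
    repSum κ g σ τ x y = markSum₂ κ g σ τ x y := by
  unfold repSum markSum₂
  rw [← finsum_mem_minReps (cyc_orbInv hκ σ x) (orbInv_markSum_cyc₂ hg _ _ _ _ _)]
  refine finsum_mem_congr rfl fun i _ => ?_
  rw [← finsum_mem_minReps (cyc_orbInv hκ τ y) (orbInv_cyc₂_right hg _ _ _ _ _), mul_finsum_mem]
  exact finsum_mem_congr rfl fun j _ => mul_assoc _ _ _

theorem repSum_congr {κ : ∀ m : ℕ, (Fin m → A) → k}
    {g g' : ∀ r s : ℕ, (Fin r → A) → (Fin s → A) → k} {σ : Perm (Fin p)} {τ : Perm (Fin q)}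
    (h : ∀ a b u v, g (Function.minimalPeriod σ a) (Function.minimalPeriod τ b) u v =
      g' (Function.minimalPeriod σ a) (Function.minimalPeriod τ b) u v)
    (x : Fin p → A) (y : Fin q → A) : repSum κ g σ τ x y = repSum κ g' σ τ x y := by
  unfold repSum cyc₂
  simp only [h]

theorem repSum_finRotate (κ : ∀ m : ℕ, (Fin m → A) → k)
    (g : ∀ r s : ℕ, (Fin r → A) → (Fin s → A) → k) (hp : 0 < p) (hq : 0 < q)
    (x : Fin p → A) (y : Fin q → A) :
    repSum κ g (finRotate p) (finRotate q) x y = g p q x y := by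
  unfold repSum
  rw [minReps_finRotate hp, minReps_finRotate hq]
  simp only [finsum_mem_singleton, sdiff_self, Set.bot_eq_empty, finprod_mem_empty, one_mul]
  rw [cyc₂_eq_left, cyc_finRotate]
  exact cyc_finRotate (fun s v => g p s x v) hq y

/-- Two families with the same marked sums agree in positive arities. -/
theorem eq_of_sum_repSum_eq {κ : ∀ m : ℕ, (Fin m → A) → k}
    {g g' : ∀ r s : ℕ, (Fin r → A) → (Fin s → A) → k}
    (h : ∀ r s, 0 < r → 0 < s → ∀ x y,
      ∑ᶠ ρ ∈ Below (finRotate r), ∑ᶠ ρ' ∈ Below (finRotate s), repSum κ g ρ ρ' x y =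
        ∑ᶠ ρ ∈ Below (finRotate r), ∑ᶠ ρ' ∈ Below (finRotate s), repSum κ g' ρ ρ' x y) :
    ∀ r s, 0 < r → 0 < s → ∀ x y, g r s x y = g' r s x y := by
  suffices H : ∀ N r s, r + s = N → 0 < r → 0 < s → ∀ x y, g r s x y = g' r s x y from
    fun r s => H _ r s rfl
  intro N
  induction N using Nat.strong_induction_on with
  | _ N ih =>
  intro r s hN hr hs x y
  have h1 : ∀ (ρ : Perm (Fin r)) (ρ' : Perm (Fin s)), ρ ∈ Below (finRotate r) →
      ρ' ∈ Below (finRotate s) → ¬ (ρ = finRotate r ∧ ρ' = finRotate s) →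
      repSum κ g ρ ρ' x y = repSum κ g' ρ ρ' x y := by
    intro ρ ρ' hρ hρ' hne
    refine repSum_congr (fun a b u v => ?_) x y
    have ha : Function.minimalPeriod ρ a ≤ r := by
      simpa using Function.minimalPeriod_le_card (f := ρ) (x := a)
    have hb : Function.minimalPeriod ρ' b ≤ s := by
      simpa using Function.minimalPeriod_le_card (f := ρ') (x := b)
    have : Function.minimalPeriod ρ a + Function.minimalPeriod ρ' b < N := by
      by_cases h : ρ = finRotate r
      · have := minimalPeriod_lt (numOrbits_ne_one_of_below hs hρ' fun h' => hne ⟨h, h'⟩) b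
        omega
      · have := minimalPeriod_lt (numOrbits_ne_one_of_below hr hρ h) a
        omega
    exact ih _ this _ _ rfl (minimalPeriod_perm_pos ρ a) (minimalPeriod_perm_pos ρ' b) u v
  have h2 := h r s hr hs x y
  rw [sum_below_finRotate, sum_below_finRotate, sum_below_finRotate,
    sum_below_finRotate (fun ρ' => repSum κ g' (finRotate r) ρ' x y),
    repSum_finRotate κ g hr hs, repSum_finRotate κ g' hr hs, add_assoc, add_assoc,
    finsum_mem_congr rfl fun ρ' hρ' => h1 _ ρ' (geo_self _) hρ'.1 fun h => hρ'.2 h.2,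
    finsum_mem_congr rfl fun ρ hρ => finsum_mem_congr rfl fun ρ' hρ' =>
      h1 ρ ρ' hρ.1 hρ' fun h => hρ.2 h.1] at h2
  exact add_right_cancel h2

end Representatives

section Conversion

open Equiv (Perm)
open Equiv.Perm

variable {A : Type*} {p q : ℕ}

theorem kappaPerm_eq_kprod {n : ℕ} {κ : ∀ m : ℕ, (Fin m → A) → ℂ} (hκ : Cyclic κ)
    (π : Perm (Fin n)) (x : Fin n → A) : kappaPerm κ π x = kprod κ π x :=
  finprod_mem_minReps (cyc_orbInv hκ π x)

theorem joinVec_comp (x : Fin p → A) (y : Fin q → A) :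
    joinVec x y ∘ finSumFinEquiv = Sum.elim x y := by
  funext i
  rcases i with i | i
  · simp [joinVec]
  · simp [joinVec]

theorem revVec_eq (T : A → A) (y : Fin q → A) : revVec T y = T ∘ y ∘ Fin.rev := by
  funext j
  simp only [revVec, Function.comp_apply]
  congr 2
  ext
  simp only [Fin.val_rev]
  omega

theorem minReps_left (σ : Perm (Fin p)) (τ : Perm (Fin q)) :
    {a | a ∈ minReps (finSumFinEquiv.permCongr (sumCongr σ τ)) ∧ (a : ℕ) < p} =
      Fin.castAdd q '' minReps σ := by
  ext a
  obtain ⟨i, rfl⟩ := finSumFinEquiv.surjective a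
  constructor
  · rintro ⟨h1, h2⟩
    rcases i with i | j
    · refine ⟨i, fun b hb => ?_, rfl⟩
      exact h1 (finSumFinEquiv (Sum.inl b))
        ((sameCycle_permCongr _ _ _ _).2 ((sameCycle_inl_inl σ τ i b).2 hb))
    · simp at h2
  · rintro ⟨i', hi', h⟩
    have h' : finSumFinEquiv (Sum.inl i') = finSumFinEquiv i := h
    obtain rfl := finSumFinEquiv.injective h'
    refine ⟨fun b hb => ?_, i'.2⟩
    obtain ⟨b, rfl⟩ := finSumFinEquiv.surjective b
    rw [sameCycle_permCongr] at hb
    rcases b with b | b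
    · exact hi' b ((sameCycle_inl_inl σ τ i' b).1 hb)
    · exact absurd hb (not_sameCycle_inl_inr σ τ i' b)

theorem minReps_right (σ : Perm (Fin p)) (τ : Perm (Fin q)) :
    {b | b ∈ minReps (finSumFinEquiv.permCongr (sumCongr σ τ)) ∧ p ≤ (b : ℕ)} =
      Fin.natAdd p '' minReps τ := by
  ext a
  obtain ⟨i, rfl⟩ := finSumFinEquiv.surjective a
  constructor
  · rintro ⟨h1, h2⟩
    rcases i with i | j
    · exact absurd i.2 (not_lt.2 h2)
    · refine ⟨j, fun b hb => ?_, rfl⟩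
      have := h1 (finSumFinEquiv (Sum.inr b))
        ((sameCycle_permCongr _ _ _ _).2 ((sameCycle_inr_inr σ τ j b).2 hb))
      exact (Fin.natAdd_le_natAdd_iff p).1 this
  · rintro ⟨i', hi', h⟩
    have h' : finSumFinEquiv (Sum.inr i') = finSumFinEquiv i := h
    obtain rfl := finSumFinEquiv.injective h'
    refine ⟨fun b hb => ?_, Nat.le_add_right _ _⟩
    obtain ⟨b, rfl⟩ := finSumFinEquiv.surjective b
    rw [sameCycle_permCongr] at hb
    rcases b with b | b
    · exact absurd hb.symm (not_sameCycle_inl_inr σ τ b i')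
    · exact (Fin.natAdd_le_natAdd_iff p).2 (hi' b ((sameCycle_inr_inr σ τ i' b).1 hb))

theorem minReps_removed (σ : Perm (Fin p)) (τ : Perm (Fin q)) (i : Fin p) (j : Fin q) :
    {c | c ∈ minReps (finSumFinEquiv.permCongr (sumCongr σ τ)) ∧ c ≠ Fin.castAdd q i ∧
        c ≠ Fin.natAdd p j} =
      Fin.castAdd q '' (minReps σ \ {i}) ∪ Fin.natAdd p '' (minReps τ \ {j}) := by
  have hc := Fin.castAdd_injective p q
  have hn := Fin.natAdd_injective q p
  have hl := minReps_left σ τ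
  have hr := minReps_right σ τ
  rw [Set.image_sdiff hc, Set.image_sdiff hn, ← hl, ← hr]
  ext c
  simp only [Set.image_singleton, Set.mem_union, Set.mem_sdiff, Set.mem_singleton_iff,
    Set.mem_ofPred_eq, ne_eq, Fin.ext_iff, Fin.val_castAdd, Fin.val_natAdd]
  have := i.2
  constructor
  · rintro ⟨h1, h2, h3⟩
    rcases lt_or_ge (c : ℕ) p with h | h
    · exact Or.inl ⟨⟨h1, h⟩, h2⟩
    · exact Or.inr ⟨⟨h1, h⟩, h3⟩
  · rintro (⟨⟨h1, h⟩, h2⟩ | ⟨⟨h1, h⟩, h2⟩)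
    · exact ⟨h1, h2, by omega⟩
    · exact ⟨h1, by omega, h2⟩

theorem castAdd_semiconj (σ : Perm (Fin p)) (τ : Perm (Fin q)) (i : Fin p) :
    Fin.castAdd q (σ i) = finSumFinEquiv.permCongr (sumCongr σ τ) (Fin.castAdd q i) := by
  simp [Equiv.permCongr_apply]

theorem natAdd_semiconj (σ : Perm (Fin p)) (τ : Perm (Fin q)) (i : Fin q) :
    Fin.natAdd p (τ i) = finSumFinEquiv.permCongr (sumCongr σ τ) (Fin.natAdd p i) := by
  simp [Equiv.permCongr_apply]

theorem joinVec_comp_castAdd (x : Fin p → A) (y : Fin q → A) :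
    joinVec x y ∘ Fin.castAdd q = x := by
  funext i
  exact congrFun (joinVec_comp x y) (Sum.inl i)

theorem joinVec_comp_natAdd (x : Fin p → A) (y : Fin q → A) :
    joinVec x y ∘ Fin.natAdd p = y := by
  funext i
  exact congrFun (joinVec_comp x y) (Sum.inr i)

theorem kappaUPi_eq (κ : ∀ m : ℕ, (Fin m → A) → ℂ)
    (g : ∀ r s : ℕ, (Fin r → A) → (Fin s → A) → ℂ) (σ : Perm (Fin p)) (τ : Perm (Fin q))
    (x : Fin p → A) (y : Fin q → A) (i : Fin p) (j : Fin q) :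
    kappaUPi κ g (finSumFinEquiv.permCongr (sumCongr σ τ)) (Fin.castAdd q i) (Fin.natAdd p j)
        (joinVec x y) =
      (∏ᶠ c ∈ minReps σ \ {i}, cyc κ σ x c) * (∏ᶠ c ∈ minReps τ \ {j}, cyc κ τ y c) *
        cyc₂ g σ τ x y i j := by
  have hc := Fin.castAdd_injective p q
  have hn := Fin.natAdd_injective q p
  unfold kappaUPi
  rw [minReps_removed, finprod_mem_union ?_ (Set.toFinite _) (Set.toFinite _),
    finprod_mem_image hc.injOn, finprod_mem_image hn.injOn]
  · congr 1
    · congr 1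
      · refine finprod_mem_congr rfl fun c _ => ?_
        exact (cyc_semiconj κ hc (castAdd_semiconj σ τ) (joinVec x y) c).trans
          (by rw [joinVec_comp_castAdd])
      · refine finprod_mem_congr rfl fun c _ => ?_
        exact (cyc_semiconj κ hn (natAdd_semiconj σ τ) (joinVec x y) c).trans
          (by rw [joinVec_comp_natAdd])
    · have h1 := cyc_semiconj (fun r u => cyc (fun s v => g r s u v)
        (finSumFinEquiv.permCongr (sumCongr σ τ)) (joinVec x y) (Fin.natAdd p j)) hc
        (castAdd_semiconj σ τ) (joinVec x y) i
      refine h1.trans ?_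
      rw [joinVec_comp_castAdd]
      refine (cyc_semiconj (fun s v => g _ s (word σ x i _) v) hn (natAdd_semiconj σ τ)
        (joinVec x y) j).trans ?_
      rw [joinVec_comp_natAdd]
      rfl
  · rw [Set.disjoint_left]
    rintro _ ⟨a, _, rfl⟩ ⟨b, _, h⟩
    have := congrArg Fin.val h
    simp only [Fin.val_castAdd, Fin.val_natAdd] at this
    omega

theorem sum_kappaUPi (κ : ∀ m : ℕ, (Fin m → A) → ℂ)
    (g : ∀ r s : ℕ, (Fin r → A) → (Fin s → A) → ℂ) (σ : Perm (Fin p)) (τ : Perm (Fin q))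
    (x : Fin p → A) (y : Fin q → A) :
    ∑ᶠ a ∈ {a : Fin (p + q) | a ∈ minReps (finSumFinEquiv.permCongr (sumCongr σ τ)) ∧ (a : ℕ) < p},
      ∑ᶠ b ∈ {b : Fin (p + q) | b ∈ minReps (finSumFinEquiv.permCongr (sumCongr σ τ)) ∧
          p ≤ (b : ℕ)},
        kappaUPi κ g (finSumFinEquiv.permCongr (sumCongr σ τ)) a b (joinVec x y) =
      repSum κ g σ τ x y := by
  rw [minReps_left, minReps_right, finsum_mem_image (Fin.castAdd_injective p q).injOn]
  refine finsum_mem_congr rfl fun i _ => ?_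
  rw [finsum_mem_image (Fin.natAdd_injective q p).injOn]
  exact finsum_mem_congr rfl fun j _ => kappaUPi_eq κ g σ τ x y i j

end Conversion

end AnnNC

namespace AnnNC

section Carrier

open Equiv (Perm)
open Equiv.Perm

theorem finsum_mem_permCongr {α β M : Type*} [AddCommMonoid M] (e : α ≃ β) {S : Set (Perm β)}
    {S' : Set (Perm α)} (h : ∀ π, e.permCongr π ∈ S ↔ π ∈ S') (F : Perm β → M) :
    ∑ᶠ π ∈ S, F π = ∑ᶠ π ∈ S', F (e.permCongr π) := by
  symm
  refine finsum_mem_eq_of_bijOn (g := F) e.permCongr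
    ⟨fun π hπ => (h π).2 hπ, e.permCongr.injective.injOn, ?_⟩ (fun _ _ => rfl)
  intro ρ hρ
  obtain ⟨ρ', rfl⟩ := e.permCongr.surjective ρ
  exact ⟨ρ', (h ρ').1 hρ, rfl⟩

theorem SNC_eq_below (n : ℕ) : SNC n = Below (finRotate n) := by
  ext π
  show _ ↔ Geo π (finRotate n)
  rw [← permLe_iff_geo]
  exact ⟨fun h => ⟨fun x y _ => finRotate_sameCycle x y, h⟩, fun h => h.2⟩

variable {p q : ℕ}

theorem sumCongr_finRotate_sameCycle (i j : Fin p ⊕ Fin q) :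
    (sumCongr (finRotate p) (finRotate q)).SameCycle i j ↔
      (((finSumFinEquiv i : Fin (p + q)) : ℕ) < p ↔ ((finSumFinEquiv j : Fin (p + q)) : ℕ) < p) := by
  rcases i with i | i <;> rcases j with j | j
  · simp [sameCycle_inl_inl, finRotate_sameCycle]
  · simp [not_sameCycle_inl_inr]
  · have h := not_sameCycle_inl_inr (finRotate p) (finRotate q) j i
    rw [sameCycle_comm] at h
    simp [h]
  · simp [sameCycle_inr_inr, finRotate_sameCycle]

theorem permCongr_mem_SDiscNC (π : Perm (Fin p ⊕ Fin q)) :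
    finSumFinEquiv.permCongr π ∈ SDiscNC p q ↔ π ∈ Below (sumCongr (finRotate p) (finRotate q)) := by
  have h := geo_permCongr finSumFinEquiv π (sumCongr (finRotate p) (finRotate q))
  rw [← permLe_iff_geo] at h
  show _ ↔ Geo π _
  rw [← h]
  have h2 : (∀ x y : Fin (p + q), (finSumFinEquiv.permCongr π).SameCycle x y →
      ((x : ℕ) < p ↔ (y : ℕ) < p)) ↔ ∀ x y : Fin (p + q), (finSumFinEquiv.permCongr π).SameCycle x y →
      (finSumFinEquiv.permCongr (sumCongr (finRotate p) (finRotate q))).SameCycle x y := by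
    refine forall_congr' fun x => forall_congr' fun y => ?_
    obtain ⟨i, rfl⟩ := finSumFinEquiv.surjective x
    obtain ⟨j, rfl⟩ := finSumFinEquiv.surjective y
    rw [sameCycle_permCongr, sameCycle_permCongr, sumCongr_finRotate_sameCycle]
  exact ⟨fun h' => ⟨h2.1 h'.2, h'.1⟩, fun h' => ⟨h'.2, h2.2 h'.1⟩⟩

theorem numJoin_of_cross {π : Perm (Fin p ⊕ Fin q)} (h : Cross π) :
    numJoin (finSumFinEquiv.permCongr π) (tauPQ p q) = 1 := by
  obtain ⟨a, b, hab⟩ := h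
  rw [numJoin, Nat.card_eq_one_iff_unique]
  set s := orbitSetoid (finSumFinEquiv.permCongr π) ⊔ orbitSetoid (tauPQ p q) with hs
  have hT : ∀ i j, (sumCongr (finRotate p) (finRotate q)).SameCycle i j →
      s (finSumFinEquiv i) (finSumFinEquiv j) := fun i j hij =>
    (le_sup_right : orbitSetoid (tauPQ p q) ≤ s) ((sameCycle_permCongr _ _ _ _).2 hij)
  have hb : s (finSumFinEquiv (Sum.inl a)) (finSumFinEquiv (Sum.inr b)) :=
    (le_sup_left : orbitSetoid (finSumFinEquiv.permCongr π) ≤ s)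
      ((sameCycle_permCongr _ _ _ _).2 hab)
  have key : ∀ i, s (finSumFinEquiv (Sum.inl a)) (finSumFinEquiv i) := by
    rintro (i | i)
    · exact hT _ _ ((sameCycle_inl_inl _ _ _ _).2 (finRotate_sameCycle _ _))
    · exact s.trans hb (hT _ _ ((sameCycle_inr_inr _ _ _ _).2 (finRotate_sameCycle _ _)))
  refine ⟨⟨fun c d => ?_⟩, ⟨Quotient.mk s (finSumFinEquiv (Sum.inl a))⟩⟩
  induction c using Quotient.inductionOn with
  | h x =>
    induction d using Quotient.inductionOn with
    | h y =>
      obtain ⟨i, rfl⟩ := finSumFinEquiv.surjective x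
      obtain ⟨j, rfl⟩ := finSumFinEquiv.surjective y
      exact Quotient.sound (s.trans (s.symm (key i)) (key j))

theorem permCongr_mem_SAnnNC (hp : 0 < p) (hq : 0 < q) (π : Perm (Fin p ⊕ Fin q)) :
    finSumFinEquiv.permCongr π ∈ SAnnNC p q ↔
      π ∈ AnnOn (sumCongr (finRotate p) (finRotate q)) := by
  have hc : (∃ a b : Fin (p + q), (finSumFinEquiv.permCongr π).SameCycle a b ∧ (a : ℕ) < p ∧
      p ≤ (b : ℕ)) ↔ Cross π := by
    constructor
    · rintro ⟨a, b, hab, ha, hb⟩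
      obtain ⟨i, rfl⟩ := finSumFinEquiv.surjective a
      obtain ⟨j, rfl⟩ := finSumFinEquiv.surjective b
      rw [sameCycle_permCongr] at hab
      rcases i with i | i
      · rcases j with j | j
        · exact absurd j.2 (not_lt.2 hb)
        · exact ⟨i, j, hab⟩
      · exact absurd ha (not_lt.2 (Nat.le_add_right _ _))
    · rintro ⟨i, j, hij⟩
      exact ⟨_, _, (sameCycle_permCongr finSumFinEquiv _ _ _).2 hij, i.2, Nat.le_add_right _ _⟩
  show _ ∧ _ ↔ Cross π ∧ _
  rw [hc, and_comm]
  refine and_congr_right fun h => ?_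
  have hT : numOrbits (sumCongr (finRotate p) (finRotate q)) = 2 := by
    rw [numOrbits_sumCongr, numOrbits_finRotate hp, numOrbits_finRotate hq]
  rw [isNoncrossingOn_iff, numJoin_of_cross h, tauPQ, ← Equiv.Perm.sumCongr, permCongr_inv_mul,
    numOrbits_permCongr, numOrbits_permCongr, numOrbits_permCongr, hT,
    Nat.card_congr (finSumFinEquiv (m := p) (n := q))]

end Carrier

end AnnNC

namespace AnnNC

section MobiusFunction

open Equiv (Perm)
open Equiv.Perm

theorem finsum_mem_permCongr_bool {α β M : Type*} [Finite β] [AddCommMonoid M] (e : α ≃ β)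
    (S : Set (Perm β × Bool)) (F : Perm β × Bool → M) :
    ∑ᶠ c ∈ S, F c = ∑ᶠ ρ ∈ {ρ | (e.permCongr ρ, false) ∈ S}, F (e.permCongr ρ, false) +
      ∑ᶠ ρ ∈ {ρ | (e.permCongr ρ, true) ∈ S}, F (e.permCongr ρ, true) := by
  have hinj : ∀ b : Bool, Function.Injective fun ρ : Perm α => (e.permCongr ρ, b) :=
    fun b ρ ρ' h => e.permCongr.injective (congrArg Prod.fst h)
  have hS : S = (fun ρ : Perm α => (e.permCongr ρ, false)) '' {ρ | (e.permCongr ρ, false) ∈ S} ∪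
      (fun ρ : Perm α => (e.permCongr ρ, true)) '' {ρ | (e.permCongr ρ, true) ∈ S} := by
    ext ⟨ρ, b⟩
    obtain ⟨ρ, rfl⟩ := e.permCongr.surjective ρ
    cases b <;> simp
  conv_lhs => rw [hS]
  rw [finsum_mem_union ?_ (Set.toFinite _) (Set.toFinite _), finsum_mem_image (hinj _).injOn,
    finsum_mem_image (hinj _).injOn]
  rw [Set.disjoint_left]
  rintro _ ⟨a, _, rfl⟩ ⟨b, _, h⟩
  exact absurd (congrArg Prod.snd h) (by simp)

variable {p q : ℕ}

/-- The interval from `a` to the maximum of the self-dual annular poset. -/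
def upperInterval (p q : ℕ) (a : Perm (Fin (p + q)) × Bool) : Set (Perm (Fin (p + q)) × Bool) :=
  {c | c ∈ NCSDSet p q ∧ ncsdLe p q a c ∧ ncsdLe p q c (tauPQ p q, true)}

theorem ncsdLe_top (c : Perm (Fin (p + q)) × Bool) : ncsdLe p q c (tauPQ p q, true) := by
  refine Or.inr ⟨rfl, (permLe_iff_geo _ _).2 ?_⟩
  show Geo ((tauPQ p q)⁻¹ * tauPQ p q) _
  rw [inv_mul_cancel]
  exact geo_one _

theorem ncsdLe_hat_iff (π ρ : Perm (Fin p ⊕ Fin q)) (b : Bool) :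
    ncsdLe p q (finSumFinEquiv.permCongr π, b) (finSumFinEquiv.permCongr ρ, true) ↔
      Geo (ρ⁻¹ * sumCongr (finRotate p) (finRotate q))
        (π⁻¹ * sumCongr (finRotate p) (finRotate q)) := by
  unfold ncsdLe
  rw [permLe_iff_geo, permLe_iff_geo, tauPQ, ← Equiv.Perm.sumCongr, permCongr_inv_mul,
    permCongr_inv_mul, geo_permCongr, geo_permCongr]
  simp

theorem ncsdLe_plain_iff (π ρ : Perm (Fin p ⊕ Fin q)) :
    ncsdLe p q (finSumFinEquiv.permCongr π, false) (finSumFinEquiv.permCongr ρ, false) ↔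
      Geo π ρ := by
  unfold ncsdLe
  rw [permLe_iff_geo, geo_permCongr]
  simp

theorem not_ncsdLe_hat_plain (π ρ : Perm (Fin (p + q))) :
    ¬ ncsdLe p q (π, true) (ρ, false) := by
  simp [ncsdLe]

theorem hat_mem_NCSDSet (π : Perm (Fin p ⊕ Fin q)) :
    (finSumFinEquiv.permCongr π, true) ∈ NCSDSet p q ↔
      π ∈ Below (sumCongr (finRotate p) (finRotate q)) := by
  rw [← permCongr_mem_SDiscNC]
  simp [NCSDSet]

theorem plain_mem_NCSDSet (hp : 0 < p) (hq : 0 < q) (π : Perm (Fin p ⊕ Fin q)) :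
    (finSumFinEquiv.permCongr π, false) ∈ NCSDSet p q ↔
      π ∈ Below (sumCongr (finRotate p) (finRotate q)) ∨
        π ∈ AnnOn (sumCongr (finRotate p) (finRotate q)) := by
  rw [← permCongr_mem_SDiscNC, ← permCongr_mem_SAnnNC hp hq]
  simp [NCSDSet]

variable {M : Type*} [AddCommMonoid M]

theorem sum_upperInterval_hat {π : Perm (Fin p ⊕ Fin q)}
    (hπ : π ∈ Below (sumCongr (finRotate p) (finRotate q)))
    (F : Perm (Fin (p + q)) × Bool → M) :
    ∑ᶠ c ∈ upperInterval p q (finSumFinEquiv.permCongr π, true), F c =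
      ∑ᶠ ρ ∈ {ρ | ρ ∈ Below (sumCongr (finRotate p) (finRotate q)) ∧ Geo π ρ},
        F (finSumFinEquiv.permCongr ρ, true) := by
  rw [finsum_mem_permCongr_bool finSumFinEquiv]
  have h1 : {ρ : Perm (Fin p ⊕ Fin q) | (finSumFinEquiv.permCongr ρ, false) ∈
      upperInterval p q (finSumFinEquiv.permCongr π, true)} = ∅ :=
    Set.eq_empty_of_forall_notMem fun ρ hρ => not_ncsdLe_hat_plain _ _ hρ.2.1
  have h2 : {ρ : Perm (Fin p ⊕ Fin q) | (finSumFinEquiv.permCongr ρ, true) ∈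
      upperInterval p q (finSumFinEquiv.permCongr π, true)} =
      {ρ | ρ ∈ Below (sumCongr (finRotate p) (finRotate q)) ∧ Geo π ρ} := by
    ext ρ
    show _ ∧ _ ∧ _ ↔ _ ∧ _
    rw [hat_mem_NCSDSet, ncsdLe_hat_iff, and_iff_left (ncsdLe_top _)]
    exact and_congr_right fun hρ => geo_complement_iff hπ hρ
  rw [h1, h2, finsum_mem_empty, zero_add]

theorem sum_upperInterval_plain (hp : 0 < p) (hq : 0 < q) (π : Perm (Fin p ⊕ Fin q))
    (F : Perm (Fin (p + q)) × Bool → M) :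
    ∑ᶠ c ∈ upperInterval p q (finSumFinEquiv.permCongr π, false), F c =
      ∑ᶠ ρ ∈ {ρ | ρ ∈ Below (sumCongr (finRotate p) (finRotate q)) ∧ Geo π ρ},
        F (finSumFinEquiv.permCongr ρ, false) +
      ∑ᶠ ρ ∈ {ρ | ρ ∈ AnnOn (sumCongr (finRotate p) (finRotate q)) ∧ Geo π ρ},
        F (finSumFinEquiv.permCongr ρ, false) +
      ∑ᶠ ρ ∈ {ρ | ρ ∈ Below (sumCongr (finRotate p) (finRotate q)) ∧
          Geo (ρ⁻¹ * sumCongr (finRotate p) (finRotate q))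
            (π⁻¹ * sumCongr (finRotate p) (finRotate q))},
        F (finSumFinEquiv.permCongr ρ, true) := by
  rw [finsum_mem_permCongr_bool finSumFinEquiv]
  have h1 : {ρ : Perm (Fin p ⊕ Fin q) | (finSumFinEquiv.permCongr ρ, false) ∈
      upperInterval p q (finSumFinEquiv.permCongr π, false)} =
      {ρ | ρ ∈ Below (sumCongr (finRotate p) (finRotate q)) ∧ Geo π ρ} ∪
        {ρ | ρ ∈ AnnOn (sumCongr (finRotate p) (finRotate q)) ∧ Geo π ρ} := by
    ext ρ
    show _ ∧ _ ∧ _ ↔ (_ ∧ _) ∨ (_ ∧ _)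
    rw [plain_mem_NCSDSet hp hq, ncsdLe_plain_iff, and_iff_left (ncsdLe_top _), or_and_right]
  have h2 : {ρ : Perm (Fin p ⊕ Fin q) | (finSumFinEquiv.permCongr ρ, true) ∈
      upperInterval p q (finSumFinEquiv.permCongr π, false)} =
      {ρ | ρ ∈ Below (sumCongr (finRotate p) (finRotate q)) ∧
          Geo (ρ⁻¹ * sumCongr (finRotate p) (finRotate q))
            (π⁻¹ * sumCongr (finRotate p) (finRotate q))} := by
    ext ρ
    show _ ∧ _ ∧ _ ↔ _ ∧ _
    rw [hat_mem_NCSDSet, ncsdLe_hat_iff, and_iff_left (ncsdLe_top _)]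
  rw [h1, h2, finsum_mem_union ?_ (Set.toFinite _) (Set.toFinite _)]
  rw [Set.disjoint_left]
  rintro ρ ⟨h, _⟩ ⟨h', _⟩
  exact Geo.not_cross h h'.1

theorem mobiusPair_of_mobius (hp : 0 < p) (hq : 0 < q) {m : Perm (Fin (p + q)) × Bool → ℤ}
    (h1 : ∑ᶠ c ∈ upperInterval p q (tauPQ p q, true), m c = 1)
    (h0 : ∀ a ∈ NCSDSet p q, a ≠ (tauPQ p q, true) → ∑ᶠ c ∈ upperInterval p q a, m c = 0) :
    MobiusPair (finRotate p) (finRotate q)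
      (fun π => (m (finSumFinEquiv.permCongr π, false) : ℂ))
      (fun π => (m (finSumFinEquiv.permCongr π, true) : ℂ)) := by
  have hcast : ∀ a, ((∑ᶠ c ∈ upperInterval p q a, m c : ℤ) : ℂ) =
      ∑ᶠ c ∈ upperInterval p q a, (m c : ℂ) := fun a =>
    (Int.castAddHom ℂ).map_finsum_mem _ (Set.toFinite _)
  have hhat : ∀ π ∈ Below (sumCongr (finRotate p) (finRotate q)),
      ∀ _ : Decidable (π = sumCongr (finRotate p) (finRotate q)),
      ∑ᶠ ρ ∈ {ρ | ρ ∈ Below (sumCongr (finRotate p) (finRotate q)) ∧ Geo π ρ},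
        (m (finSumFinEquiv.permCongr ρ, true) : ℂ) =
      if π = sumCongr (finRotate p) (finRotate q) then 1 else 0 := by
    intro π hπ _
    rw [← sum_upperInterval_hat hπ (fun c => (m c : ℂ)), ← hcast]
    split_ifs with h
    · subst h
      exact (congrArg _ h1).trans Int.cast_one
    · rw [h0 _ ((hat_mem_NCSDSet π).2 hπ) fun h' =>
        h (finSumFinEquiv.permCongr.injective (congrArg Prod.fst h')), Int.cast_zero]
  have hplain : ∀ π : Perm (Fin p ⊕ Fin q), (finSumFinEquiv.permCongr π, false) ∈ NCSDSet p q →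
      ∑ᶠ c ∈ upperInterval p q (finSumFinEquiv.permCongr π, false), (m c : ℂ) = 0 := by
    intro π hπ
    rw [← hcast, h0 _ hπ (fun h' => by simpa using congrArg Prod.snd h'), Int.cast_zero]
  refine ⟨fun π hπ => hhat π hπ _, fun π hπ => ?_, fun π hπ => ?_⟩
  · rw [← hhat π hπ (Classical.propDecidable _),
      ← hplain π ((plain_mem_NCSDSet hp hq π).2 (Or.inl hπ)),
      sum_upperInterval_plain hp hq]
    congr 1
    refine finsum_mem_congr ?_ fun _ _ => rfl
    ext ρ
    exact and_congr_right fun hρ => (geo_complement_iff hπ hρ).symm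
  · rw [← hplain π ((plain_mem_NCSDSet hp hq π).2 (Or.inr hπ)), sum_upperInterval_plain hp hq]
    have he : {ρ | ρ ∈ Below (sumCongr (finRotate p) (finRotate q)) ∧ Geo π ρ} = ∅ := by
      refine Set.eq_empty_of_forall_notMem fun ρ hρ => ?_
      obtain ⟨x, y, hxy⟩ := hπ.1
      exact Geo.not_cross hρ.1 ⟨x, y, Geo.sameCycle hρ.2 hxy⟩
    rw [he, finsum_mem_empty, zero_add]
    congr 1
    refine finsum_mem_congr ?_ fun _ _ => rfl
    ext ρ
    exact and_congr_right fun hρ => (geo_complement_iff_mem_annOn (numOrbits_finRotate hp)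
      (numOrbits_finRotate hq) hπ hρ).symm

end MobiusFunction

end AnnNC

namespace AnnNC

section Moments

open Equiv (Perm)
open Equiv.Perm

variable {A : Type*}

theorem cyclic_prod [Monoid A] {φ : A → ℂ} (h : ∀ a b, φ (a * b) = φ (b * a)) :
    Cyclic fun m (x : Fin m → A) => φ (List.ofFn x).prod := by
  intro m x
  rcases m with _ | m
  · rw [Subsingleton.elim (x ∘ finRotate 0) x]
  · have h1 : (List.ofFn (x ∘ finRotate (m + 1))).prod =
        (List.ofFn fun i : Fin m => x i.succ).prod * x 0 := by
      rw [List.ofFn_succ', List.concat_eq_append, List.prod_append, List.prod_singleton]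
      simp
    show φ _ = φ _
    rw [h1, h, List.ofFn_succ, List.prod_cons]

theorem biCyclic_prod [Monoid A] {φ : A → A → ℂ} (h : ∀ a b c, φ (a * b) c = φ (b * a) c)
    (h' : ∀ a b c, φ a (b * c) = φ a (c * b)) :
    BiCyclic fun r s (x : Fin r → A) (y : Fin s → A) => φ (List.ofFn x).prod (List.ofFn y).prod :=
  ⟨fun _ y => cyclic_prod (φ := fun a => φ a (List.ofFn y).prod) fun a b => h a b _,
    fun _ x => cyclic_prod (φ := φ (List.ofFn x).prod) (h' _)⟩

theorem prod_ofFn_rev [Monoid A] {T : A → A} (hmul : ∀ a b, T (a * b) = T b * T a)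
    (hinv : ∀ a, T (T a) = a) {m : ℕ} (v : Fin m → A) :
    (List.ofFn (T ∘ v ∘ Fin.rev)).prod = T (List.ofFn v).prod := by
  induction m with
  | zero =>
    have h : T 1 = 1 := by
      have h1 := hmul (T 1) 1
      rwa [mul_one, hinv, mul_one, eq_comm] at h1
    simp [h]
  | succ m ih =>
    rw [List.ofFn_succ', List.concat_eq_append, List.prod_append, List.prod_singleton,
      List.ofFn_succ, List.prod_cons, hmul, ← ih]
    simp [Function.comp_def, Fin.rev_castSucc]

theorem cycleList_eq [Ring A] {n : ℕ} (π : Perm (Fin n)) (x : Fin n → A) (a : Fin n) :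
    cycleList π x a = (List.ofFn (word π x a (Function.minimalPeriod π a))).prod := by
  unfold cycleList
  congr 1
  refine List.ext_getElem (by simp) fun i h1 h2 => ?_
  simp [word]

theorem kappaPerm_finRotate {n : ℕ} (hn : 0 < n) (κ : ∀ m : ℕ, (Fin m → A) → ℂ) (x : Fin n → A) :
    kappaPerm κ (finRotate n) x = κ n x := by
  unfold kappaPerm
  rw [minReps_finRotate hn, finprod_mem_singleton]
  exact cyc_finRotate κ hn x

/-- Free cumulants inherit traciality from the moments. -/
theorem cyclic_of_moment {f κ : ∀ m : ℕ, (Fin m → A) → ℂ} (hf : Cyclic f)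
    (h : ∀ n : ℕ, 1 ≤ n → ∀ x, f n x = ∑ᶠ π ∈ SNC n, kappaPerm κ π x) : Cyclic κ := by
  intro n
  induction n using Nat.strong_induction_on with
  | _ n ih =>
  intro x
  rcases Nat.eq_zero_or_pos n with rfl | hn
  · rw [Subsingleton.elim (x ∘ finRotate 0) x]
  let κ' : ∀ m : ℕ, (Fin m → A) → ℂ := fun m v => if m < n then κ m v else 0
  have hκ' : Cyclic κ' := by
    intro m v
    by_cases hm : m < n
    · simp only [κ', if_pos hm, ih m hm]
    · simp only [κ', if_neg hm]
  have hrest : ∀ v : Fin n → A, ∑ᶠ π ∈ Below (finRotate n) \ {finRotate n}, kappaPerm κ π v =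
      ∑ᶠ π ∈ Below (finRotate n), kprod κ' π v := by
    intro v
    rw [sum_below_finRotate, kprod_finRotate hκ' hn, show κ' n v = 0 from if_neg (lt_irrefl n),
      zero_add]
    refine finsum_mem_congr rfl fun π hπ => ?_
    rw [← kappaPerm_eq_kprod hκ']
    refine finprod_mem_congr rfl fun a _ => ?_
    exact (if_pos (minimalPeriod_lt (numOrbits_ne_one_of_below hn hπ.1 hπ.2) a)).symm
  have hcyc : ∑ᶠ π ∈ Below (finRotate n), kprod κ' π (x ∘ finRotate n) =
      ∑ᶠ π ∈ Below (finRotate n), kprod κ' π x := by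
    conv_rhs => rw [← permCongr_self (finRotate n) (finRotate n) rfl]
    rw [sum_below_permCongr]
    exact finsum_mem_congr rfl fun ρ _ => (kprod_permCongr hκ' _ ρ x).symm
  have key : ∀ v, f n v = κ n v + ∑ᶠ π ∈ Below (finRotate n), kprod κ' π v := by
    intro v
    rw [h n hn, SNC_eq_below, sum_below_finRotate, kappaPerm_finRotate hn, hrest]
  have h1 := key (x ∘ finRotate n)
  rw [hf, key x, hcyc] at h1
  exact (add_right_cancel h1).symm

theorem momentCumulant_of_moment {f κ : ∀ m : ℕ, (Fin m → A) → ℂ} (hκ : Cyclic κ)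
    (h : ∀ n : ℕ, 1 ≤ n → ∀ x, f n x = ∑ᶠ π ∈ SNC n, kappaPerm κ π x) : MomentCumulant f κ := by
  intro n hn x
  rw [h n hn, SNC_eq_below]
  exact finsum_mem_congr rfl fun π _ => kappaPerm_eq_kprod hκ π x

theorem annSum_rev_biCyclic {κ : ∀ m : ℕ, (Fin m → A) → ℂ} (hκ : Cyclic κ) (T : A → A) :
    BiCyclic fun r s x y => annSum κ r s x (T ∘ y ∘ Fin.rev) := by
  have h := annSum_biCyclic hκ
  refine ⟨fun s y => h.1 s _, fun r x s y => ?_⟩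
  have h1 : T ∘ y ∘ Fin.rev = (T ∘ (y ∘ finRotate s) ∘ Fin.rev) ∘ finRotate s := by
    funext i
    have h2 := revPerm_permCongr_finRotate_inv s
    have h3 : finRotate s i = Fin.rev ((finRotate s)⁻¹ (Fin.rev i)) := by
      conv_lhs => rw [← h2]
      rfl
    simp only [Function.comp_apply]
    rw [h3, Fin.rev_rev, ← Equiv.Perm.mul_apply, mul_inv_cancel, Equiv.Perm.one_apply]
  show annSum κ r s x (T ∘ (y ∘ finRotate s) ∘ Fin.rev) = annSum κ r s x (T ∘ y ∘ Fin.rev)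
  rw [h1]
  exact (h.2 r x s _).symm

end Moments

end AnnNC

namespace AnnNC

section Assembly

open Equiv (Perm)
open Equiv.Perm

variable {A : Type*} {p q : ℕ}

theorem sum_SAnnNC_kappaPerm (hp : 0 < p) (hq : 0 < q) {κ : ∀ m : ℕ, (Fin m → A) → ℂ}
    (hκ : Cyclic κ) (F : Perm (Fin (p + q)) → ℂ) (x : Fin p → A) (y : Fin q → A) :
    ∑ᶠ π ∈ SAnnNC p q, F π * kappaPerm κ π (joinVec x y) =
      ∑ᶠ π ∈ AnnOn (sumCongr (finRotate p) (finRotate q)),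
        F (finSumFinEquiv.permCongr π) * kprod κ π (Sum.elim x y) := by
  rw [finsum_mem_permCongr finSumFinEquiv (permCongr_mem_SAnnNC hp hq)]
  refine finsum_mem_congr rfl fun π _ => ?_
  rw [kappaPerm_eq_kprod hκ, kprod_permCongr hκ, joinVec_comp]

theorem sum_SDiscNC_kappaPerm {κ : ∀ m : ℕ, (Fin m → A) → ℂ} (hκ : Cyclic κ)
    (F : Perm (Fin (p + q)) → ℂ) (x : Fin p → A) (y : Fin q → A) :
    ∑ᶠ π ∈ SDiscNC p q, F π * kappaPerm κ π (joinVec x y) =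
      ∑ᶠ π ∈ Below (sumCongr (finRotate p) (finRotate q)),
        F (finSumFinEquiv.permCongr π) * kprod κ π (Sum.elim x y) := by
  rw [finsum_mem_permCongr finSumFinEquiv permCongr_mem_SDiscNC]
  refine finsum_mem_congr rfl fun π _ => ?_
  rw [kappaPerm_eq_kprod hκ, kprod_permCongr hκ, joinVec_comp]

variable [Ring A] [Algebra ℂ A]

theorem momCumRel_iff (hp : 0 < p) (hq : 0 < q) (φ₂ : A →ₗ[ℂ] A →ₗ[ℂ] ℂ) (T : A →ₗ[ℂ] A)
    {κ : ∀ m : ℕ, (Fin m → A) → ℂ} (hκ : Cyclic κ)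
    (κ₂ : ∀ r s : ℕ, (Fin r → A) → (Fin s → A) → ℂ) (x : Fin p → A) (y : Fin q → A) :
    MomCumRel φ₂ T κ κ₂ p q x y ↔
      φ₂ (List.ofFn x).prod (List.ofFn y).prod =
        annSum κ p q x y + annSum κ p q x (T ∘ y ∘ Fin.rev) +
          ∑ᶠ σ ∈ Below (finRotate p), ∑ᶠ τ ∈ Below (finRotate q), repSum κ κ₂ σ τ x y := by
  have h : ∀ w : Fin q → A, ∑ᶠ π ∈ SAnnNC p q, kappaPerm κ π (joinVec x w) = annSum κ p q x w := by
    intro w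
    have := sum_SAnnNC_kappaPerm hp hq hκ (fun _ => 1) x w
    simpa only [one_mul, annSum] using this
  unfold MomCumRel
  rw [h, h, revVec_eq, finsum_mem_permCongr finSumFinEquiv permCongr_mem_SDiscNC,
    sum_below_sumCongr]
  simp only [sum_kappaUPi]

theorem alphaPerm_eq {n : ℕ} (φ₁ : A →ₗ[ℂ] ℂ) (π : Perm (Fin n)) (z : Fin n → A) :
    alphaPerm φ₁ π z = kappaPerm (fun _ x => φ₁ (List.ofFn x).prod) π z :=
  finprod_mem_congr rfl fun a _ => congrArg φ₁ (cycleList_eq π z a)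

theorem alphaUPi_eq (φ₁ : A →ₗ[ℂ] ℂ) (φ₂ : A →ₗ[ℂ] A →ₗ[ℂ] ℂ) (π : Perm (Fin (p + q)))
    (a b : Fin (p + q)) (z : Fin (p + q) → A) :
    alphaUPi φ₁ φ₂ π a b z = kappaUPi (fun _ x => φ₁ (List.ofFn x).prod)
      (fun _ _ x y => φ₂ (List.ofFn x).prod (List.ofFn y).prod) π a b z := by
  unfold alphaUPi kappaUPi
  rw [cycleList_eq, cycleList_eq]
  refine congrArg₂ _ (finprod_mem_congr rfl fun c _ => ?_) rfl
  exact congrArg φ₁ (cycleList_eq π z c)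

theorem explicitCumulantFormula_iff (φ₁ : A →ₗ[ℂ] ℂ) (φ₂ : A →ₗ[ℂ] A →ₗ[ℂ] ℂ) (T : A →ₗ[ℂ] A)
    (κ₂ : ∀ r s : ℕ, (Fin r → A) → (Fin s → A) → ℂ)
    (μ : ∀ p q : ℕ, (Perm (Fin (p + q)) × Bool) → (Perm (Fin (p + q)) × Bool) → ℤ)
    (hp : 0 < p) (hq : 0 < q) (hf : Cyclic fun m (x : Fin m → A) => φ₁ (List.ofFn x).prod)
    (x : Fin p → A) (y : Fin q → A) :
    ExplicitCumulantFormula φ₁ φ₂ T κ₂ μ p q x y ↔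
      κ₂ p q x y =
        2 * ∑ᶠ π ∈ Below (sumCongr (finRotate p) (finRotate q)),
          ((μ p q (finSumFinEquiv.permCongr π, false) (tauPQ p q, true) : ℂ) +
            (μ p q (finSumFinEquiv.permCongr π, true) (tauPQ p q, true) : ℂ)) *
            kprod (fun _ x => φ₁ (List.ofFn x).prod) π (Sum.elim x y) +
        ∑ᶠ π ∈ AnnOn (sumCongr (finRotate p) (finRotate q)),
          (μ p q (finSumFinEquiv.permCongr π, false) (tauPQ p q, true) : ℂ) *
            kprod (fun _ x => φ₁ (List.ofFn x).prod) π (Sum.elim x y) +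
        ∑ᶠ π ∈ AnnOn (sumCongr (finRotate p) (finRotate q)),
          (μ p q (finSumFinEquiv.permCongr π, false) (tauPQ p q, true) : ℂ) *
            kprod (fun _ x => φ₁ (List.ofFn x).prod) π (Sum.elim x (T ∘ y ∘ Fin.rev)) +
        ∑ᶠ π ∈ Below (sumCongr (finRotate p) (finRotate q)),
          (μ p q (finSumFinEquiv.permCongr π, true) (tauPQ p q, true) : ℂ) *
          ∑ᶠ a ∈ {a : Fin (p + q) | a ∈ minReps (finSumFinEquiv.permCongr π) ∧ (a : ℕ) < p},
            ∑ᶠ b ∈ {b : Fin (p + q) | b ∈ minReps (finSumFinEquiv.permCongr π) ∧ p ≤ (b : ℕ)},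
              kappaUPi (fun _ x => φ₁ (List.ofFn x).prod)
                (fun _ _ x y => φ₂ (List.ofFn x).prod (List.ofFn y).prod)
                (finSumFinEquiv.permCongr π) a b (joinVec x y) := by
  unfold ExplicitCumulantFormula
  simp only [alphaPerm_eq, alphaUPi_eq, Int.cast_add, ← mul_finsum_mem]
  rw [sum_SDiscNC_kappaPerm hf (fun π => (μ p q (π, false) (tauPQ p q, true) : ℂ) +
      (μ p q (π, true) (tauPQ p q, true) : ℂ)),
    sum_SAnnNC_kappaPerm hp hq hf (fun π => (μ p q (π, false) (tauPQ p q, true) : ℂ)),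
    sum_SAnnNC_kappaPerm hp hq hf (fun π => (μ p q (π, false) (tauPQ p q, true) : ℂ)), revVec_eq,
    finsum_mem_permCongr finSumFinEquiv permCongr_mem_SDiscNC]

end Assembly

end AnnNC

attribute [local instance] Classical.propDecidable

open AnnNC in
/-- in a real second-order probability space (with `φ₁` tracial and `φ₂`
cyclically invariant in each argument), a family of second-order cumulant functionals
`κ₂` satisfies the second-order moment–cumulant relation for all `p, q ≥ 1` if and only if
each `κ_{p,q}` is given by the explicit Möbius-function formula. -/
theorem stmt18 {A : Type*} [Ring A] [Algebra ℂ A]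
    (φ₁ : A →ₗ[ℂ] ℂ) (φ₂ : A →ₗ[ℂ] A →ₗ[ℂ] ℂ) (T : A →ₗ[ℂ] A)
    (hφ₁1 : φ₁ 1 = 1)
    (htr : ∀ a b : A, φ₁ (a * b) = φ₁ (b * a))
    (hcyc1 : ∀ a b c : A, φ₂ (a * b) c = φ₂ (b * a) c)
    (hcyc2 : ∀ a b c : A, φ₂ a (b * c) = φ₂ a (c * b))
    (hTmul : ∀ a b : A, T (a * b) = T b * T a)
    (hTT : ∀ a : A, T (T a) = a)
    (hφT : ∀ a : A, φ₁ (T a) = φ₁ a)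
    (κfree : ∀ m : ℕ, (Fin m → A) → ℂ)
    (hκfree : ∀ n : ℕ, 1 ≤ n → ∀ x : Fin n → A,
        φ₁ ((List.ofFn x).prod) = ∑ᶠ π ∈ SNC n, kappaPerm κfree π x)
    (μ : ∀ p q : ℕ,
      (Equiv.Perm (Fin (p + q)) × Bool) → (Equiv.Perm (Fin (p + q)) × Bool) → ℤ)
    (hμ0 : ∀ p q a b, ¬ ncsdLe p q a b → μ p q a b = 0)
    (hμ1 : ∀ p q : ℕ, ∀ a ∈ NCSDSet p q, ∀ b ∈ NCSDSet p q, ncsdLe p q a b →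
        (∑ᶠ c ∈ {c | c ∈ NCSDSet p q ∧ ncsdLe p q a c ∧ ncsdLe p q c b}, μ p q a c) =
          if a = b then 1 else 0)
    (hμ2 : ∀ p q : ℕ, ∀ a ∈ NCSDSet p q, ∀ b ∈ NCSDSet p q, ncsdLe p q a b →
        (∑ᶠ c ∈ {c | c ∈ NCSDSet p q ∧ ncsdLe p q a c ∧ ncsdLe p q c b}, μ p q c b) =
          if a = b then 1 else 0)
    (κ₂ : ∀ r s : ℕ, (Fin r → A) → (Fin s → A) → ℂ) :
    (∀ p q : ℕ, 1 ≤ p → 1 ≤ q → ∀ (x : Fin p → A) (y : Fin q → A),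
        MomCumRel φ₂ T κfree κ₂ p q x y) ↔
    (∀ p q : ℕ, 1 ≤ p → 1 ≤ q → ∀ (x : Fin p → A) (y : Fin q → A),
        ExplicitCumulantFormula φ₁ φ₂ T κ₂ μ p q x y) := by
  have hf : Cyclic fun m (x : Fin m → A) => φ₁ (List.ofFn x).prod := cyclic_prod htr
  have hψ : BiCyclic fun r s (x : Fin r → A) (y : Fin s → A) =>
      φ₂ (List.ofFn x).prod (List.ofFn y).prod :=
    biCyclic_prod (φ := fun a b => φ₂ a b) hcyc1 hcyc2
  have hκ : Cyclic κfree := cyclic_of_moment hf hκfree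
  have hm := momentCumulant_of_moment hκ hκfree
  have hT : ∀ m (v : Fin m → A), φ₁ (List.ofFn (T ∘ v ∘ Fin.rev)).prod = φ₁ (List.ofFn v).prod :=
    fun m v => by rw [prod_ofFn_rev hTmul hTT, hφT]
  have h1 := annSum_biCyclic hκ
  have h2 := annSum_rev_biCyclic hκ T
  have hdiff : BiCyclic fun r s (x : Fin r → A) (y : Fin s → A) =>
      φ₂ (List.ofFn x).prod (List.ofFn y).prod -
        (annSum κfree r s x y + annSum κfree r s x (T ∘ y ∘ Fin.rev)) := by
    refine ⟨fun s y r x => ?_, fun r x s y => ?_⟩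
    · exact congrArg₂ (· - ·) (hψ.1 s y r x)
        (congrArg₂ (· + ·) (h1.1 s y r x) (h2.1 s y r x))
    · exact congrArg₂ (· - ·) (hψ.2 r x s y)
        (congrArg₂ (· + ·) (h1.2 r x s y) (h2.2 r x s y))
  obtain ⟨g, hg, hgrel⟩ := exists_markedMoment₂_eq hκ hdiff
  have hrel : ∀ r s, 0 < r → 0 < s → ∀ (x : Fin r → A) (y : Fin s → A),
      φ₂ (List.ofFn x).prod (List.ofFn y).prod = annSum κfree r s x y +
        annSum κfree r s x (T ∘ y ∘ Fin.rev) + markedMoment₂ κfree g r s x y :=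
    fun r s hr hs x y => by rw [hgrel r s hr hs x y, add_sub_cancel]
  have hexp : ∀ p q : ℕ, 1 ≤ p → 1 ≤ q → ∀ (x : Fin p → A) (y : Fin q → A),
      ExplicitCumulantFormula φ₁ φ₂ T κ₂ μ p q x y ↔ κ₂ p q x y = g p q x y := by
    intro p q hp hq x y
    have htop : (tauPQ p q, true) ∈ NCSDSet p q :=
      (hat_mem_NCSDSet (Equiv.Perm.sumCongr (finRotate p) (finRotate q))).2 (geo_self _)
    have H := mobiusPair_of_mobius hp hq (m := fun c => μ p q c (tauPQ p q, true))
      ((hμ2 p q _ htop _ htop (ncsdLe_top _)).trans (if_pos rfl))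
      fun a ha hne => (hμ2 p q a ha _ htop (ncsdLe_top _)).trans (if_neg hne)
    have hc := H.cumulant_eq (ψ := fun r s (x : Fin r → A) (y : Fin s → A) =>
      φ₂ (List.ofFn x).prod (List.ofFn y).prod) (V := fun π =>
        ∑ᶠ a ∈ {a | a ∈ minReps (finSumFinEquiv.permCongr π) ∧ (a : ℕ) < p},
          ∑ᶠ b ∈ {b | b ∈ minReps (finSumFinEquiv.permCongr π) ∧ p ≤ (b : ℕ)},
            kappaUPi (fun _ x => φ₁ (List.ofFn x).prod)
              (fun _ _ x y => φ₂ (List.ofFn x).prod (List.ofFn y).prod)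
              (finSumFinEquiv.permCongr π) a b (joinVec x y)) hp hq hf hκ hm hT hg hrel x y
      fun σ τ => (sum_kappaUPi _ _ σ τ x y).trans (repSum_eq_markSum₂ hf hψ σ τ x y)
    rw [explicitCumulantFormula_iff φ₁ φ₂ T κ₂ μ hp hq hf]
    exact ⟨fun h => h.trans hc.symm, fun h => h.trans hc⟩
  have hrep : ∀ p q : ℕ, 1 ≤ p → 1 ≤ q → ∀ (x : Fin p → A) (y : Fin q → A),
      MomCumRel φ₂ T κfree κ₂ p q x y ↔
      ∑ᶠ σ ∈ Below (finRotate p), ∑ᶠ τ ∈ Below (finRotate q), repSum κfree κ₂ σ τ x y =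
        ∑ᶠ σ ∈ Below (finRotate p), ∑ᶠ τ ∈ Below (finRotate q), repSum κfree g σ τ x y := by
    intro p q hp hq x y
    have h3 : ∑ᶠ σ ∈ Below (finRotate p), ∑ᶠ τ ∈ Below (finRotate q), repSum κfree g σ τ x y =
        markedMoment₂ κfree g p q x y :=
      finsum_mem_congr rfl fun σ _ => finsum_mem_congr rfl fun τ _ => repSum_eq_markSum₂ hκ hg _ _ _ _
    rw [momCumRel_iff hp hq φ₂ T hκ, h3, hgrel p q hp hq x y, eq_sub_iff_add_eq', eq_comm]
  constructor
  · intro h p q hp hq x y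
    refine (hexp p q hp hq x y).2 ?_
    exact eq_of_sum_repSum_eq (fun r s hr hs x y => (hrep r s hr hs x y).1 (h r s hr hs x y))
      p q hp hq x y
  · intro h p q hp hq x y
    refine (hrep p q hp hq x y).2 ?_
    refine finsum_mem_congr rfl fun σ _ => finsum_mem_congr rfl fun τ _ => ?_
    refine repSum_congr (fun a b v w => ?_) x y
    have ha := minimalPeriod_perm_pos σ a
    have hb := minimalPeriod_perm_pos τ b
    exact (hexp _ _ ha hb v w).1 (h _ _ ha hb v w)
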